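/- For every finite set Γ of formulae and every formula φ of the propositional modal μ-calculus: Γ ⊢ φ is derivable in the Natural Deduction system N(μK) if and only if Γ ⊨ φ (soundness and completeness of N(μK) with respect to the finitary truth consequence relation). -/

import Mathlib

namespace MuCalc

/-- Preformulae of the propositional modal μ-calculus over actions `Act` and atomic
propositional letters `Atom`; propositional variables are rendered by de Bruijn
indices (`var n`), and `mu A` binds the variable with index `0` in `A`. -/
inductive Fm (Act Atom : Type) : Type
  | atom : Atom → Fm Act Atom
  | ff   : Fm Act Atom
  | neg  : Fm Act Atom → Fm Act Atom
  | imp  : Fm Act Atom → Fm Act Atom → Fm Act Atom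
  | box  : Act → Fm Act Atom → Fm Act Atom
  | var  : ℕ → Fm Act Atom
  | mu   : Fm Act Atom → Fm Act Atom
  deriving DecidableEq

variable {Act Atom : Type}

/-- Shift: increment every free de Bruijn variable `≥ c` by one. -/
def shiftFm : ℕ → Fm Act Atom → Fm Act Atom
  | _, .atom p => .atom p
  | _, .ff => .ff
  | c, .neg A => .neg (shiftFm c A)
  | c, .imp A B => .imp (shiftFm c A) (shiftFm c B)
  | c, .box a A => .box a (shiftFm c A)
  | c, .var n => if n < c then .var n else .var (n + 1)
  | c, .mu A => .mu (shiftFm (c + 1) A)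

/-- Capture-avoiding substitution `A[ψ/x]` of the preformula `ψ` for the free
variable `x` of `A` (all other variables are left unchanged). -/
def subst : Fm Act Atom → ℕ → Fm Act Atom → Fm Act Atom
  | .atom p, _, _ => .atom p
  | .ff, _, _ => .ff
  | .neg A, x, ψ => .neg (subst A x ψ)
  | .imp A B, x, ψ => .imp (subst A x ψ) (subst B x ψ)
  | .box a A, x, ψ => .box a (subst A x ψ)
  | .var n, x, ψ => if n = x then ψ else .var n
  | .mu A, x, ψ => .mu (subst A (x + 1) (shiftFm 0 ψ))

/-- Instantiation of a bound variable: replace `var x` by `ψ` and lower the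
variables above `x`; `instVar A 0 ψ` is `A[ψ/x]` where `x` is the outermost
bound variable of `mu A`. -/
def instVar : Fm Act Atom → ℕ → Fm Act Atom → Fm Act Atom
  | .atom p, _, _ => .atom p
  | .ff, _, _ => .ff
  | .neg A, x, ψ => .neg (instVar A x ψ)
  | .imp A B, x, ψ => .imp (instVar A x ψ) (instVar B x ψ)
  | .box a A, x, ψ => .box a (instVar A x ψ)
  | .var n, x, ψ => if n = x then ψ else if x < n then .var (n - 1) else .var n
  | .mu A, x, ψ => .mu (instVar A (x + 1) (shiftFm 0 ψ))

/-- Abstraction of the free variable `x`, at binder depth `k`. -/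
def abstractVar : ℕ → ℕ → Fm Act Atom → Fm Act Atom
  | _, _, .atom p => .atom p
  | _, _, .ff => .ff
  | k, x, .neg A => .neg (abstractVar k x A)
  | k, x, .imp A B => .imp (abstractVar k x A) (abstractVar k x B)
  | k, x, .box a A => .box a (abstractVar k x A)
  | k, x, .var n => if n = x + k then .var k else if k ≤ n then .var (n + 1) else .var n
  | k, x, .mu A => .mu (abstractVar (k + 1) x A)

/-- `muBind x φ` is the formula `μx.φ`, binding the free variable `x` of `φ`. -/
def muBind (x : ℕ) (φ : Fm Act Atom) : Fm Act Atom := .mu (abstractVar 0 x φ)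

/-- Environments over a state set `S`: an assignment of a set of states to each
propositional variable. -/
abbrev Env (S : Type) := ℕ → Set S

/-- `Env.cons T ρ`: the environment `ρ[x ↦ T]` for the newly bound variable `0`. -/
def Env.cons {S : Type} (T : Set S) (ρ : Env S) : Env S
  | 0 => T
  | n + 1 => ρ n

/-- The semantics `⟦φ⟧_M ρ ⊆ S` in the model `M = ⟨S, V, R⟩`. -/
def sem {S : Type} (V : Atom → Set S) (R : Act → S → Set S) :
    Fm Act Atom → Env S → Set S
  | .atom p, _ => V p
  | .ff, _ => ∅
  | .neg A, ρ => (sem V R A ρ)ᶜ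
  | .imp A B, ρ => (sem V R A ρ)ᶜ ∪ sem V R B ρ
  | .box a A, ρ => {s | ∀ r ∈ R a s, r ∈ sem V R A ρ}
  | .var n, ρ => ρ n
  | .mu A, ρ => ⋂₀ {T : Set S | sem V R A (Env.cons T ρ) ⊆ T}

/-- The (truth) semantic consequence relation `Γ ⊨ φ`: in every model (over any
nonempty set of states) and every environment, the intersection of the meanings of
the hypotheses is included in the meaning of the conclusion. -/
def SemCons (Γ : Set (Fm Act Atom)) (φ : Fm Act Atom) : Prop :=
  ∀ (S : Type) [Nonempty S] (V : Atom → Set S) (R : Act → S → Set S) (ρ : Env S),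
    (⋂ γ ∈ Γ, sem V R γ ρ) ⊆ sem V R φ ρ

/-- The mutual positivity/negativity proof system: `Polin true x φ` is the judgement
`posin(x,φ)`, `Polin false x φ` is `negin(x,φ)`. -/
inductive Polin {Act Atom : Type} : Bool → ℕ → Fm Act Atom → Prop
  | atom (b : Bool) (x : ℕ) (p : Atom) : Polin b x (.atom p)
  | ff (b : Bool) (x : ℕ) : Polin b x .ff
  | varPos (x y : ℕ) : Polin true x (.var y)
  | varNeg {x y : ℕ} : y ≠ x → Polin false x (.var y)
  | neg {b : Bool} {x : ℕ} {A : Fm Act Atom} : Polin (!b) x A → Polin b x (.neg A)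
  | imp {b : Bool} {x : ℕ} {A B : Fm Act Atom} :
      Polin (!b) x A → Polin b x B → Polin b x (.imp A B)
  | box {b : Bool} {x : ℕ} {A : Fm Act Atom} (a : Act) :
      Polin b x A → Polin b x (.box a A)
  | mu {b : Bool} {x : ℕ} {A : Fm Act Atom} :
      Polin b (x + 1) A → Polin b x (.mu A)

/-- `posin(x,φ)`: `x` occurs only positively in `φ`. -/
def Posin (x : ℕ) (φ : Fm Act Atom) : Prop := Polin true x φ

/-- `negin(x,φ)`: `x` occurs only negatively in `φ`. -/
def Negin (x : ℕ) (φ : Fm Act Atom) : Prop := Polin false x φ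

/-- Well-formedness: every application of `mu` satisfies the positivity condition. -/
def Wf : Fm Act Atom → Prop
  | .atom _ => True
  | .ff => True
  | .neg A => Wf A
  | .imp A B => Wf A ∧ Wf B
  | .box _ A => Wf A
  | .var _ => True
  | .mu A => Posin 0 A ∧ Wf A

/-- `isin(x,A)`: the variable `x` occurs free in `A`. -/
def Isin : ℕ → Fm Act Atom → Prop
  | _, .atom _ => False
  | _, .ff => False
  | x, .neg A => Isin x A
  | x, .imp A B => Isin x A ∨ Isin x B
  | x, .box _ A => Isin x A
  | x, .var y => x = y
  | x, .mu A => Isin (x + 1) A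

/-- `notin(x,A)`: the variable `x` does not occur free in `A`. -/
def Notin : ℕ → Fm Act Atom → Prop
  | _, .atom _ => True
  | _, .ff => True
  | x, .neg A => Notin x A
  | x, .imp A B => Notin x A ∧ Notin x B
  | x, .box _ A => Notin x A
  | x, .var y => x ≠ y
  | x, .mu A => Notin (x + 1) A

/-- `HasOcc true x φ` (resp. `HasOcc false x φ`): the variable `x` has a free
occurrence in `φ` inside an even (resp. odd) number of negations, the left-hand
side of an implication counting as one additional negation. -/
def HasOcc : Bool → ℕ → Fm Act Atom → Prop
  | _, _, .atom _ => False
  | _, _, .ff => False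
  | b, x, .neg A => HasOcc (!b) x A
  | b, x, .imp A B => HasOcc (!b) x A ∨ HasOcc b x B
  | b, x, .box _ A => HasOcc b x A
  | b, x, .var y => x = y ∧ b = true
  | b, x, .mu A => HasOcc b (x + 1) A

/-- The Natural Deduction system N(μK), on sequents `Γ ⊢ φ` with `Γ` a finite set.
Rules are those of Figure 1; `weak` is the (admissible) weakening of the hypothesis
set; formation of `mu` formulae in the μ-rules carries the positivity condition. -/
inductive Deriv [DecidableEq Act] [DecidableEq Atom] :
    Finset (Fm Act Atom) → Fm Act Atom → Prop
  | hyp (Γ : Finset (Fm Act Atom)) (φ : Fm Act Atom) : Deriv (insert φ Γ) φ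
  | weak {Γ Δ : Finset (Fm Act Atom)} {φ} : Deriv Γ φ → Γ ⊆ Δ → Deriv Δ φ
  | raa {Γ φ} : Deriv (insert (.neg φ) Γ) .ff → Deriv Γ φ
  | impI {Γ φ ψ} : Deriv (insert φ Γ) ψ → Deriv Γ (.imp φ ψ)
  | impE {Γ φ ψ} : Deriv Γ (.imp φ ψ) → Deriv Γ φ → Deriv Γ ψ
  | negI {Γ φ} : Deriv (insert φ Γ) .ff → Deriv Γ (.neg φ)
  | ffI {Γ φ} : Deriv Γ φ → Deriv Γ (.neg φ) → Deriv Γ .ff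
  | boxI {φ} (a : Act) : Deriv ∅ φ → Deriv ∅ (.box a φ)
  | boxK {Γ φ ψ} {a : Act} :
      Deriv Γ (.box a (.imp φ ψ)) → Deriv Γ (.box a φ) → Deriv Γ (.box a ψ)
  | muI {Γ} {A : Fm Act Atom} :
      Posin 0 A → Deriv Γ (instVar A 0 (.mu A)) → Deriv Γ (.mu A)
  | muE {Γ} {A ψ : Fm Act Atom} :
      Posin 0 A → Deriv Γ (.mu A) → Deriv {instVar A 0 ψ} ψ → Deriv Γ ψ

/-- Conjunction as a defined connective: `A ∧ B := ¬(A ⊃ ¬B)`. -/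
def andFm (A B : Fm Act Atom) : Fm Act Atom := .neg (.imp A (.neg B))

/-- The conjunction `γ₁ ∧ … ∧ γₙ` of a list of formulae (the empty conjunction
being the truth `¬ff`). -/
def conjList : List (Fm Act Atom) → Fm Act Atom
  | [] => .neg .ff
  | γ :: rest => andFm γ (conjList rest)

open Set Function Filter

/-- A general frame: a Kripke model together with a family of admissible sets. -/
structure Frame (Act Atom : Type) where
  W : Type
  V : Atom → Set W
  R : Act → W → Set W
  Adm : Set (Set W)

section Fixpoints
variable {W : Type}

/-- The least admissible prefixpoint of `f`, as an intersection. -/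
def lfpA (Adm : Set (Set W)) (f : Set W → Set W) : Set W :=
  ⋂₀ {T | T ∈ Adm ∧ f T ⊆ T}

/-- The dual of `lfpA`. -/
def gfpA (Adm : Set (Set W)) (f : Set W → Set W) : Set W :=
  (lfpA Adm (fun T => (f Tᶜ)ᶜ))ᶜ

/-- `fx true` is the least, `fx false` the greatest fixpoint operator. -/
def fx (Adm : Set (Set W)) (b : Bool) (f : Set W → Set W) : Set W :=
  if b then lfpA Adm f else gfpA Adm f

variable {Adm : Set (Set W)} {f g : Set W → Set W}

theorem lfpA_subset {T : Set W} (hT : T ∈ Adm) (h : f T ⊆ T) : lfpA Adm f ⊆ T :=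
  sInter_subset_of_mem ⟨hT, h⟩

theorem lfpA_mono (h : ∀ T, f T ⊆ g T) : lfpA Adm f ⊆ lfpA Adm g :=
  sInter_subset_sInter fun T hT => ⟨hT.1, (h T).trans hT.2⟩

theorem gfpA_mono (h : ∀ T, f T ⊆ g T) : gfpA Adm f ⊆ gfpA Adm g :=
  compl_subset_compl.2 (lfpA_mono fun _ => compl_subset_compl.2 (h _))

theorem fx_mono (b : Bool) (h : ∀ T, f T ⊆ g T) : fx Adm b f ⊆ fx Adm b g := by
  unfold fx; split
  · exact lfpA_mono h
  · exact gfpA_mono h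

theorem fx_compl (b : Bool) :
    (fx Adm b f)ᶜ = fx Adm (!b) (fun T => (f Tᶜ)ᶜ) := by
  cases b <;> simp [fx, gfpA]

theorem lfpA_eq (hf : Monotone f) (ha : f (lfpA Adm f) ∈ Adm) :
    f (lfpA Adm f) = lfpA Adm f := by
  have h1 : f (lfpA Adm f) ⊆ lfpA Adm f :=
    subset_sInter fun T hT => (hf (lfpA_subset hT.1 hT.2)).trans hT.2
  exact h1.antisymm (lfpA_subset ha (hf h1))

theorem gfpA_eq (hc : ∀ T ∈ Adm, Tᶜ ∈ Adm) (hf : Monotone f) (ha : f (gfpA Adm f) ∈ Adm) :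
    f (gfpA Adm f) = gfpA Adm f := by
  have := lfpA_eq (Adm := Adm) (f := fun T => (f Tᶜ)ᶜ)
    (fun _ _ h => compl_subset_compl.2 (hf (compl_subset_compl.2 h))) (hc _ ha)
  conv_rhs => rw [gfpA, ← this]
  simp [gfpA]

theorem fx_eq (hc : ∀ T ∈ Adm, Tᶜ ∈ Adm) (b : Bool) (hf : Monotone f)
    (ha : f (fx Adm b f) ∈ Adm) : f (fx Adm b f) = fx Adm b f := by
  cases b
  · simpa [fx] using gfpA_eq hc hf (by simpa [fx] using ha)
  · simpa [fx] using lfpA_eq hf (by simpa [fx] using ha)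

end Fixpoints

/-- Positive modal fixpoint terms (de Bruijn). -/
inductive PT (Act : Type) : Type
  | var : ℕ → PT Act
  | and : PT Act → PT Act → PT Act
  | or : PT Act → PT Act → PT Act
  | box : Act → PT Act → PT Act
  | dia : Act → PT Act → PT Act
  | fix : Bool → PT Act → PT Act

/-- Box of a set. -/
def Frame.bx (M : Frame Act Atom) (a : Act) (T : Set M.W) : Set M.W := {s | ∀ r ∈ M.R a s, r ∈ T}

/-- Diamond of a set. -/
def Frame.dm (M : Frame Act Atom) (a : Act) (T : Set M.W) : Set M.W := {s | ∃ r ∈ M.R a s, r ∈ T}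

/-- Value of a positive term. -/
def semPT (M : Frame Act Atom) : PT Act → Env M.W → Set M.W
  | .var n, ρ => ρ n
  | .and s t, ρ => semPT M s ρ ∩ semPT M t ρ
  | .or s t, ρ => semPT M s ρ ∪ semPT M t ρ
  | .box a t, ρ => M.bx a (semPT M t ρ)
  | .dia a t, ρ => M.dm a (semPT M t ρ)
  | .fix b t, ρ => fx M.Adm b (fun T => semPT M t (Env.cons T ρ))

/-- `semA` is the semantics with quantification over admissible sets only. -/
def semA (M : Frame Act Atom) : Fm Act Atom → Env M.W → Set M.W
  | .atom p, _ => M.V p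
  | .ff, _ => ∅
  | .neg A, ρ => (semA M A ρ)ᶜ
  | .imp A B, ρ => (semA M A ρ)ᶜ ∪ semA M B ρ
  | .box a A, ρ => M.bx a (semA M A ρ)
  | .var n, ρ => ρ n
  | .mu A, ρ => lfpA M.Adm (fun T => semA M A (Env.cons T ρ))

/-- `μ`-frames: the admissible sets are closed under definable operations. -/
structure MF (M : Frame Act Atom) : Prop where
  univ_mem : univ ∈ M.Adm
  compl_mem : ∀ T ∈ M.Adm, Tᶜ ∈ M.Adm
  atom_mem : ∀ p, M.V p ∈ M.Adm
  pt_mem : ∀ (t : PT Act) (ρ : Env M.W), (∀ i, ρ i ∈ M.Adm) → semPT M t ρ ∈ M.Adm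

theorem Env.cons_mono {S : Type} {T T' : Set S} {ρ ρ' : Env S} (h : T ⊆ T') (h' : ρ ≤ ρ') :
    Env.cons T ρ ≤ Env.cons T' ρ' := by
  rintro (_ | n)
  · exact h
  · exact h' n

theorem semPT_mono (M : Frame Act Atom) (t : PT Act) : Monotone (semPT M t) := by
  induction t with
  | var n => exact fun _ _ h => h n
  | and s t hs ht => exact fun _ _ h => inter_subset_inter (hs h) (ht h)
  | or s t hs ht => exact fun _ _ h => union_subset_union (hs h) (ht h)
  | box a t ht => exact fun _ _ h _ hw r hr => ht h (hw r hr)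
  | dia a t ht => exact fun _ _ h _ ⟨r, hr, hw⟩ => ⟨r, hr, ht h hw⟩
  | fix b t ht => exact fun _ _ h => fx_mono b fun T => ht (Env.cons_mono le_rfl h)

/-- Renaming of variables. -/
def PT.ren : (ℕ → ℕ) → PT Act → PT Act
  | r, .var n => .var (r n)
  | r, .and s t => .and (s.ren r) (t.ren r)
  | r, .or s t => .or (s.ren r) (t.ren r)
  | r, .box a t => .box a (t.ren r)
  | r, .dia a t => .dia a (t.ren r)
  | r, .fix b t => .fix b (t.ren fun n => n.casesOn 0 fun m => r m + 1)

theorem semPT_ren (M : Frame Act Atom) (t : PT Act) (r : ℕ → ℕ) (ρ : Env M.W) :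
    semPT M (t.ren r) ρ = semPT M t (fun n => ρ (r n)) := by
  induction t generalizing r ρ with
  | var n => rfl
  | and s t hs ht => simp only [PT.ren, semPT, hs, ht]
  | or s t hs ht => simp only [PT.ren, semPT, hs, ht]
  | box a t ht => simp only [PT.ren, semPT, ht]
  | dia a t ht => simp only [PT.ren, semPT, ht]
  | fix b t ht =>
    simp only [PT.ren, semPT, ht]
    congr 1; funext T; congr 1; funext n; cases n <;> rfl

/-- Parallel substitution. -/
def PT.sub : (ℕ → PT Act) → PT Act → PT Act
  | σ, .var n => σ n
  | σ, .and s t => .and (s.sub σ) (t.sub σ)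
  | σ, .or s t => .or (s.sub σ) (t.sub σ)
  | σ, .box a t => .box a (t.sub σ)
  | σ, .dia a t => .dia a (t.sub σ)
  | σ, .fix b t => .fix b (t.sub fun n => n.casesOn (.var 0) fun m => (σ m).ren Nat.succ)

theorem semPT_sub (M : Frame Act Atom) (t : PT Act) (σ : ℕ → PT Act) (ρ : Env M.W) :
    semPT M (t.sub σ) ρ = semPT M t (fun n => semPT M (σ n) ρ) := by
  induction t generalizing σ ρ with
  | var n => rfl
  | and s t hs ht => simp only [PT.sub, semPT, hs, ht]
  | or s t hs ht => simp only [PT.sub, semPT, hs, ht]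
  | box a t ht => simp only [PT.sub, semPT, ht]
  | dia a t ht => simp only [PT.sub, semPT, ht]
  | fix b t ht =>
    simp only [PT.sub, semPT, ht]
    congr 1; funext T; congr 1; funext n; cases n
    · rfl
    · simp only [semPT_ren]; rfl

/-- Interleave two environments. -/
def mixE {S : Type} (ρ κ : Env S) : Env S := fun n => if n % 2 = 0 then ρ (n / 2) else κ (n / 2)

@[simp] theorem mixE_even {S : Type} (ρ κ : Env S) (i : ℕ) : mixE ρ κ (2 * i) = ρ i := by
  simp [mixE]

@[simp] theorem mixE_odd {S : Type} (ρ κ : Env S) (i : ℕ) : mixE ρ κ (2 * i + 1) = κ i := by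
  have h1 : (2 * i + 1) % 2 = 1 := by omega
  have h2 : (2 * i + 1) / 2 = i := by omega
  simp [mixE, h1, h2]

theorem nat_even_odd (n : ℕ) : (∃ i, n = 2 * i) ∨ ∃ i, n = 2 * i + 1 := by
  rcases Nat.even_or_odd' n with ⟨i, h | h⟩
  · exact .inl ⟨i, h⟩
  · exact .inr ⟨i, h⟩

/-- Operations on environments definable by a positive term with admissible parameters. -/
def PF (M : Frame Act Atom) (f : Env M.W → Set M.W) : Prop :=
  ∃ (t : PT Act) (κ : Env M.W), (∀ i, κ i ∈ M.Adm) ∧ ∀ ρ, f ρ = semPT M t (mixE ρ κ)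

section PF
variable {M : Frame Act Atom} {f g : Env M.W → Set M.W}

theorem PF.mono (hf : PF M f) : Monotone f := by
  obtain ⟨t, κ, -, h⟩ := hf
  intro ρ ρ' hρ
  rw [h, h]
  refine semPT_mono M t fun n => ?_
  obtain ⟨i, rfl⟩ | ⟨i, rfl⟩ := nat_even_odd n
  · simpa using hρ i
  · simp

theorem PF.adm (hM : MF M) (hf : PF M f) {ρ : Env M.W} (hρ : ∀ i, ρ i ∈ M.Adm) :
    f ρ ∈ M.Adm := by
  obtain ⟨t, κ, hκ, h⟩ := hf
  rw [h]
  refine hM.pt_mem t _ fun n => ?_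
  obtain ⟨i, rfl⟩ | ⟨i, rfl⟩ := nat_even_odd n
  · simpa using hρ i
  · simpa using hκ i

theorem PF.var (hM : MF M) (i : ℕ) : PF M (fun ρ => ρ i) :=
  ⟨.var (2 * i), fun _ => univ, fun _ => hM.univ_mem, fun ρ => by simp [semPT]⟩

theorem PF.const {c : Set M.W} (hc : c ∈ M.Adm) : PF M (fun _ => c) :=
  ⟨.var (2 * 0 + 1), fun _ => c, fun _ => hc, fun ρ => by simp only [semPT, mixE_odd]⟩

theorem PF.comp {h : ℕ → Env M.W → Set M.W} (hf : PF M f) (hh : ∀ i, PF M (h i)) :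
    PF M (fun ρ => f (fun i => h i ρ)) := by
  obtain ⟨t, κ, hκ, ht⟩ := hf
  choose s θ hθ hs using hh
  refine ⟨t.sub fun n => if n % 2 = 0 then
      (s (n / 2)).ren (fun m => if m % 2 = 0 then m else 2 * Nat.pair (n / 2 + 1) (m / 2) + 1)
      else .var (2 * Nat.pair 0 (n / 2) + 1),
    fun j => (j.unpair.1).casesOn (κ j.unpair.2) fun i => θ i j.unpair.2, ?_, ?_⟩
  · intro j
    dsimp only
    cases j.unpair.1 with
    | zero => exact hκ _
    | succ i => exact hθ i _
  · intro ρ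
    dsimp only
    rw [ht, semPT_sub]
    congr 1; funext n
    obtain ⟨i, rfl⟩ | ⟨i, rfl⟩ := nat_even_odd n
    · have h0 : 2 * i / 2 = i := by omega
      simp only [mixE_even, hs, Nat.mul_mod_right, if_true, semPT_ren, h0]
      congr 1; funext m
      obtain ⟨j, rfl⟩ | ⟨j, rfl⟩ := nat_even_odd m
      · simp
      · have h1 : (2 * j + 1) % 2 = 1 := by omega
        have h2 : (2 * j + 1) / 2 = j := by omega
        simp [h1, h2]
    · have h1 : (2 * i + 1) % 2 = 1 := by omega
      have h2 : (2 * i + 1) / 2 = i := by omega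
      simp [h1, h2, semPT]

theorem PF.comp2 (hM : MF M) {op : Set M.W → Set M.W → Set M.W} (t : PT Act)
    (ht : ∀ ρ : Env M.W, semPT M t ρ = op (ρ 0) (ρ 2)) (hf : PF M f) (hg : PF M g) :
    PF M (fun ρ => op (f ρ) (g ρ)) := by
  have h0 : PF M (fun ρ => op (ρ 0) (ρ 1)) :=
    ⟨t, fun _ => univ, fun _ => hM.univ_mem, fun ρ => by
      rw [ht]; rfl⟩
  exact h0.comp (h := fun i => if i = 0 then f else g) (by intro i; split <;> assumption)

theorem PF.inter (hM : MF M) (hf : PF M f) (hg : PF M g) : PF M (fun ρ => f ρ ∩ g ρ) :=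
  PF.comp2 hM (.and (.var 0) (.var 2)) (fun _ => rfl) hf hg

theorem PF.union (hM : MF M) (hf : PF M f) (hg : PF M g) : PF M (fun ρ => f ρ ∪ g ρ) :=
  PF.comp2 hM (.or (.var 0) (.var 2)) (fun _ => rfl) hf hg

theorem PF.box (hM : MF M) (a : Act) (hf : PF M f) : PF M (fun ρ => M.bx a (f ρ)) :=
  PF.comp2 hM (op := fun s _ => M.bx a s) (.box a (.var 0)) (fun _ => rfl) hf hf

theorem PF.dia (hM : MF M) (a : Act) (hf : PF M f) : PF M (fun ρ => M.dm a (f ρ)) :=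
  PF.comp2 hM (op := fun s _ => M.dm a s) (.dia a (.var 0)) (fun _ => rfl) hf hf

theorem MF.empty_mem (hM : MF M) : ∅ ∈ M.Adm := by
  simpa using hM.compl_mem _ hM.univ_mem

theorem MF.inter_mem (hM : MF M) {s t : Set M.W} (hs : s ∈ M.Adm) (ht : t ∈ M.Adm) :
    s ∩ t ∈ M.Adm :=
  (PF.inter hM (PF.const hs) (PF.const ht)).adm hM (ρ := fun _ => univ) fun _ => hM.univ_mem

theorem MF.diff_mem (hM : MF M) {s t : Set M.W} (hs : s ∈ M.Adm) (ht : t ∈ M.Adm) :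
    s \ t ∈ M.Adm := hM.inter_mem hs (hM.compl_mem _ ht)

theorem PF.iInter (hM : MF M) {ι : Type*} [Finite ι] {h : ι → Env M.W → Set M.W}
    (hh : ∀ i, PF M (h i)) : PF M (fun ρ => ⋂ i, h i ρ) := by
  have : Fintype ι := Fintype.ofFinite ι
  have key : ∀ s : Finset ι, PF M (fun ρ => ⋂ i ∈ s, h i ρ) := by
    classical
    intro s
    induction s using Finset.induction_on with
    | empty => simpa using PF.const hM.univ_mem
    | insert a s _ ih => simpa [Finset.set_biInter_insert] using (hh a).inter hM ih
  simpa using key Finset.univ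

theorem PF.iUnion (hM : MF M) {ι : Type*} [Finite ι] {h : ι → Env M.W → Set M.W}
    (hh : ∀ i, PF M (h i)) : PF M (fun ρ => ⋃ i, h i ρ) := by
  have : Fintype ι := Fintype.ofFinite ι
  have key : ∀ s : Finset ι, PF M (fun ρ => ⋃ i ∈ s, h i ρ) := by
    classical
    intro s
    induction s using Finset.induction_on with
    | empty => simpa using PF.const hM.empty_mem
    | insert a s _ ih => simpa [Finset.set_biUnion_insert] using (hh a).union hM ih
  simpa using key Finset.univ

theorem MF.iInter_mem (hM : MF M) {ι : Type*} [Finite ι] {s : ι → Set M.W}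
    (hs : ∀ i, s i ∈ M.Adm) : ⋂ i, s i ∈ M.Adm :=
  (PF.iInter hM (fun i => PF.const (hs i))).adm hM (ρ := fun _ => univ) fun _ => hM.univ_mem

theorem PF.congr (hf : PF M f) (h : ∀ ρ, g ρ = f ρ) : PF M g := by
  rwa [show g = f from funext h]

theorem PF.fix (b : Bool) (i : ℕ) (hf : PF M f) :
    PF M (fun ρ => fx M.Adm b (fun T => f (update ρ i T))) := by
  obtain ⟨t, κ, hκ, ht⟩ := hf
  refine ⟨.fix b (t.ren fun n => if n = 2 * i then 0 else n + 1), κ, hκ, fun ρ => ?_⟩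
  simp only [semPT, semPT_ren, ht]
  congr 1; funext T; congr 1; funext n
  obtain ⟨j, rfl⟩ | ⟨j, rfl⟩ := nat_even_odd n
  · by_cases h : j = i
    · subst h; simp [Env.cons]
    · have : 2 * j ≠ 2 * i := by omega
      simp [h, Env.cons]
  · have : 2 * j + 1 ≠ 2 * i := by omega
    simp only [this, if_false, Env.cons, mixE_odd]

/-- The dual term. -/
def PT.dual : PT Act → PT Act
  | .var n => .var n
  | .and s t => .or s.dual t.dual
  | .or s t => .and s.dual t.dual
  | .box a t => .dia a t.dual
  | .dia a t => .box a t.dual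
  | .fix b t => .fix (!b) t.dual

theorem bx_compl (M : Frame Act Atom) (a : Act) (T : Set M.W) : (M.bx a T)ᶜ = M.dm a Tᶜ := by
  ext w; simp [Frame.bx, Frame.dm]

theorem dm_compl (M : Frame Act Atom) (a : Act) (T : Set M.W) : (M.dm a T)ᶜ = M.bx a Tᶜ := by
  ext w; simp [Frame.bx, Frame.dm]

theorem semPT_dual (M : Frame Act Atom) (t : PT Act) (ρ : Env M.W) :
    semPT M t.dual ρ = (semPT M t (fun i => (ρ i)ᶜ))ᶜ := by
  induction t generalizing ρ with
  | var n => simp [semPT, PT.dual]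
  | and s t hs ht => simp only [PT.dual, semPT, hs, ht, compl_inter]
  | or s t hs ht => simp only [PT.dual, semPT, hs, ht, compl_union]
  | box a t ht => simp only [PT.dual, semPT, ht, bx_compl]
  | dia a t ht => simp only [PT.dual, semPT, ht, dm_compl]
  | fix b t ht =>
    simp only [PT.dual, semPT, ht, fx_compl]
    congr 1; funext T; congr 2; funext n; cases n <;> rfl

theorem PF.dual (hM : MF M) (hf : PF M f) : PF M (fun ρ => (f (fun i => (ρ i)ᶜ))ᶜ) := by
  obtain ⟨t, κ, hκ, ht⟩ := hf
  refine ⟨t.dual, fun i => (κ i)ᶜ, fun i => hM.compl_mem _ (hκ i), fun ρ => ?_⟩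
  dsimp only
  rw [ht, semPT_dual]
  congr 2; funext n
  obtain ⟨j, rfl⟩ | ⟨j, rfl⟩ := nat_even_odd n <;> simp

end PF

section NatSystem
variable {W : Type} (Adm : Set (Set W)) (F : ℕ → Env W → Set W) (mu : ℕ → Bool)

/-- Solve the equations below `k` of a system, larger indices being outermost. -/
def solveBelow : ℕ → Env W → Env W
  | 0, ρ => ρ
  | k + 1, ρ => solveBelow k (update ρ k (fx Adm (mu k)
      (fun t => F k (solveBelow k (update ρ k t)))))

/-- As `solveBelow`, but intersecting the outermost unfolding of each equation with a guard. -/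
def solveGuard (g : Env W) : ℕ → Env W → Env W
  | 0, ρ => ρ
  | k + 1, ρ => solveGuard g k (update ρ k (fx Adm (mu k)
      (fun t => g k ∩ F k (solveBelow Adm F mu k (update ρ k t)))))

/-- Drop the guards below `k`. -/
def cutBelow (k : ℕ) (g : Env W) : Env W := fun j => if k ≤ j then g j else univ

variable {Adm F mu}

theorem solveGuard_univ (k : ℕ) (ρ : Env W) {g : Env W} (hg : ∀ j < k, g j = univ) :
    solveGuard Adm F mu g k ρ = solveBelow Adm F mu k ρ := by
  induction k generalizing ρ with
  | zero => rfl
  | succ k ih =>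
    rw [solveGuard, solveBelow, ih _ fun j hj => hg j (hj.trans (Nat.lt_succ_self k)),
      hg k (Nat.lt_succ_self k)]
    simp only [univ_inter]

theorem solveGuard_of_le {g : Env W} {k j : ℕ} (ρ : Env W) (h : k ≤ j) :
    solveGuard Adm F mu g k ρ j = ρ j := by
  induction k generalizing ρ with
  | zero => rfl
  | succ k ih =>
    rw [solveGuard, ih _ (by omega), update_of_ne (by omega)]

theorem update_agree {ρ ρ' : Env W} {k : ℕ} (t : Set W) (h : ∀ j, k + 1 ≤ j → ρ j = ρ' j) :
    ∀ j, k ≤ j → update ρ k t j = update ρ' k t j := by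
  intro j hj
  by_cases e : j = k
  · subst e; simp
  · rw [update_of_ne e, update_of_ne e, h j (by omega)]

theorem solveBelow_congr {k : ℕ} {ρ ρ' : Env W} (h : ∀ j, k ≤ j → ρ j = ρ' j) :
    solveBelow Adm F mu k ρ = solveBelow Adm F mu k ρ' := by
  induction k generalizing ρ ρ' with
  | zero => exact funext fun j => h j (Nat.zero_le j)
  | succ k ih =>
    rw [solveBelow, solveBelow]
    have : ∀ t, solveBelow Adm F mu k (update ρ k t) = solveBelow Adm F mu k (update ρ' k t) :=
      fun t => ih (update_agree t h)
    simp only [this]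

theorem solveGuard_congr {g : Env W} {k : ℕ} {ρ ρ' : Env W} (h : ∀ j, k ≤ j → ρ j = ρ' j) :
    solveGuard Adm F mu g k ρ = solveGuard Adm F mu g k ρ' := by
  induction k generalizing ρ ρ' with
  | zero => exact funext fun j => h j (Nat.zero_le j)
  | succ k ih =>
    rw [solveGuard, solveGuard]
    have h1 : ∀ t, solveBelow Adm F mu k (update ρ k t) = solveBelow Adm F mu k (update ρ' k t) :=
      fun t => solveBelow_congr (update_agree t h)
    have h2 : ∀ t, solveGuard Adm F mu g k (update ρ k t) =
      solveGuard Adm F mu g k (update ρ' k t) := fun t => ih (update_agree t h)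
    simp only [h1, h2]

theorem solveGuard_solveGuard {g : Env W} {k n : ℕ} (ρ : Env W) (h : k ≤ n) :
    solveGuard Adm F mu g k (solveGuard Adm F mu g n ρ) = solveGuard Adm F mu g n ρ := by
  induction n generalizing ρ with
  | zero => obtain rfl : k = 0 := by omega
            rfl
  | succ n ih =>
    by_cases e : k = n + 1
    · subst e
      exact solveGuard_congr fun j hj => solveGuard_of_le ρ hj
    · exact ih _ (by omega)

theorem solveGuard_apply {g : Env W} {k n : ℕ} (ρ : Env W) (h : k < n) :
    solveGuard Adm F mu g n ρ k = fx Adm (mu k) (fun t => g k ∩ F k (solveBelow Adm F mu k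
      (update (solveGuard Adm F mu g n ρ) k t))) := by
  conv_lhs => rw [← solveGuard_solveGuard ρ (Nat.succ_le_of_lt h)]
  rw [solveGuard, solveGuard_of_le _ le_rfl, update_self]

theorem solveGuard_agree {g g' : Env W} {k n : ℕ} (ρ : Env W) (h : ∀ j, k ≤ j → g j = g' j)
    {j : ℕ} (hj : k ≤ j) : solveGuard Adm F mu g n ρ j = solveGuard Adm F mu g' n ρ j := by
  induction n generalizing ρ with
  | zero => rfl
  | succ n ih =>
    by_cases e : k ≤ n
    · rw [solveGuard, solveGuard, h n e, ih]
    · rw [solveGuard_of_le _ (by omega), solveGuard_of_le _ (by omega)]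

theorem solveBelow_solveGuard {g : Env W} {k n : ℕ} (ρ : Env W) (h : k ≤ n) :
    solveBelow Adm F mu k (solveGuard Adm F mu g n ρ) =
      solveGuard Adm F mu (cutBelow k g) n ρ := by
  rw [← solveGuard_solveGuard ρ h (g := cutBelow k g), solveGuard_univ k]
  · exact solveBelow_congr fun j hj =>
      solveGuard_agree ρ (fun i hi => by simp [cutBelow, hi]) hj
  · intro j hj
    simp [cutBelow, Nat.not_le.2 hj]

theorem solveBelow_local {n : ℕ} (hF : ∀ k < n, ∀ ρ ρ' : Env W, (∀ j < n, ρ j = ρ' j) →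
    F k ρ = F k ρ') {k : ℕ} (hk : k ≤ n) {ρ ρ' : Env W} (h : ∀ j, k ≤ j → j < n → ρ j = ρ' j) :
    ∀ j < n, solveBelow Adm F mu k ρ j = solveBelow Adm F mu k ρ' j := by
  induction k generalizing ρ ρ' with
  | zero => exact fun j hj => h j (Nat.zero_le j) hj
  | succ k ih =>
    have agree : ∀ t j, k ≤ j → j < n → update ρ k t j = update ρ' k t j := by
      intro t j hj hn
      by_cases e : j = k
      · subst e; simp
      · rw [update_of_ne e, update_of_ne e, h j (by omega) hn]
    have : ∀ t, F k (solveBelow Adm F mu k (update ρ k t)) =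
        F k (solveBelow Adm F mu k (update ρ' k t)) :=
      fun t => hF k (by omega) _ _ (ih (by omega) (agree t))
    intro j hj
    simp only [solveBelow, this]
    exact ih (by omega) (agree _) j hj

theorem solveBelow_dual {F' : ℕ → Env W → Set W} {mu' : ℕ → Bool} {k : ℕ}
    (hF : ∀ j < k, ∀ ρ, F' j ρ = (F j (fun i => (ρ i)ᶜ))ᶜ) (hm : ∀ j < k, mu' j = !mu j)
    (ρ : Env W) : solveBelow Adm F' mu' k ρ =
      fun i => (solveBelow Adm F mu k (fun i => (ρ i)ᶜ) i)ᶜ := by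
  induction k generalizing ρ with
  | zero => simp [solveBelow]
  | succ k ih =>
    have ih' := ih (fun j hj => hF j (by omega)) (fun j hj => hm j (by omega))
    have key : ∀ (τ : Env W) (t : Set W),
        (fun i => (update τ k t i)ᶜ) = update (fun i => (τ i)ᶜ) k tᶜ := by
      intro τ t; funext i
      by_cases e : i = k
      · subst e; simp
      · simp [update_of_ne e]
    rw [solveBelow, solveBelow, ih', key, fx_compl]
    simp only [ih', hF k (Nat.lt_succ_self k), hm k (Nat.lt_succ_self k), Bool.not_not, compl_compl,
      key]

end NatSystem

section NatSystemPF
variable {M : Frame Act Atom} {F : ℕ → Env M.W → Set M.W} {mu : ℕ → Bool}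

theorem solveBelow_PF (hM : MF M) (hF : ∀ k, PF M (F k)) (k j : ℕ) :
    PF M (fun ρ => solveBelow M.Adm F mu k ρ j) := by
  induction k generalizing j with
  | zero => exact PF.var hM j
  | succ k ih =>
    have h1 : PF M (fun ρ => F k (solveBelow M.Adm F mu k ρ)) :=
      ((hF k).comp (h := fun i ρ => solveBelow M.Adm F mu k ρ i) ih)
    have h2 := h1.fix (mu k) k
    refine ((ih j).comp (h := fun i ρ => update ρ k (fx M.Adm (mu k)
      (fun t => F k (solveBelow M.Adm F mu k (update ρ k t)))) i) fun i => ?_)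
    by_cases e : i = k
    · subst e; simpa using h2
    · simpa [update_of_ne e] using PF.var hM i

theorem update_adm {W : Type} {Adm : Set (Set W)} {ρ : Env W} {k : ℕ} {t : Set W}
    (hρ : ∀ i, ρ i ∈ Adm) (ht : t ∈ Adm) : ∀ i, update ρ k t i ∈ Adm := by
  intro i
  by_cases e : i = k
  · subst e; simpa
  · simpa [update_of_ne e] using hρ i

theorem update_mono' {W : Type} {ρ ρ' : Env W} {t t' : Set W} (k : ℕ) (h : ρ ≤ ρ') (ht : t ⊆ t') :
    update ρ k t ≤ update ρ' k t' := by
  intro i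
  by_cases e : i = k
  · subst e; simpa
  · simpa [update_of_ne e] using h i

theorem solveBelow_mono (hM : MF M) (hF : ∀ k, PF M (F k)) (k : ℕ) :
    Monotone (solveBelow M.Adm F mu k) :=
  fun _ _ h j => (solveBelow_PF hM hF k j).mono h

theorem guarded_adm (hM : MF M) (hF : ∀ k, PF M (F k)) {g ρ : Env M.W} (hg : ∀ i, g i ∈ M.Adm)
    (hρ : ∀ i, ρ i ∈ M.Adm) (k : ℕ) : fx M.Adm (mu k)
      (fun t => g k ∩ F k (solveBelow M.Adm F mu k (update ρ k t))) ∈ M.Adm := by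
  have h1 : PF M (fun ρ => F k (solveBelow M.Adm F mu k ρ)) :=
    ((hF k).comp (h := fun i ρ => solveBelow M.Adm F mu k ρ i) (solveBelow_PF hM hF k))
  exact (((PF.const (hg k)).inter hM h1).fix (mu k) k).adm hM hρ

theorem solveGuard_adm (hM : MF M) (hF : ∀ k, PF M (F k)) {g : Env M.W} (hg : ∀ i, g i ∈ M.Adm)
    (k : ℕ) {ρ : Env M.W} (hρ : ∀ i, ρ i ∈ M.Adm) (j : ℕ) :
    solveGuard M.Adm F mu g k ρ j ∈ M.Adm := by
  induction k generalizing ρ with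
  | zero => exact hρ j
  | succ k ih =>
    exact ih (update_adm hρ (guarded_adm hM hF hg hρ k))

theorem solveGuard_mono (hM : MF M) (hF : ∀ k, PF M (F k)) {g g' : Env M.W} (hg : g ≤ g')
    (k : ℕ) {ρ ρ' : Env M.W} (hρ : ρ ≤ ρ') :
    solveGuard M.Adm F mu g k ρ ≤ solveGuard M.Adm F mu g' k ρ' := by
  induction k generalizing ρ ρ' with
  | zero => exact hρ
  | succ k ih =>
    exact ih (update_mono' k hρ (fx_mono _ fun t => inter_subset_inter (hg k)
      ((hF k).mono (solveBelow_mono hM hF k (update_mono' k hρ Subset.rfl)))))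

theorem solveGuard_unfold (hM : MF M) (hF : ∀ k, PF M (F k)) {g : Env M.W} (hg : ∀ i, g i ∈ M.Adm)
    {k n : ℕ} {ρ : Env M.W} (hρ : ∀ i, ρ i ∈ M.Adm) (h : k < n) :
    solveGuard M.Adm F mu g n ρ k =
      g k ∩ F k (solveGuard M.Adm F mu (cutBelow k g) n ρ) := by
  have hy := solveGuard_adm hM hF hg n hρ (mu := mu)
  have e := solveGuard_apply ρ h (Adm := M.Adm) (F := F) (mu := mu) (g := g)
  have := fx_eq hM.compl_mem (mu k) (f := fun t => g k ∩ F k (solveBelow M.Adm F mu k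
      (update (solveGuard M.Adm F mu g n ρ) k t)))
    (fun t t' ht => inter_subset_inter_right _
      ((hF k).mono (solveBelow_mono hM hF k (update_mono' k le_rfl ht))))
    (by
      refine hM.inter_mem (hg k) ((hF k).adm hM fun i => (solveBelow_PF hM hF k i).adm hM ?_)
      exact update_adm hy (guarded_adm hM hF hg hy k))
  rw [← e, update_eq_self, solveBelow_solveGuard _ h.le] at this
  exact this.symm

theorem solveGuard_strengthen (hM : MF M) (hF : ∀ k, PF M (F k)) {g : Env M.W}
    (hg : ∀ i, g i ∈ M.Adm) {k n : ℕ} {ρ : Env M.W} (hρ : ∀ i, ρ i ∈ M.Adm) (h : k < n)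
    (hk : mu k = true) {c : Set M.W} (hc : c ∈ M.Adm)
    (hne : (c ∩ solveGuard M.Adm F mu g n ρ k).Nonempty) :
    (c ∩ F k (solveGuard M.Adm F mu (update (cutBelow k g) k (g k \ c)) n ρ)).Nonempty := by
  set g' := update (cutBelow k g) k (g k \ c) with hg'
  by_contra hcon
  rw [not_nonempty_iff_eq_empty] at hcon
  have g'adm : ∀ i, g' i ∈ M.Adm := by
    refine update_adm (fun i => ?_) (hM.diff_mem (hg k) hc)
    unfold cutBelow; split
    · exact hg i
    · exact hM.univ_mem
  have cutg' : cutBelow k g' = g' := by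
    funext j
    by_cases e : k ≤ j
    · simp [cutBelow, e]
    · have : j ≠ k := by omega
      simp [cutBelow, e, hg', update_of_ne this]
  have unf := solveGuard_unfold hM hF g'adm (mu := mu) hρ h
  rw [cutg'] at unf
  have hsub : solveGuard M.Adm F mu g n ρ k ⊆ solveGuard M.Adm F mu g' n ρ k := by
    rw [solveGuard_apply ρ h, hk, fx, if_pos rfl]
    refine lfpA_subset (solveGuard_adm hM hF g'adm n hρ k) ?_
    have e1 : solveBelow M.Adm F mu k (update (solveGuard M.Adm F mu g n ρ) k
        (solveGuard M.Adm F mu g' n ρ k)) = solveGuard M.Adm F mu g' n ρ := by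
      conv_rhs => rw [← cutg', ← solveBelow_solveGuard ρ h.le]
      refine solveBelow_congr fun j hj => ?_
      by_cases e : j = k
      · subst e; simp
      · rw [update_of_ne e]
        refine solveGuard_agree (k := k + 1) ρ (fun i hi => ?_) (by omega)
        have : i ≠ k := by omega
        have h2 : k ≤ i := by omega
        simp [hg', update_of_ne this, cutBelow, h2]
    rw [e1, unf]
    rintro w ⟨hw1, hw2⟩
    refine ⟨?_, hw2⟩
    simp only [hg', update_self]
    exact ⟨hw1, fun hw3 => by
      have : w ∈ (∅ : Set M.W) := hcon ▸ ⟨hw3, hw2⟩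
      exact this⟩
  obtain ⟨w, hw1, hw2⟩ := hne
  have h3 := hsub hw2
  rw [unf] at h3
  have := h3.1
  simp only [hg', update_self] at this
  exact this.2 hw1

end NatSystemPF

/-- Drop the guards at the states of rank below that of `q`. -/
def cutRank {W Q : Type} (rk : Q → ℕ) (q : Q) (g : Q → Set W) : Q → Set W :=
  fun p => if rk q ≤ rk p then g p else univ

/-- An equation system over `Q` together with the approximations `U g` of its solution
obtained by guarding states. -/
structure Ann (M : Frame Act Atom) (Q : Type) where
  F : Q → (Q → Set M.W) → Set M.W
  pri : Q → ℕ
  rk : Q → ℕ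
  U : (Q → Set M.W) → Q → Set M.W
  rk_inj : Injective rk
  rk_pri : ∀ p q, rk p ≤ rk q → pri p ≤ pri q
  F_mono : ∀ q, Monotone (F q)
  U_mono : Monotone U
  U_adm : ∀ g, (∀ q, g q ∈ M.Adm) → ∀ q, U g q ∈ M.Adm
  U_guard : ∀ g, (∀ q, g q ∈ M.Adm) → ∀ q, U g q ⊆ g q
  U_unf : ∀ g, (∀ q, g q ∈ M.Adm) → ∀ q, U g q ⊆ F q (U (cutRank rk q g))
  U_str : ∀ g, (∀ q, g q ∈ M.Adm) → ∀ q, Odd (pri q) → ∀ c ∈ M.Adm, (c ∩ U g q).Nonempty →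
    ∀ g', g' q = g q \ c → (∀ p, p ≠ q → g' p = cutRank rk q g p) → (c ∩ F q (U g')).Nonempty
  unf_univ : ∀ q, F q (U fun _ => univ) = U (fun _ => univ) q

/-- The solution of the system. -/
def Ann.y {M : Frame Act Atom} {Q : Type} (A : Ann M Q) : Q → Set M.W := A.U fun _ => univ

theorem Ann.y_unf {M : Frame Act Atom} {Q : Type} (A : Ann M Q) (q : Q) : A.F q A.y = A.y q :=
  A.unf_univ q

theorem Ann.U_le_y {M : Frame Act Atom} {Q : Type} (A : Ann M Q) (g : Q → Set M.W) : A.U g ≤ A.y :=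
  A.U_mono fun _ => subset_univ _

/-- Definable operations on `Q`-indexed families. -/
def PFQ (M : Frame Act Atom) {Q : Type} (f : (Q → Set M.W) → Set M.W) : Prop :=
  ∀ e : Q → ℕ, PF M (fun ρ => f (fun p => ρ (e p)))

/-- A ranking of `Q` by the numbers below `n`, refining a priority function. -/
structure Ranking {Q : Type} (pri : Q → ℕ) (rk : Q → ℕ) (n : ℕ) : Prop where
  inj : Injective rk
  lt : ∀ q, rk q < n
  surj : ∀ k < n, ∃ q, rk q = k
  pri_le : ∀ p q, rk p ≤ rk q → pri p ≤ pri q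

theorem exists_ranking {Q : Type} [Finite Q] (pri : Q → ℕ) : ∃ rk, Ranking pri rk (Nat.card Q) := by
  classical
  have : Fintype Q := Fintype.ofFinite Q
  obtain ⟨⟨e⟩⟩ : Nonempty (Trunc (Q ≃ Fin (Fintype.card Q))) := ⟨Fintype.truncEquivFin Q⟩
  let key : Q → ℕ ×ₗ ℕ := fun q => toLex (pri q, (e q : ℕ))
  have kinj : Injective key := by
    intro p q h
    have : (e p : ℕ) = e q := congrArg Prod.snd (toLex.injective h)
    exact e.injective (Fin.ext this)
  let _ : LinearOrder Q := LinearOrder.lift' key kinj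
  have hle : ∀ p q : Q, p ≤ q → pri p ≤ pri q := by
    intro p q h
    have h' : key p ≤ key q := h
    rw [Prod.Lex.le_iff] at h'
    rcases h' with h' | h'
    · exact h'.le
    · exact h'.1.le
  let o := Fintype.orderIsoFinOfCardEq Q (Nat.card_eq_fintype_card (α := Q)).symm
  refine ⟨fun q => (o.symm q : ℕ), ?_, ?_, ?_, ?_⟩
  · intro p q h
    exact o.symm.injective (Fin.ext h)
  · intro q
    exact (o.symm q).2
  · intro k hk
    exact ⟨o ⟨k, hk⟩, by simp⟩
  · intro p q h
    exact hle p q (o.symm.le_iff_le.1 h)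

section Transfer
variable {W Q : Type}

/-- The system over `ℕ` induced by a ranking. -/
def natF (rk : Q → ℕ) (F : Q → (Q → Set W) → Set W) (k : ℕ) (ρ : Env W) : Set W :=
  ⋃ q, {w | rk q = k ∧ w ∈ F q (fun p => ρ (rk p))}

open Classical in
/-- Least fixpoints are taken at odd priorities. -/
noncomputable def natMu (rk pri : Q → ℕ) (k : ℕ) : Bool := decide (∃ q, rk q = k ∧ Odd (pri q))

/-- Guards over `ℕ` induced by a ranking. -/
def natG (rk : Q → ℕ) (g : Q → Set W) : Env W := fun k => {w | ∀ q, rk q = k → w ∈ g q}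

variable {rk pri : Q → ℕ} {F : Q → (Q → Set W) → Set W}

theorem natF_rk (hr : Injective rk) (q : Q) (ρ : Env W) :
    natF rk F (rk q) ρ = F q (fun p => ρ (rk p)) := by
  ext w
  simp only [natF, mem_iUnion, mem_ofPred_eq]
  constructor
  · rintro ⟨p, hp, hw⟩
    exact hr hp ▸ hw
  · exact fun hw => ⟨q, rfl, hw⟩

theorem natMu_rk (hr : Injective rk) (q : Q) : natMu rk pri (rk q) = decide (Odd (pri q)) := by
  simp only [natMu, decide_eq_decide]
  constructor
  · rintro ⟨p, hp, h⟩
    exact hr hp ▸ h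
  · exact fun h => ⟨q, rfl, h⟩

theorem natG_rk (hr : Injective rk) (g : Q → Set W) (q : Q) : natG rk g (rk q) = g q := by
  ext w
  constructor
  · exact fun h => h q rfl
  · exact fun h p hp => hr hp ▸ h

theorem natG_cut (hr : Injective rk) (g : Q → Set W) (q : Q) :
    natG rk (cutRank rk q g) = cutBelow (rk q) (natG rk g) := by
  funext k
  by_cases h : ∃ p, rk p = k
  · obtain ⟨p, rfl⟩ := h
    rw [natG_rk hr, cutBelow, natG_rk hr, cutRank]
  · have : ∀ g : Q → Set W, natG rk g k = univ := fun g => by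
      ext w; simpa [natG] using fun q hq => absurd ⟨q, hq⟩ h
    simp [this, cutBelow]

/-- The solution of a system with respect to a ranking. -/
noncomputable def solR (Adm : Set (Set W)) (rk pri : Q → ℕ) (n : ℕ) (F : Q → (Q → Set W) → Set W) :
    Q → Set W :=
  fun q => solveBelow Adm (natF rk F) (natMu rk pri) n (fun _ => ∅) (rk q)

theorem solR_dual {Adm : Set (Set W)} {n : ℕ} (hr : Ranking pri rk n) :
    solR Adm rk (fun q => pri q + 1) n (fun q ρ => (F q (fun p => (ρ p)ᶜ))ᶜ) =
      fun q => (solR Adm rk pri n F q)ᶜ := by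
  funext q
  rw [solR, solveBelow_dual (F := natF rk F) (mu := natMu rk pri), solR]
  · dsimp only
    congr 1
    refine solveBelow_local (fun k hk ρ ρ' h => ?_) le_rfl (fun j h1 h2 => by omega) _ (hr.lt q)
    obtain ⟨p, rfl⟩ := hr.surj k hk
    rw [natF_rk hr.inj, natF_rk hr.inj]
    congr 1
    funext p
    exact h _ (hr.lt p)
  · intro k hk ρ
    obtain ⟨p, rfl⟩ := hr.surj k hk
    rw [natF_rk hr.inj, natF_rk hr.inj]
  · intro k hk
    obtain ⟨p, rfl⟩ := hr.surj k hk
    rw [natMu_rk hr.inj, natMu_rk hr.inj]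
    by_cases h : Odd (pri p) <;> simp [h, Nat.odd_add_one]

end Transfer

theorem natG_adm {M : Frame Act Atom} {Q : Type} {rk : Q → ℕ} (hM : MF M) (hr : Injective rk) {g : Q → Set M.W} (hg : ∀ q, g q ∈ M.Adm) (k : ℕ) :
    natG rk g k ∈ M.Adm := by
  by_cases h : ∃ p, rk p = k
  · obtain ⟨p, rfl⟩ := h
    rw [natG_rk hr]; exact hg p
  · have : natG rk g k = univ := by
      ext w; simpa [natG] using fun q hq => absurd ⟨q, hq⟩ h
    rw [this]; exact hM.univ_mem

section MkAnn
variable {M : Frame Act Atom} {Q : Type} [Finite Q] {rk pri : Q → ℕ} {n : ℕ}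
  {F : Q → (Q → Set M.W) → Set M.W}

theorem natF_PF (hM : MF M) (hF : ∀ q, PFQ M (F q)) (k : ℕ) : PF M (natF rk F k) := by
  refine PF.iUnion hM fun q => ?_
  by_cases h : rk q = k
  · simpa [h] using hF q rk
  · simpa [h] using PF.const hM.empty_mem

theorem PFQ.mono {f : (Q → Set M.W) → Set M.W} (hf : PFQ M f) : Monotone f := by
  obtain ⟨m, ⟨e⟩⟩ := Finite.exists_equiv_fin Q
  have h := (hf fun q => (e q : ℕ)).mono
  intro ρ ρ' hρ
  have := h (a := fun k => {w | ∃ q, (e q : ℕ) = k ∧ w ∈ ρ q})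
    (b := fun k => {w | ∃ q, (e q : ℕ) = k ∧ w ∈ ρ' q}) fun k w ⟨q, h1, h2⟩ => ⟨q, h1, hρ q h2⟩
  have key : ∀ τ : Q → Set M.W, (fun p => {w | ∃ q, (e q : ℕ) = e p ∧ w ∈ τ q}) = τ := by
    intro τ; funext p; ext w
    constructor
    · rintro ⟨q, h1, h2⟩
      rw [← e.injective (Fin.ext h1)]; exact h2
    · exact fun h => ⟨p, rfl, h⟩
  simpa only [key] using this

/-- The approximations attached to a definable system. -/
noncomputable def mkAnn (hM : MF M) (hr : Ranking pri rk n) (hF : ∀ q, PFQ M (F q)) : Ann M Q where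
  F := F
  pri := pri
  rk := rk
  U g q := solveGuard M.Adm (natF rk F) (natMu rk pri) (natG rk g) n (fun _ => ∅) (rk q)
  rk_inj := hr.inj
  rk_pri := hr.pri_le
  F_mono q := (hF q).mono
  U_mono g g' h q := solveGuard_mono hM (natF_PF hM hF)
    (fun k w (hw : ∀ q, rk q = k → w ∈ g q) q hq => h q (hw q hq)) n le_rfl (rk q)
  U_adm g hg q := solveGuard_adm hM (natF_PF hM hF) (natG_adm hM hr.inj hg) n
    (fun _ => hM.empty_mem) (rk q)
  U_guard g hg q := by
    rw [solveGuard_unfold hM (natF_PF hM hF) (natG_adm hM hr.inj hg) (fun _ => hM.empty_mem)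
      (hr.lt q), natG_rk hr.inj]
    exact inter_subset_left
  U_unf g hg q := by
    rw [solveGuard_unfold hM (natF_PF hM hF) (natG_adm hM hr.inj hg) (fun _ => hM.empty_mem)
      (hr.lt q), natF_rk hr.inj, natG_cut hr.inj]
    exact inter_subset_right
  U_str g hg q hq c hc hne g' hg' hg'' := by
    have := solveGuard_strengthen hM (natF_PF hM hF) (natG_adm hM hr.inj hg)
      (fun _ => hM.empty_mem) (hr.lt q) (by rw [natMu_rk hr.inj]; simpa using hq) hc hne
    rw [natF_rk hr.inj] at this
    convert this using 8
    funext k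
    by_cases h : ∃ p, rk p = k
    · obtain ⟨p, rfl⟩ := h
      rw [natG_rk hr.inj, natG_rk hr.inj]
      by_cases e : p = q
      · subst e; simpa using hg'
      · rw [hg'' p e, update_of_ne (fun h => e (hr.inj h)), ← natG_cut hr.inj, natG_rk hr.inj]
    · have hk : natG rk g' k = univ := by
        ext w; simpa [natG] using fun q hq => absurd ⟨q, hq⟩ h
      have hk' : natG rk (cutRank rk q g) k = univ := by
        ext w; simpa [natG] using fun q hq => absurd ⟨q, hq⟩ h
      rw [hk, update_of_ne (fun h' => h ⟨q, h'.symm⟩), ← natG_cut hr.inj, hk']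
  unf_univ q := by
    have := solveGuard_unfold hM (natF_PF hM hF (rk := rk)) (mu := natMu rk pri)
      (natG_adm hM hr.inj (fun _ : Q => hM.univ_mem)) (fun _ => hM.empty_mem) (hr.lt q)
    rw [natG_rk hr.inj, natF_rk hr.inj, ← natG_cut hr.inj, univ_inter] at this
    have hcut : cutRank rk q (fun _ => (univ : Set M.W)) = fun _ => univ := by
      funext p; simp [cutRank]
    rw [hcut] at this
    exact this.symm

theorem mkAnn_y (hM : MF M) (hr : Ranking pri rk n) (hF : ∀ q, PFQ M (F q)) :
    (mkAnn hM hr hF).y = solR M.Adm rk pri n F := by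
  funext q
  simp only [Ann.y, mkAnn, solR]
  rw [solveGuard_univ]
  intro j _
  simp [natG]

end MkAnn

section OptionSystem
variable {W Q : Type} {rk pri : Q → ℕ} {n : ℕ}

/-- Extend a `Q`-indexed family by a value at `none`. -/
def optCons {α : Type*} (x : α) (ρ : Q → α) : Option Q → α
  | none => x
  | some q => ρ q

theorem Ranking.option (hr : Ranking pri rk n) {c : ℕ} (hc : ∀ q, pri q ≤ c) :
    Ranking (optCons c pri) (optCons n rk) (n + 1) where
  inj := by
    rintro (_ | p) (_ | q) h
    · rfl
    · exact absurd h (hr.lt q).ne'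
    · exact absurd h (hr.lt p).ne
    · exact congrArg some (hr.inj h)
  lt := by
    rintro (_ | q)
    · exact Nat.lt_succ_self n
    · exact (hr.lt q).trans (Nat.lt_succ_self n)
  surj k hk := by
    by_cases e : k = n
    · exact ⟨none, e.symm⟩
    · obtain ⟨q, rfl⟩ := hr.surj k (by omega)
      exact ⟨some q, rfl⟩
  pri_le := by
    rintro (_ | p) (_ | q) h
    · exact le_rfl
    · exact absurd h (Nat.not_le.2 (hr.lt q))
    · exact hc p
    · exact hr.pri_le p q h

variable {Adm : Set (Set W)} {F : Option Q → (Option Q → Set W) → Set W}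

theorem solveBelow_option (hr : Ranking pri rk n) {c : ℕ} (hc : ∀ q, pri q ≤ c) {k : ℕ}
    (hk : k ≤ n) (ρ : Env W) :
    solveBelow Adm (natF (optCons n rk) F) (natMu (optCons n rk) (optCons c pri)) k ρ =
      solveBelow Adm (natF rk fun q τ => F (some q) (optCons (ρ n) τ)) (natMu rk pri) k ρ := by
  induction k generalizing ρ with
  | zero => rfl
  | succ k ih =>
    obtain ⟨q, hq⟩ := hr.surj k (by omega)
    have hr' := hr.option hc
    have e1 : ∀ t, update ρ k t n = ρ n := fun t => update_of_ne (by omega) _ _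
    have e2 : natMu (optCons n rk) (optCons c pri) k = natMu rk pri k := by
      rw [← hq, natMu_rk hr.inj]
      exact natMu_rk hr'.inj (some q)
    have e3 : ∀ τ : Env W, natF (optCons n rk) F k τ = F (some q) (fun p => τ (optCons n rk p)) := by
      intro τ
      rw [← hq]; exact natF_rk hr'.inj (some q) τ
    have e4 : ∀ (x : Set W) (τ : Env W), natF rk (fun q τ => F (some q) (optCons x τ)) k τ =
        F (some q) (optCons x fun p => τ (rk p)) := by
      intro x τ
      rw [← hq]; exact natF_rk hr.inj q τ
    have e5 : ∀ t, solveBelow Adm (natF rk fun q τ => F (some q) (optCons (ρ n) τ)) (natMu rk pri) k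
        (update ρ k t) n = ρ n := by
      intro t
      rw [← solveGuard_univ k _ (g := fun _ => univ) (fun _ _ => rfl), solveGuard_of_le _ (by omega),
        e1]
    have e6 : (fun t => natF (optCons n rk) F k (solveBelow Adm (natF (optCons n rk) F)
          (natMu (optCons n rk) (optCons c pri)) k (update ρ k t))) =
        (fun t => natF rk (fun q τ => F (some q) (optCons (ρ n) τ)) k (solveBelow Adm
          (natF rk fun q τ => F (some q) (optCons (ρ n) τ)) (natMu rk pri) k (update ρ k t))) := by
      funext t
      rw [e3, e4, ih (by omega), e1]
      congr 1
      funext p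
      cases p with
      | none => exact e5 t
      | some p => rfl
    rw [solveBelow, solveBelow, e6, e2, ih (by omega), e1]

/-- Solving an equation whose variable has the highest rank. -/
theorem solR_option (hr : Ranking pri rk n) {c : ℕ} (hc : ∀ q, pri q ≤ c) :
    solR Adm (optCons n rk) (optCons c pri) (n + 1) F none = fx Adm (decide (Odd c))
      (fun T => F none (optCons T (solR Adm rk pri n fun q τ => F (some q) (optCons T τ)))) ∧
    ∀ q, solR Adm (optCons n rk) (optCons c pri) (n + 1) F (some q) =
      solR Adm rk pri n (fun q τ => F (some q)
        (optCons (solR Adm (optCons n rk) (optCons c pri) (n + 1) F none) τ)) q := by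
  have hr' := hr.option hc
  have loc : ∀ (T : Set W) (ρ ρ' : Env W) (q : Q),
      solveBelow Adm (natF rk fun q τ => F (some q) (optCons T τ)) (natMu rk pri) n ρ (rk q) =
      solveBelow Adm (natF rk fun q τ => F (some q) (optCons T τ)) (natMu rk pri) n ρ' (rk q) := by
    intro T ρ ρ' q
    refine solveBelow_local (fun k hk ρ ρ' h => ?_) le_rfl (fun j h1 h2 => by omega) _ (hr.lt q)
    obtain ⟨p, rfl⟩ := hr.surj k hk
    rw [natF_rk hr.inj, natF_rk hr.inj]
    congr 2
    funext p
    exact h _ (hr.lt p)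
  have top : ∀ (F' : ℕ → Env W → Set W) (m : ℕ → Bool) (ρ : Env W),
      solveBelow Adm F' m n ρ n = ρ n := by
    intro F' m ρ
    rw [← solveGuard_univ n _ (g := fun _ => univ) (fun _ _ => rfl), solveGuard_of_le _ le_rfl]
  have e0 : solR Adm (optCons n rk) (optCons c pri) (n + 1) F none = fx Adm (decide (Odd c))
      (fun T => F none (optCons T (solR Adm rk pri n fun q τ => F (some q) (optCons T τ)))) := by
    rw [solR]
    change solveBelow _ _ _ _ _ n = _
    rw [solveBelow, top, update_self]
    have : natMu (optCons n rk) (optCons c pri) n = decide (Odd c) := natMu_rk hr'.inj none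
    rw [this]
    congr 1
    funext T
    rw [show natF (optCons n rk) F n = _ from funext fun τ => natF_rk hr'.inj none τ]
    dsimp only
    rw [solveBelow_option hr hc le_rfl, update_self]
    congr 1
    funext p
    cases p with
    | none => exact (top _ _ _).trans (update_self _ _ _)
    | some p => exact loc T _ _ p
  refine ⟨e0, fun q => ?_⟩
  have e1 : solR Adm (optCons n rk) (optCons c pri) (n + 1) F none =
      solveBelow Adm (natF (optCons n rk) F) (natMu (optCons n rk) (optCons c pri)) (n + 1)
        (fun _ => ∅) n := rfl
  rw [e1, solR]
  change solveBelow _ _ _ _ _ (rk q) = _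
  rw [solveBelow, top, update_self, solveBelow_option hr hc le_rfl, update_self]
  exact loc _ _ _ q

end OptionSystem

/-- The largest value taken infinitely often by the bounded sequence `c` is odd. -/
def OddDom (c : ℕ → ℕ) : Prop :=
  ∃ p, Odd p ∧ (∃ᶠ t in atTop, c t = p) ∧ ∀ᶠ t in atTop, c t ≤ p

/-- Finitely many slots, each running through the states of an equation system; a
configuration assigns to each slot a state or a pending formula. -/
structure Arena (M : Frame Act Atom) (ι C : Type) where
  Q : ι → Type
  A : ∀ i, Ann M (Q i)
  ent : C → ∀ i, Option (Q i)
  pf : C → ∀ i, (Q i → Set M.W) → Set M.W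
  K : C → Set M.W

namespace Arena
variable {M : Frame Act Atom} {ι C : Type} (X : Arena M ι C)

/-- Value of slot `i` on arrival. -/
def land (c : C) (i : ι) (v : X.Q i → Set M.W) : Set M.W :=
  (X.ent c i).elim (X.pf c i v) v

/-- Value of slot `i` after unfolding. -/
def unf (c : C) (i : ι) (v : X.Q i → Set M.W) : Set M.W :=
  (X.ent c i).elim (X.pf c i v) fun q => (X.A i).F q v

/-- Priority of slot `i`. -/
def colour (c : C) (i : ι) : ℕ := (X.ent c i).elim 0 (X.A i).pri

/-- The one-step hypothesis of the path theorem. -/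
def HStep (S : C → C → (ι → Prop) → Prop) : Prop :=
  ∀ (c : C) (v : ∀ i, X.Q i → Set M.W), (∀ i q, v i q ∈ M.Adm) → (∀ i, v i ≤ (X.A i).y) →
    ∀ w ∈ X.K c, (∀ i, w ∈ X.unf c i (v i)) → ∃ c' kept, S c c' kept ∧ ∃ w' ∈ X.K c', ∀ i,
      (kept i → w' ∈ X.land c' i (v i)) ∧ (¬ kept i → w' ∈ X.land c' i (X.A i).y)

/-- Regularity of an arena. -/
structure Good : Prop where
  pf_mono : ∀ c i, Monotone (X.pf c i)
  pf_adm : ∀ c i v, (∀ q, v q ∈ M.Adm) → X.pf c i v ∈ M.Adm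
  K_adm : ∀ c, X.K c ∈ M.Adm

/-- Guards at all states of all slots. -/
abbrev Guards := ∀ i, X.Q i → Set M.W

/-- A slot together with one of its states. -/
abbrev Pr := Σ i, X.Q i

/-- The pair `π` is currently visited and has odd priority. -/
def Hit (c : C) (π : X.Pr) : Prop := X.ent c π.1 = some π.2 ∧ Odd ((X.A π.1).pri π.2)

/-- The pair `π` loses its guard in this round. -/
def Reset (c : C) (kept : ι → Prop) (π : X.Pr) : Prop :=
  ¬ kept π.1 ∨ ∃ q, X.ent c π.1 = some q ∧ (X.A π.1).rk π.2 < (X.A π.1).rk q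

open Classical in
/-- The guards senior to `π`. -/
noncomputable def senior (g : X.Guards) (key : X.Pr → ℕ) (π : X.Pr) : X.Guards :=
  fun i q => if key ⟨i, q⟩ < key π then g i q else univ

/-- What is known about the other slots by means of guards senior to `π`. -/
def ctx (c : C) (g : X.Guards) (key : X.Pr → ℕ) (π : X.Pr) : Set M.W :=
  X.K c ∩ ⋂ j, {w | j ≠ π.1 → w ∈ X.land c j ((X.A j).U (X.senior g key π j))}

/-- Invariant of the construction. -/
def Inv (c : C) (g : X.Guards) : Prop :=
  (∀ i q, g i q ∈ M.Adm) ∧ (X.K c ∩ ⋂ i, X.land c i ((X.A i).U (g i))).Nonempty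

/-- How guards are updated in a round. -/
def Upd (c : C) (kept : ι → Prop) (key : X.Pr → ℕ) (g g' : X.Guards) : Prop :=
  (∀ π, ¬ X.Reset c kept π → (∀ π', X.Hit c π' → key π < key π') → g' π.1 π.2 = g π.1 π.2) ∧
  ∀ π, ¬ X.Reset c kept π → X.Hit c π → (∀ π', X.Hit c π' → π' ≠ π → key π < key π') →
    g' π.1 π.2 ⊆ g π.1 π.2 \ X.ctx c g key π

variable {X}

theorem land_mono (hX : X.Good) (c : C) (i : ι) : Monotone (X.land c i) := by
  intro v v' h
  unfold land
  cases X.ent c i with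
  | none => exact hX.pf_mono c i h
  | some q => exact h q

theorem land_adm (hX : X.Good) (c : C) (i : ι) {v : X.Q i → Set M.W} (h : ∀ q, v q ∈ M.Adm) :
    X.land c i v ∈ M.Adm := by
  unfold land
  cases X.ent c i with
  | none => exact hX.pf_adm c i _ h
  | some q => exact h q

open Classical in
/-- The guards of slot `i` surviving a visit of the current entry. -/
noncomputable def cutEnt (X : Arena M ι C) (c : C) (i : ι) (g : X.Q i → Set M.W) :
    X.Q i → Set M.W :=
  (X.ent c i).elim g fun q => cutRank (X.A i).rk q g

theorem land_sub_unf (c : C) (i : ι) {g : X.Q i → Set M.W} (hg : ∀ q, g q ∈ M.Adm) :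
    X.land c i ((X.A i).U g) ⊆ X.unf c i ((X.A i).U (X.cutEnt c i g)) := by
  unfold land unf cutEnt
  cases X.ent c i with
  | none => exact Subset.rfl
  | some q => exact (X.A i).U_unf g hg q

theorem cutEnt_adm (hM : MF M) (c : C) (i : ι) {g : X.Q i → Set M.W} (hg : ∀ q, g q ∈ M.Adm) (q) :
    X.cutEnt c i g q ∈ M.Adm := by
  unfold cutEnt
  cases X.ent c i with
  | none => exact hg q
  | some p =>
    simp only [Option.elim, cutRank]
    split
    · exact hg q
    · exact hM.univ_mem

theorem cutEnt_of_not_reset {c : C} {kept : ι → Prop} {π : X.Pr} (h : ¬ X.Reset c kept π)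
    (g : X.Q π.1 → Set M.W) : X.cutEnt c π.1 g π.2 = g π.2 := by
  unfold cutEnt
  cases e : X.ent c π.1 with
  | none => rfl
  | some p =>
    simp only [Option.elim, cutRank]
    rw [if_pos]
    by_contra hlt
    exact h (.inr ⟨p, e, not_le.1 hlt⟩)

theorem senior_adm (hM : MF M) {g : X.Guards} (hg : ∀ i q, g i q ∈ M.Adm) (key : X.Pr → ℕ)
    (π : X.Pr) (i : ι) (q : X.Q i) : X.senior g key π i q ∈ M.Adm := by
  unfold senior; split
  · exact hg i q
  · exact hM.univ_mem

theorem ctx_adm [Finite ι] (hM : MF M) (hX : X.Good) {g : X.Guards} (hg : ∀ i q, g i q ∈ M.Adm)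
    (c : C) (key : X.Pr → ℕ) (π : X.Pr) : X.ctx c g key π ∈ M.Adm := by
  refine hM.inter_mem (hX.K_adm c) (hM.iInter_mem fun j => ?_)
  by_cases e : j = π.1
  · simpa [e] using hM.univ_mem
  · simpa [e] using land_adm hX c j ((X.A j).U_adm _ (senior_adm hM hg key π j))

/-- From the invariant, one can unfold all slots simultaneously. -/
theorem unfold_guards [Finite ι] [∀ i, Finite (X.Q i)] (hM : MF M) (hX : X.Good) {c : C}
    {g : X.Guards} (hI : X.Inv c g) {key : X.Pr → ℕ} (hkey : Injective key) :
    ∃ h : X.Guards, (∀ i q, h i q ∈ M.Adm) ∧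
      (∃ w ∈ X.K c, ∀ i, w ∈ X.unf c i ((X.A i).U (X.cutEnt c i (h i)))) ∧
      (∀ π : X.Pr, (∀ π', X.Hit c π' → key π < key π') → h π.1 π.2 = g π.1 π.2) ∧
      ∀ π, X.Hit c π → (∀ π', X.Hit c π' → π' ≠ π → key π < key π') →
        h π.1 π.2 ⊆ g π.1 π.2 \ X.ctx c g key π := by
  classical
  obtain ⟨hg, w, hwK, hw⟩ := hI
  rw [mem_iInter] at hw
  by_cases hH : ∃ π, X.Hit c π
  · obtain ⟨π, hπ, hmin⟩ : ∃ π, X.Hit c π ∧ ∀ π', X.Hit c π' → π' ≠ π → key π < key π' := by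
      obtain ⟨π, hπ, h⟩ := (toFinite {π | X.Hit c π}).exists_minimalFor key _ hH
      refine ⟨π, hπ, fun π' h' hne => ?_⟩
      by_contra hlt
      exact hne (hkey (le_antisymm (not_lt.1 hlt) (h h' (not_lt.1 hlt))))
    obtain ⟨i0, q0⟩ := π
    set κ := X.ctx c g key ⟨i0, q0⟩ with hκ
    have κadm : κ ∈ M.Adm := ctx_adm hM hX hg c key _
    let s := X.senior g key ⟨i0, q0⟩
    have sadm : ∀ i q, s i q ∈ M.Adm := senior_adm hM hg key _
    have gs : g ≤ s := by
      intro i q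
      change g i q ⊆ if _ then _ else _
      split
      · exact Subset.rfl
      · exact subset_univ _
    let h : X.Guards := fun i q => if key ⟨i, q⟩ = key ⟨i0, q0⟩ then g i q \ κ else s i q
    have hadm : ∀ i q, h i q ∈ M.Adm := by
      intro i q
      dsimp only [h]
      split
      · exact hM.diff_mem (hg i q) κadm
      · exact sadm i q
    have hκw : w ∈ κ := by
      refine ⟨hwK, mem_iInter.2 fun j _ => ?_⟩
      exact land_mono hX c j ((X.A j).U_mono (gs j)) (hw j)
    have hne_i : ∀ j, j ≠ i0 → h j = s j := by
      intro j hj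
      funext q
      dsimp only [h]
      rw [if_neg]
      intro e
      exact hj (congrArg Sigma.fst (hkey e))
    refine ⟨h, hadm, ?_, ?_, ?_⟩
    · let g2 : X.Q i0 → Set M.W := fun q => if q = q0 then g i0 q else s i0 q
      have g2adm : ∀ q, g2 q ∈ M.Adm := by
        intro q; dsimp only [g2]; split
        · exact hg _ _
        · exact sadm _ _
      have hgg2 : g i0 ≤ g2 := by
        intro q
        change g i0 q ⊆ if _ then _ else _
        split
        · exact Subset.rfl
        · exact gs i0 q
      have hw0 : w ∈ (X.A i0).U (g i0) q0 := by
        have := hw i0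
        rwa [land, hπ.1] at this
      have h2 : (κ ∩ (X.A i0).U g2 q0).Nonempty := ⟨w, hκw, (X.A i0).U_mono hgg2 q0 hw0⟩
      obtain ⟨u, hu1, hu2⟩ := (X.A i0).U_str g2 g2adm q0 hπ.2 κ κadm h2
        (X.cutEnt c i0 (h i0)) (by
          simp [cutEnt, hπ.1, cutRank, h, g2]) (by
          intro p hp
          have : key ⟨i0, p⟩ ≠ key ⟨i0, q0⟩ := fun e => hp (by simpa using hkey e)
          simp [cutEnt, hπ.1, cutRank, h, g2, hp, this])
      refine ⟨u, hu1.1, fun j => ?_⟩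
      by_cases hj : j = i0
      · subst hj
        rw [unf, hπ.1]
        exact hu2
      · refine land_sub_unf c j (hadm j) ?_
        rw [hne_i j hj]
        exact mem_iInter.1 hu1.2 j hj
    · rintro ⟨i, q⟩ hlt
      have := hlt _ hπ
      simp only [h, this.ne, if_false]
      exact if_pos this
    · rintro ⟨i, q⟩ hh hm
      obtain e : (⟨i0, q0⟩ : X.Pr) = ⟨i, q⟩ := by
        by_contra hne
        exact lt_asymm (hm _ hπ hne) (hmin _ hh (Ne.symm hne))
      cases e
      simp only [h, if_true]
      exact Subset.rfl
  · refine ⟨g, hg, ⟨w, hwK, fun i => land_sub_unf c i (hg i) (hw i)⟩, fun _ _ => rfl, ?_⟩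
    intro π hπ
    exact absurd ⟨π, hπ⟩ hH

/-- One round of the construction. -/
theorem exists_round [Finite ι] [∀ i, Finite (X.Q i)] (hM : MF M) (hX : X.Good)
    {S : C → C → (ι → Prop) → Prop} (hS : X.HStep S) {c : C} {g : X.Guards} (hI : X.Inv c g)
    {key : X.Pr → ℕ} (hkey : Injective key) :
    ∃ c' kept g', S c c' kept ∧ X.Inv c' g' ∧ X.Upd c kept key g g' := by
  classical
  obtain ⟨h, hadm, ⟨w, hwK, hw⟩, h1, h2⟩ := unfold_guards hM hX hI hkey
  have vadm : ∀ i q, (X.A i).U (X.cutEnt c i (h i)) q ∈ M.Adm :=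
    fun i => (X.A i).U_adm _ (cutEnt_adm hM c i (hadm i))
  obtain ⟨c', kept, hSt, w', hK', hw'⟩ := hS c (fun i => (X.A i).U (X.cutEnt c i (h i)))
    vadm (fun i => (X.A i).U_le_y _) w hwK hw
  refine ⟨c', kept, fun i => if kept i then X.cutEnt c i (h i) else fun _ => univ, hSt,
    ⟨?_, w', hK', mem_iInter.2 fun i => ?_⟩, ?_, ?_⟩
  · intro i q
    by_cases e : kept i
    · simpa [e] using cutEnt_adm hM c i (hadm i) q
    · simpa [e] using hM.univ_mem
  · by_cases e : kept i
    · simpa [e] using (hw' i).1 e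
    · simpa [e, Ann.y] using (hw' i).2 e
  · intro π hr hlt
    have : kept π.1 := by
      by_contra e; exact hr (.inl e)
    simp only [this, if_true]
    rw [cutEnt_of_not_reset hr, h1 π hlt]
  · intro π hr hh hlt
    have : kept π.1 := by
      by_contra e; exact hr (.inl e)
    simp only [this, if_true]
    rw [cutEnt_of_not_reset hr]
    exact h2 π hh hlt

end Arena

/-- Among finitely many values, one is taken frequently. -/
theorem exists_frequently_eq {α : Type*} [Finite α] {l : Filter ℕ} {f : ℕ → α} {P : ℕ → Prop}
    (h : ∃ᶠ t in l, P t) : ∃ a, ∃ᶠ t in l, P t ∧ f t = a := by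
  by_contra hcon
  simp only [not_exists, not_frequently] at hcon
  refine h ?_
  filter_upwards [eventually_all.2 hcon] with t ht hP
  exact ht (f t) ⟨hP, rfl⟩

namespace Arena
variable {M : Frame Act Atom} {ι C : Type} {X : Arena M ι C}

theorem inv_sub_ctx (hX : X.Good) {c : C} {g : X.Guards} (key : X.Pr → ℕ) (π : X.Pr) :
    X.K c ∩ ⋂ i, X.land c i ((X.A i).U (g i)) ⊆ X.ctx c g key π := by
  classical
  rintro w ⟨hwK, hw⟩
  refine ⟨hwK, mem_iInter.2 fun j _ => ?_⟩
  refine land_mono hX c j ((X.A j).U_mono fun q => ?_) (mem_iInter.1 hw j)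
  change g j q ⊆ if _ then _ else _
  split
  · exact Subset.rfl
  · exact subset_univ _

/-- A run of the construction, with the dates of the last resets. -/
structure IsRun (X : Arena M ι C) (key : (X.Pr → ℕ) → X.Pr → ℕ) (c : ℕ → C) (g : ℕ → X.Guards)
    (lam : ℕ → X.Pr → ℕ) (kept : ℕ → ι → Prop) : Prop where
  inv : ∀ t, X.Inv (c t) (g t)
  upd : ∀ t, X.Upd (c t) (kept t) (key (lam t)) (g t) (g (t + 1))
  lam_reset : ∀ t π, X.Reset (c t) (kept t) π → lam (t + 1) π = t + 1
  lam_keep : ∀ t π, ¬ X.Reset (c t) (kept t) π → lam (t + 1) π = lam t π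
  lam_zero : ∀ π, lam 0 π = 0

theorem exists_run [Finite ι] [∀ i, Finite (X.Q i)] (hM : MF M) (hX : X.Good)
    {S : C → C → (ι → Prop) → Prop} (hS : X.HStep S) {c0 : C}
    (h0 : (X.K c0 ∩ ⋂ i, X.land c0 i (X.A i).y).Nonempty)
    {key : (X.Pr → ℕ) → X.Pr → ℕ} (hkey : ∀ l, Injective (key l)) :
    ∃ c g lam kept, X.IsRun key c g lam kept ∧ c 0 = c0 ∧
      ∀ t, S (c t) (c (t + 1)) (kept t) := by
  classical
  let St := {s : C × X.Guards × (X.Pr → ℕ) // X.Inv s.1 s.2.1}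
  have step : ∀ (t : ℕ) (s : St), ∃ (s' : St) (kept : ι → Prop), S s.1.1 s'.1.1 kept ∧
      X.Upd s.1.1 kept (key s.1.2.2) s.1.2.1 s'.1.2.1 ∧
      s'.1.2.2 = fun π => if X.Reset s.1.1 kept π then t + 1 else s.1.2.2 π := by
    intro t s
    obtain ⟨c', kept, g', h1, h2, h3⟩ := exists_round hM hX hS s.2 (hkey s.1.2.2)
    exact ⟨⟨(c', g', _), h2⟩, kept, h1, h3, rfl⟩
  choose nxt kp hstep using step
  let s0 : St := ⟨(c0, fun _ _ => univ, fun _ => 0), ⟨fun _ _ => hM.univ_mem, h0⟩⟩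
  let seq : ℕ → St := fun t => Nat.rec s0 nxt t
  refine ⟨fun t => (seq t).1.1, fun t => (seq t).1.2.1, fun t => (seq t).1.2.2,
    fun t => kp t (seq t), ⟨fun t => (seq t).2, fun t => (hstep t (seq t)).2.1, ?_, ?_, ?_⟩, rfl,
    fun t => (hstep t (seq t)).1⟩
  · intro t π h
    exact (congrFun (hstep t (seq t)).2.2 π).trans (if_pos h)
  · intro t π h
    exact (congrFun (hstep t (seq t)).2.2 π).trans (if_neg h)
  · intro π; rfl

namespace IsRun
variable {key : (X.Pr → ℕ) → X.Pr → ℕ} {c : ℕ → C} {g : ℕ → X.Guards}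
  {lam : ℕ → X.Pr → ℕ} {kept : ℕ → ι → Prop}

theorem lam_le (hr : X.IsRun key c g lam kept) (t : ℕ) (π : X.Pr) : lam t π ≤ t := by
  induction t with
  | zero => exact (hr.lam_zero π).le
  | succ t ih =>
    by_cases h : X.Reset (c t) (kept t) π
    · exact (hr.lam_reset t π h).le
    · rw [hr.lam_keep t π h]; omega

theorem lam_mono (hr : X.IsRun key c g lam kept) (π : X.Pr) : Monotone fun t => lam t π := by
  refine monotone_nat_of_le_succ fun t => ?_
  by_cases h : X.Reset (c t) (kept t) π
  · rw [hr.lam_reset t π h]; exact (hr.lam_le t π).trans (by omega)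
  · rw [hr.lam_keep t π h]

theorem lam_stable (hr : X.IsRun key c g lam kept) {π : X.Pr}
    (h : ∀ᶠ t in atTop, ¬ X.Reset (c t) (kept t) π) : ∃ l, ∀ᶠ t in atTop, lam t π = l := by
  obtain ⟨T, hT⟩ := eventually_atTop.1 h
  refine ⟨lam T π, eventually_atTop.2 ⟨T, fun t ht => ?_⟩⟩
  induction t, ht using Nat.le_induction with
  | base => rfl
  | succ t ht ih => rw [hr.lam_keep t π (hT t ht), ih]

theorem lam_unstable (hr : X.IsRun key c g lam kept) {π : X.Pr}
    (h : ¬ ∀ᶠ t in atTop, ¬ X.Reset (c t) (kept t) π) (n : ℕ) : ∀ᶠ t in atTop, n < lam t π := by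
  have h' : ∃ᶠ t in atTop, X.Reset (c t) (kept t) π := h
  obtain ⟨t, ht, hR⟩ := frequently_atTop.1 h' n
  refine eventually_atTop.2 ⟨t + 1, fun s hs => ?_⟩
  have := hr.lam_mono π hs
  simp only [hr.lam_reset t π hR] at this
  omega

/-- A pair which is eventually never reset is hit finitely often. -/
theorem finite_hits [Finite C] [Finite ι] [∀ i, Finite (X.Q i)] (hX : X.Good)
    (hr : X.IsRun key c g lam kept) (hkey : ∀ l, Injective (key l))
    (hkl : ∀ l l' π, l π = l' π → key l π = key l' π) (hlk : ∀ l π, l π ≤ key l π) (n : ℕ) :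
    ∀ π, (∀ᶠ t in atTop, ¬ X.Reset (c t) (kept t) π) → (∀ᶠ t in atTop, key (lam t) π = n) →
      ¬ ∃ᶠ t in atTop, X.Hit (c t) π := by
  induction n using Nat.strong_induction_on with
  | _ n ih =>
  intro π hst hn hfr
  have hclass : ∀ π', π' ≠ π → (∀ᶠ t in atTop, n < key (lam t) π') ∨
      ∀ᶠ t in atTop, key (lam t) π' < n ∧ ¬ X.Hit (c t) π' ∧ ¬ X.Reset (c t) (kept t) π' := by
    intro π' hne
    by_cases hs : ∀ᶠ t in atTop, ¬ X.Reset (c t) (kept t) π'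
    · obtain ⟨l, hl⟩ := hr.lam_stable hs
      obtain ⟨m, hm⟩ : ∃ m, ∀ᶠ t in atTop, key (lam t) π' = m := by
        refine ⟨key (fun _ => l) π', hl.mono fun t ht => hkl _ _ _ ht⟩
      have hmn : m ≠ n := by
        rintro rfl
        obtain ⟨t, h1, h2⟩ := (hm.and hn).exists
        exact hne (hkey _ (h1.trans h2.symm))
      rcases lt_or_gt_of_ne hmn with h | h
      · right
        filter_upwards [hm, hs, not_frequently.1 (ih m h π' hs hm)] with t h1 h2 h3
        exact ⟨h1 ▸ h, h3, h2⟩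
      · left
        filter_upwards [hm] with t h1
        omega
    · left
      filter_upwards [hr.lam_unstable hs n] with t h1
      exact h1.trans_le (hlk _ _)
  have hclass' : ∃ T, ∀ t, T ≤ t → (key (lam t) π = n ∧ ¬ X.Reset (c t) (kept t) π) ∧
      ∀ π', π' ≠ π → (∀ s, T ≤ s → n < key (lam s) π') ∨
        ∀ s, T ≤ s → key (lam s) π' < n ∧ ¬ X.Hit (c s) π' ∧ ¬ X.Reset (c s) (kept s) π' := by
    have h2 : ∀ π' : X.Pr, ∀ᶠ T in atTop, π' ≠ π → (∀ s, T ≤ s → n < key (lam s) π') ∨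
        ∀ s, T ≤ s → key (lam s) π' < n ∧ ¬ X.Hit (c s) π' ∧ ¬ X.Reset (c s) (kept s) π' := by
      intro π'
      by_cases e : π' = π
      · exact Eventually.of_forall fun _ h => absurd e h
      · rcases hclass π' e with h | h
        · obtain ⟨T, hT⟩ := eventually_atTop.1 h
          exact eventually_atTop.2 ⟨T, fun T' hT' _ => .inl fun s hs => hT s (hT'.trans hs)⟩
        · obtain ⟨T, hT⟩ := eventually_atTop.1 h
          exact eventually_atTop.2 ⟨T, fun T' hT' _ => .inr fun s hs => hT s (hT'.trans hs)⟩
    obtain ⟨T1, hT1⟩ := eventually_atTop.1 (hn.and hst)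
    obtain ⟨T2, hT2⟩ := eventually_atTop.1 (eventually_all.2 h2)
    refine ⟨max T1 T2, fun t ht => ⟨hT1 t (le_trans (le_max_left _ _) ht), fun π' hne => ?_⟩⟩
    exact hT2 (max T1 T2) (le_max_right _ _) π' hne
  obtain ⟨T, hT⟩ := hclass'
  have hhit : ∀ t, T ≤ t → ∀ π', X.Hit (c t) π' → π' ≠ π → n < key (lam t) π' := by
    intro t ht π' hh hne
    rcases (hT t ht).2 π' hne with h | h
    · exact h t ht
    · exact absurd hh (h t ht).2.1
  have hconst : ∀ t, T ≤ t → X.senior (g t) (key (lam t)) π = X.senior (g T) (key (lam T)) π := by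
    intro t ht
    funext i q
    by_cases e : (⟨i, q⟩ : X.Pr) = π
    · simp [senior, e]
    · unfold senior
      rw [(hT t ht).1.1, (hT T le_rfl).1.1]
      rcases (hT T le_rfl).2 ⟨i, q⟩ e with h | h
      · rw [if_neg (h t ht).not_gt, if_neg (h T le_rfl).not_gt]
      · rw [if_pos (h t ht).1, if_pos (h T le_rfl).1]
        induction t, ht using Nat.le_induction with
        | base => rfl
        | succ t ht ih =>
          rw [← ih]
          refine (hr.upd t).1 ⟨i, q⟩ (h t ht).2.2 fun π' hh => ?_
          refine (h t ht).1.trans_le ?_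
          by_cases e' : π' = π
          · rw [e', (hT t ht).1.1]
          · exact (hhit t ht π' hh e').le
  have hctx : ∀ t t', T ≤ t → T ≤ t' → c t = c t' →
      X.ctx (c t) (g t) (key (lam t)) π = X.ctx (c t') (g t') (key (lam t')) π := by
    intro t t' ht ht' e
    unfold ctx
    rw [hconst t ht, hconst t' ht', e]
  have hdrop : ∀ t, T ≤ t → X.Hit (c t) π →
      g (t + 1) π.1 π.2 ⊆ g t π.1 π.2 \ X.ctx (c t) (g t) (key (lam t)) π := by
    intro t ht hh
    refine (hr.upd t).2 π (hT t ht).1.2 hh fun π' h' hne => ?_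
    rw [(hT t ht).1.1]; exact hhit t ht π' h' hne
  have hdec1 : ∀ t, T ≤ t → g (t + 1) π.1 π.2 ⊆ g t π.1 π.2 := by
    intro t ht
    by_cases hh : X.Hit (c t) π
    · exact (hdrop t ht hh).trans sdiff_subset
    · refine ((hr.upd t).1 π (hT t ht).1.2 fun π' h' => ?_).subset
      rw [(hT t ht).1.1]
      exact hhit t ht π' h' fun e => hh (e ▸ h')
  have hdec : ∀ s t, T ≤ s → s ≤ t → g t π.1 π.2 ⊆ g s π.1 π.2 := by
    intro s t hs hst
    induction t, hst using Nat.le_induction with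
    | base => exact Subset.rfl
    | succ t ht ih => exact (hdec1 t (hs.trans ht)).trans ih
  obtain ⟨a, ha⟩ := exists_frequently_eq (f := c) hfr
  obtain ⟨t, ht, hh, hca⟩ := frequently_atTop.1 ha T
  obtain ⟨t', ht', hh', hca'⟩ := frequently_atTop.1 ha (t + 1)
  obtain ⟨hga, w, hw⟩ := hr.inv t'
  have hw1 : w ∈ X.ctx (c t') (g t') (key (lam t')) π := inv_sub_ctx hX _ _ hw
  have hw2 : w ∈ g t' π.1 π.2 := by
    have := mem_iInter.1 hw.2 π.1
    rw [land, hh'.1] at this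
    exact (X.A π.1).U_guard _ (hga π.1) _ this
  have hw3 := hdrop t ht hh (hdec (t + 1) t' (by omega) ht' hw2)
  rw [hctx t t' ht (by omega) (hca.trans hca'.symm)] at hw3
  exact hw3.2 hw1

end IsRun

/-- The path theorem: from a nonempty configuration one can walk forever in such a way that
every slot which is eventually kept satisfies the parity condition. -/
theorem exists_path [Finite C] [Finite ι] [∀ i, Finite (X.Q i)] (hM : MF M) (hX : X.Good)
    {S : C → C → (ι → Prop) → Prop} (hS : X.HStep S) {c0 : C}
    (h0 : (X.K c0 ∩ ⋂ i, X.land c0 i (X.A i).y).Nonempty) :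
    ∃ (c : ℕ → C) (kept : ℕ → ι → Prop), c 0 = c0 ∧ (∀ t, S (c t) (c (t + 1)) (kept t)) ∧
      ∀ i, (∀ᶠ t in atTop, kept t i) → ¬ OddDom (fun t => X.colour (c t) i) := by
  classical
  obtain ⟨N, ⟨e⟩⟩ := Finite.exists_equiv_fin X.Pr
  let key : (X.Pr → ℕ) → X.Pr → ℕ := fun l π => Nat.pair (l π) (e π)
  have hkey : ∀ l, Injective (key l) := by
    intro l π π' h
    exact e.injective (Fin.ext (Nat.pair_eq_pair.1 h).2)
  have hkl : ∀ l l' π, l π = l' π → key l π = key l' π := fun l l' π h => by simp only [key, h]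
  have hlk : ∀ l π, l π ≤ key l π := fun l π => Nat.left_le_pair _ _
  obtain ⟨c, g, lam, kept, hr, hc0, hSt⟩ := exists_run hM hX hS h0 hkey
  refine ⟨c, kept, hc0, hSt, fun i hk hodd => ?_⟩
  obtain ⟨p, hp, hfr, hev⟩ := hodd
  obtain ⟨a, ha⟩ := exists_frequently_eq (f := fun t => X.ent (c t) i) hfr
  have hvis : ∃ q, (∃ᶠ t in atTop, X.ent (c t) i = some q) ∧ (X.A i).pri q = p := by
    obtain ⟨t, h1, h2⟩ := ha.exists
    cases a with
    | none =>
      simp only [colour, h2, Option.elim] at h1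
      subst h1
      exact absurd hp (by decide)
    | some q =>
      simp only [colour, h2, Option.elim] at h1
      exact ⟨q, ha.mono fun _ h => h.2, h1⟩
  obtain ⟨q1, hq1, hq1p⟩ := hvis
  obtain ⟨q, hq, hmax⟩ := (toFinite {q | ∃ᶠ t in atTop, X.ent (c t) i = some q}).exists_maximalFor
    (X.A i).rk _ ⟨q1, hq1⟩
  have hmax' : ∀ q', (∃ᶠ t in atTop, X.ent (c t) i = some q') → (X.A i).rk q' ≤ (X.A i).rk q := by
    intro q' h'
    by_contra hlt
    exact hlt (hmax h' (not_le.1 hlt).le)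
  have hqp : (X.A i).pri q = p := by
    refine le_antisymm ?_ ?_
    · obtain ⟨t, h1, h2⟩ := (hq.and_eventually hev).exists
      simpa only [colour, h1, Option.elim] using h2
    · rw [← hq1p]
      exact (X.A i).rk_pri _ _ (hmax' q1 hq1)
  have hstab : ∀ᶠ t in atTop, ¬ X.Reset (c t) (kept t) ⟨i, q⟩ := by
    have : ∀ q', ∀ᶠ t in atTop, (X.A i).rk q < (X.A i).rk q' → X.ent (c t) i ≠ some q' := by
      intro q'
      by_cases hlt : (X.A i).rk q < (X.A i).rk q'
      · by_contra hcon
        have : ∃ᶠ t in atTop, X.ent (c t) i = some q' :=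
          (not_eventually.1 hcon).mono fun t ht => by
            by_contra h; exact ht fun _ => h
        exact absurd (hmax' q' this) (not_le.2 hlt)
      · exact Eventually.of_forall fun _ h => absurd h hlt
    filter_upwards [hk, eventually_all.2 this] with t h1 h2
    rintro (h | ⟨q', h3, h4⟩)
    · exact h h1
    · exact h2 q' h4 h3
  obtain ⟨l, hl⟩ := hr.lam_stable hstab
  refine hr.finite_hits hX hkey hkl hlk (key (fun _ => l) ⟨i, q⟩) ⟨i, q⟩ hstab
    (hl.mono fun t ht => hkl (lam t) (fun _ => l) ⟨i, q⟩ ht) ?_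
  exact hq.mono fun t ht => ⟨ht, hqp ▸ hp⟩

end Arena

theorem PFQ.adm {M : Frame Act Atom} {Q : Type} [Finite Q] (hM : MF M)
    {f : (Q → Set M.W) → Set M.W} (hf : PFQ M f) {v : Q → Set M.W} (hv : ∀ q, v q ∈ M.Adm) :
    f v ∈ M.Adm := by
  obtain ⟨rk, hr⟩ := exists_ranking (fun _ : Q => 0)
  have := (hf rk).adm hM (ρ := natG rk v) (natG_adm hM hr.inj hv)
  have e : (fun p => natG rk v (rk p)) = v := funext fun p => natG_rk hr.inj v p
  rwa [e] at this

theorem PFQ.var {M : Frame Act Atom} {Q : Type} (hM : MF M) (q : Q) :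
    PFQ M (fun ρ : Q → Set M.W => ρ q) := fun e => PF.var hM (e q)

theorem PFQ.dual {M : Frame Act Atom} {Q : Type} (hM : MF M) {f : (Q → Set M.W) → Set M.W}
    (hf : PFQ M f) : PFQ M (fun ρ => (f (fun p => (ρ p)ᶜ))ᶜ) := fun e => (hf e).dual hM

theorem exists_dom {c : ℕ → ℕ} (hc : ∃ B, ∀ t, c t ≤ B) :
    ∃ p, (∃ᶠ t in atTop, c t = p) ∧ ∀ᶠ t in atTop, c t ≤ p := by
  obtain ⟨B, hB⟩ := hc
  have h : ∃ p, ∀ᶠ t in atTop, c t ≤ p := ⟨B, Eventually.of_forall hB⟩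
  classical
  refine ⟨Nat.find h, fun hcon => ?_, Nat.find_spec h⟩
  have hlt : ∀ᶠ t in atTop, c t < Nat.find h := by
    filter_upwards [hcon, Nat.find_spec h] with t h1 h2
    exact lt_of_le_of_ne h2 h1
  obtain ⟨t, ht⟩ := hlt.exists
  refine Nat.find_min h (m := Nat.find h - 1) (by omega) ?_
  filter_upwards [hlt] with t ht
  omega

theorem dom_unique {c : ℕ → ℕ} {p p' : ℕ} (h : ∃ᶠ t in atTop, c t = p)
    (h' : ∃ᶠ t in atTop, c t = p') (hp : ∀ᶠ t in atTop, c t ≤ p)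
    (hp' : ∀ᶠ t in atTop, c t ≤ p') : p = p' := by
  obtain ⟨t, rfl, h1⟩ := (h.and_eventually hp').exists
  obtain ⟨s, rfl, h2⟩ := (h'.and_eventually hp).exists
  exact le_antisymm h1 h2

theorem oddDom_succ_iff {c : ℕ → ℕ} (hc : ∃ B, ∀ t, c t ≤ B) :
    OddDom (fun t => c t + 1) ↔ ¬ OddDom c := by
  obtain ⟨p, h1, h2⟩ := exists_dom hc
  constructor
  · rintro ⟨q, hq, h3, h4⟩ ⟨p', hp', h5, h6⟩
    have := dom_unique h3 (p' := p' + 1) (h5.mono fun t h => by rw [h]) h4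
      (h6.mono fun t h => Nat.succ_le_succ h)
    subst this
    exact (Nat.not_odd_iff_even.2 hp'.add_one) hq
  · intro h
    refine ⟨p + 1, ?_, h1.mono fun t h => congrArg (· + 1) h, h2.mono fun t h => Nat.succ_le_succ h⟩
    rw [Nat.odd_add_one]
    exact fun hp => h ⟨p, hp, h1, h2⟩

theorem OddDom.congr {c c' : ℕ → ℕ} (h : OddDom c) (hc : ∀ t, c t = c' t) : OddDom c' := by
  rwa [show c' = c from funext fun t => (hc t).symm]

/-- The path theorem for two slots that are never dropped. -/
theorem exists_path_two {M : Frame Act Atom} {Q₁ Q₂ C : Type} [Finite C] [Finite Q₁] [Finite Q₂]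
    (hM : MF M) (A₁ : Ann M Q₁) (A₂ : Ann M Q₂) (K : C → Set M.W) (hK : ∀ c, K c ∈ M.Adm)
    (e₁ : C → Option Q₁) (e₂ : C → Option Q₂)
    (p₁ : C → (Q₁ → Set M.W) → Set M.W) (p₂ : C → (Q₂ → Set M.W) → Set M.W)
    (hp₁ : ∀ c, PFQ M (p₁ c)) (hp₂ : ∀ c, PFQ M (p₂ c)) (S : C → C → Prop)
    (hS : ∀ c v₁ v₂, (∀ q, v₁ q ∈ M.Adm) → (∀ q, v₂ q ∈ M.Adm) → v₁ ≤ A₁.y → v₂ ≤ A₂.y →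
      ∀ w ∈ K c, w ∈ (e₁ c).elim (p₁ c v₁) (fun q => A₁.F q v₁) →
        w ∈ (e₂ c).elim (p₂ c v₂) (fun q => A₂.F q v₂) →
        ∃ c', S c c' ∧ ∃ w' ∈ K c', w' ∈ (e₁ c').elim (p₁ c' v₁) v₁ ∧
          w' ∈ (e₂ c').elim (p₂ c' v₂) v₂)
    {c₀ : C} {w₀ : M.W} (h0 : w₀ ∈ K c₀) (h1 : w₀ ∈ (e₁ c₀).elim (p₁ c₀ A₁.y) A₁.y)
    (h2 : w₀ ∈ (e₂ c₀).elim (p₂ c₀ A₂.y) A₂.y) :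
    ∃ c : ℕ → C, c 0 = c₀ ∧ (∀ t, S (c t) (c (t + 1))) ∧
      ¬ OddDom (fun t => (e₁ (c t)).elim 0 A₁.pri) ∧
      ¬ OddDom (fun t => (e₂ (c t)).elim 0 A₂.pri) := by
  let X : Arena M Bool C :=
    { Q := fun i => Bool.rec Q₂ Q₁ i
      A := fun i => Bool.rec A₂ A₁ i
      ent := fun c i => Bool.rec (e₂ c) (e₁ c) i
      pf := fun c i => Bool.rec (p₂ c) (p₁ c) i
      K := K }
  have fin : ∀ i, Finite (X.Q i) := by
    rintro (_ | _)
    · exact (inferInstance : Finite Q₂)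
    · exact (inferInstance : Finite Q₁)
  have hX : X.Good :=
    { pf_mono := by
        rintro c (_ | _)
        · exact (hp₂ c).mono
        · exact (hp₁ c).mono
      pf_adm := by
        rintro c (_ | _) v hv
        · exact (hp₂ c).adm hM hv
        · exact (hp₁ c).adm hM hv
      K_adm := hK }
  have hSt : X.HStep (fun c c' kept => S c c' ∧ ∀ i, kept i) := by
    intro c v hv hy w hwK hw
    obtain ⟨c', hc', w', hK', h1', h2'⟩ := hS c (v true) (v false) (hv true) (hv false)
      (hy true) (hy false) w hwK (hw true) (hw false)
    refine ⟨c', fun _ => True, ⟨hc', fun _ => trivial⟩, w', hK', ?_⟩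
    rintro (_ | _)
    · exact ⟨fun _ => h2', fun h => absurd trivial h⟩
    · exact ⟨fun _ => h1', fun h => absurd trivial h⟩
  obtain ⟨c, kept, hc0, hst, hod⟩ := @Arena.exists_path _ _ M Bool C X _ _ fin hM hX _ hSt c₀
    ⟨w₀, h0, mem_iInter.2 (by
      rintro (_ | _)
      · exact h2
      · exact h1)⟩
  exact ⟨c, hc0, fun t => (hst t).1, hod true (Eventually.of_forall fun t => (hst t).2 true),
    hod false (Eventually.of_forall fun t => (hst t).2 false)⟩

/-- Parity automata over the actions in `A`, with letters `L`. -/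
structure Aut (L : Type) (A : Finset Act) where
  Q : Type
  T : Type
  finQ : Finite Q
  finT : Finite T
  src : T → Q
  lit : T → Set L
  lit_fin : ∀ t, (lit t).Finite
  suc : T → A → Set Q
  pri : Q → ℕ

attribute [instance] Aut.finQ Aut.finT

/-- The cover modality. -/
def nab (M : Frame Act Atom) {A : Finset Act} {Q : Type} (suc : A → Set Q) (ρ : Q → Set M.W) :
    Set M.W :=
  {w | ∀ a : A, (∀ s ∈ suc a, ∃ w' ∈ M.R a w, w' ∈ ρ s) ∧ ∀ w' ∈ M.R a w, ∃ s ∈ suc a, w' ∈ ρ s}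

theorem nab_pfq {M : Frame Act Atom} (hM : MF M) {A : Finset Act} {Q : Type} [Finite Q]
    (suc : A → Set Q) : PFQ M (nab M suc) := by
  intro e
  have : PF M (fun ρ => ⋂ a : A, (⋂ s : suc a, M.dm a (ρ (e s))) ∩
      M.bx a (⋃ s : suc a, ρ (e s))) :=
    PF.iInter hM fun a => PF.inter hM (PF.iInter hM fun s => PF.dia hM _ (PF.var hM _))
      (PF.box hM _ (PF.iUnion hM fun s => PF.var hM _))
  refine this.congr fun ρ => ?_
  ext w
  simp [nab, Frame.dm, Frame.bx]

theorem not_nab {M : Frame Act Atom} {A : Finset Act} {Q : Type} {suc : A → Set Q}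
    {v : Q → Set M.W} {w : M.W} (h : w ∉ nab M suc fun q => (v q)ᶜ) :
    ∃ a : A, (∃ s ∈ suc a, ∀ w' ∈ M.R a w, w' ∈ v s) ∨ ∃ w' ∈ M.R a w, ∀ s ∈ suc a, w' ∈ v s := by
  by_contra hc
  push Not at hc
  exact h fun a => ⟨fun s hs => (hc a).1 s hs, fun w' hw' => (hc a).2 w' hw'⟩

theorem nab_conflict {M : Frame Act Atom} {A : Finset Act} {Q₁ Q₂ : Type} {suc₁ : A → Set Q₁}
    {suc₂ : A → Set Q₂} {v₁ : Q₁ → Set M.W} {v₂ : Q₂ → Set M.W} {w : M.W} {Z : Q₁ → Q₂ → Prop}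
    (h₁ : w ∈ nab M suc₁ v₁) (h₂ : w ∉ nab M suc₂ fun q => (v₂ q)ᶜ)
    (hZ : ∀ a, (∀ s ∈ suc₁ a, ∃ s' ∈ suc₂ a, Z s s') ∧ ∀ s' ∈ suc₂ a, ∃ s ∈ suc₁ a, Z s s') :
    ∃ w' s s', Z s s' ∧ w' ∈ v₁ s ∧ w' ∈ v₂ s' := by
  obtain ⟨a, ⟨s', hs', h⟩ | ⟨w', hw', h⟩⟩ := not_nab h₂
  · obtain ⟨s, hs, hz⟩ := (hZ a).2 s' hs'
    obtain ⟨w', hw', hv⟩ := (h₁ a).1 s hs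
    exact ⟨w', s, s', hz, hv, h w' hw'⟩
  · obtain ⟨s, hs, hv⟩ := (h₁ a).2 w' hw'
    obtain ⟨s', hs', hz⟩ := (hZ a).1 s hs
    exact ⟨w', s, s', hz, hv, h s' hs'⟩

namespace Aut
variable {L : Type} {A : Finset Act} (D : Aut L A) (M : Frame Act Atom) (Lv : L → Set M.W)

/-- The letters of a transition hold. -/
def lits (t : D.T) : Set M.W := {w | ∀ l ∈ D.lit t, w ∈ Lv l}

/-- One step of the automaton. -/
def step (q : D.Q) (ρ : D.Q → Set M.W) : Set M.W :=
  {w | ∃ t, D.src t = q ∧ w ∈ D.lits M Lv t ∧ w ∈ nab M (D.suc t) ρ}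

variable {M Lv}

theorem lits_adm (hM : MF M) (hL : ∀ l, Lv l ∈ M.Adm) (t : D.T) : D.lits M Lv t ∈ M.Adm := by
  have : Finite (D.lit t) := D.lit_fin t
  have h := hM.iInter_mem (fun l : D.lit t => hL l)
  convert h using 1
  ext w; simp [lits]

theorem step_pfq (hM : MF M) (hL : ∀ l, Lv l ∈ M.Adm) (q : D.Q) : PFQ M (D.step M Lv q) := by
  intro e
  have : PF M (fun ρ => ⋃ t : {t // D.src t = q}, D.lits M Lv t ∩
      nab M (D.suc t) (fun p => ρ (e p))) :=
    PF.iUnion hM fun t => PF.inter hM (PF.const (D.lits_adm hM hL t)) (nab_pfq hM _ e)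
  refine this.congr fun ρ => ?_
  ext w
  simp [step, and_left_comm]

/-- A ranking of the states refining the priorities. -/
noncomputable def rk : D.Q → ℕ := (exists_ranking D.pri).choose

theorem ranking : Ranking D.pri D.rk (Nat.card D.Q) := (exists_ranking D.pri).choose_spec

theorem ranking' : Ranking (fun q => D.pri q + 1) D.rk (Nat.card D.Q) :=
  ⟨D.ranking.inj, D.ranking.lt, D.ranking.surj,
    fun p q h => Nat.succ_le_succ (D.ranking.pri_le p q h)⟩

variable (M Lv) in
/-- The sets accepted by the states. -/
noncomputable def val : D.Q → Set M.W :=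
  solR M.Adm D.rk D.pri (Nat.card D.Q) (D.step M Lv)

/-- The annotated system of the automaton. -/
noncomputable def ann (hM : MF M) (hL : ∀ l, Lv l ∈ M.Adm) : Ann M D.Q :=
  mkAnn hM D.ranking (F := D.step M Lv) (D.step_pfq hM hL)

/-- The annotated dual system of the automaton. -/
noncomputable def coann (hM : MF M) (hL : ∀ l, Lv l ∈ M.Adm) : Ann M D.Q :=
  mkAnn hM D.ranking' (F := fun q ρ => (D.step M Lv q (fun p => (ρ p)ᶜ))ᶜ)
    fun q => (D.step_pfq hM hL q).dual hM

theorem ann_y (hM : MF M) (hL : ∀ l, Lv l ∈ M.Adm) : (D.ann hM hL).y = D.val M Lv :=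
  mkAnn_y ..

theorem coann_y (hM : MF M) (hL : ∀ l, Lv l ∈ M.Adm) :
    (D.coann hM hL).y = fun q => (D.val M Lv q)ᶜ := by
  rw [coann, mkAnn_y, solR_dual D.ranking]; rfl

theorem val_step (hM : MF M) (hL : ∀ l, Lv l ∈ M.Adm) (q : D.Q) :
    D.step M Lv q (D.val M Lv) = D.val M Lv q := by
  rw [← D.ann_y hM hL]
  exact (D.ann hM hL).y_unf q

theorem val_adm (hM : MF M) (hL : ∀ l, Lv l ∈ M.Adm) (q : D.Q) : D.val M Lv q ∈ M.Adm := by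
  rw [← D.ann_y hM hL]
  exact (D.ann hM hL).U_adm _ (fun _ => hM.univ_mem) q

/-- Simulations between automata. -/
theorem val_le_of_sim {L' : Type} (D' : Aut L' A) {Lv' : L' → Set M.W} (hM : MF M)
    (hL : ∀ l, Lv l ∈ M.Adm) (hL' : ∀ l, Lv' l ∈ M.Adm) (Z : D.Q → D'.Q → Prop)
    (hpri : ∀ q q', Z q q' → D.pri q = D'.pri q')
    (hZ : ∀ q q', Z q q' → ∀ t, D.src t = q → ∃ t', D'.src t' = q' ∧
      D.lits M Lv t ⊆ D'.lits M Lv' t' ∧ ∀ a, (∀ s ∈ D.suc t a, ∃ s' ∈ D'.suc t' a, Z s s') ∧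
        ∀ s' ∈ D'.suc t' a, ∃ s ∈ D.suc t a, Z s s') {q : D.Q} {q' : D'.Q} (h : Z q q') :
    D.val M Lv q ⊆ D'.val M Lv' q' := by
  intro w hw
  by_contra hw'
  obtain ⟨c, -, -, h1, h2⟩ := exists_path_two (C := {p : D.Q × D'.Q // Z p.1 p.2}) hM
    (D.ann hM hL) (D'.coann hM hL') (fun _ => univ) (fun _ => hM.univ_mem)
    (fun c => some c.1.1) (fun c => some c.1.2) (fun c ρ => ρ c.1.1) (fun c ρ => ρ c.1.2)
    (fun c => PFQ.var hM _) (fun c => PFQ.var hM _) (fun _ _ => True) (by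
      rintro ⟨⟨q, q'⟩, hz⟩ v₁ v₂ - - - - w - ⟨t, ht, hl, hn⟩ hu₂
      obtain ⟨t', ht', hl', hs⟩ := hZ q q' hz t ht
      have hn' : w ∉ nab M (D'.suc t') fun q => (v₂ q)ᶜ := fun h => hu₂ ⟨t', ht', hl' hl, h⟩
      obtain ⟨w', s, s', hz', h1, h2⟩ := nab_conflict hn hn' hs
      exact ⟨⟨(s, s'), hz'⟩, trivial, w', trivial, h1, h2⟩)
    (c₀ := ⟨(q, q'), h⟩) (w₀ := w) trivial (by rw [D.ann_y hM hL]; exact hw)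
    (by rw [D'.coann_y hM hL']; exact hw')
  refine h2 ((oddDom_succ_iff (c := fun t => D'.pri (c t).1.2) ?_).2 fun h => h1 ?_)
  · obtain ⟨B, hB⟩ := (finite_range D'.pri).bddAbove
    exact ⟨B, fun t => hB (mem_range_self _)⟩
  · exact h.congr fun t => (hpri _ _ (c t).2).symm

end Aut

section Determinization
variable {S β : Type} [Monoid S]

/-- Product of the letters of `w` in the interval `[i, j)`. -/
def segProd (lt : β → S) (w : ℕ → β) (i j : ℕ) : S := ((List.Ico i j).map fun k => lt (w k)).prod

variable {lt : β → S} {w : ℕ → β}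

theorem segProd_self (i : ℕ) : segProd lt w i i = 1 := by simp [segProd]

theorem segProd_mul {i j k : ℕ} (h : i ≤ j) (h' : j ≤ k) :
    segProd lt w i j * segProd lt w j k = segProd lt w i k := by
  rw [segProd, segProd, segProd, ← List.prod_append, ← List.map_append,
    List.Ico.append_consecutive h h']

theorem segProd_succ {i j : ℕ} (h : i ≤ j) :
    segProd lt w i (j + 1) = segProd lt w i j * lt (w j) := by
  rw [← segProd_mul h (Nat.le_succ j)]
  simp [segProd]

variable (S) in
/-- States of the deterministic automaton: the alive products ending now, ordered by seniority of
their starting positions, with products between starting positions. -/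
structure DState where
  al : S → Prop
  le : S → S → Prop
  sl : S → S
  lab : S → S → S
  tot : S

instance [Finite S] : Finite (DState S) :=
  Finite.of_injective (β := (S → Prop) × (S → S → Prop) × (S → S) × (S → S → S) × S)
    (fun σ => (σ.al, σ.le, σ.sl, σ.lab, σ.tot)) (by
      rintro ⟨⟩ ⟨⟩ h
      simpa using h)

namespace DState

/-- `p` is the most senior alive product that becomes `p'`. -/
def IsRep (σ : DState S) (b p' p : S) : Prop :=
  σ.al p ∧ p * b = p' ∧ ∀ q, σ.al q → q * b = p' → σ.le p q

open Classical in
/-- The most senior predecessor of `p'`, if any. -/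
noncomputable def rep (σ : DState S) (b p' : S) : Option S :=
  if h : ∃ p, σ.IsRep b p' p then some h.choose else none

/-- Reading a letter. -/
noncomputable def next (σ : DState S) (b : S) : DState S where
  al p' := p' = 1 ∨ ∃ q, σ.al q ∧ q * b = p'
  le p' q' := (σ.rep b p').elim ((σ.rep b q').elim True fun _ => False)
    fun p => (σ.rep b q').elim True fun q => σ.le p q
  sl p' := (σ.rep b p').elim (σ.tot * b) σ.sl
  lab p' q' := (σ.rep b p').elim 1 fun p => (σ.rep b q').elim p' fun q => σ.lab p q
  tot := σ.tot * b

/-- A junior product merges into `p`, at distance `f`. -/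
def Mg (σ : DState S) (b p f : S) : Prop :=
  σ.al p ∧ ((∃ q, σ.al q ∧ q ≠ p ∧ σ.le p q ∧ q * b = p * b ∧ f = σ.lab p q) ∨
    (p * b = 1 ∧ f = p * b))

/-- Seniority of an alive product. -/
noncomputable def rank (σ : DState S) (p : S) : ℕ := {q | σ.al q ∧ σ.le q p ∧ q ≠ p}.ncard

open Classical in
/-- Priority of a transition. -/
noncomputable def out (Bad : S → S → Prop) (σ : DState S) (b : S) : ℕ :=
  if h : ∃ m p f, σ.Mg b p f ∧ σ.rank p = m then
    2 * (Nat.card S - Nat.find h) + if ∃ p f, σ.Mg b p f ∧ σ.rank p = Nat.find h ∧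
      Bad (σ.sl p) f then 1 else 0
  else 0

/-- The initial state. -/
def init : DState S where
  al p := p = 1
  le _ _ := True
  sl _ := 1
  lab _ _ := 1
  tot := 1

/-- Starting positions after reading a letter. -/
noncomputable def nextPos (σ : DState S) (b : S) (t : ℕ) (pos : S → ℕ) : S → ℕ :=
  fun p' => (σ.rep b p').elim (t + 1) pos

/-- The state is described by the starting positions `pos`. -/
structure Inv (lt : β → S) (w : ℕ → β) (t : ℕ) (σ : DState S) (pos : S → ℕ) : Prop where
  pos_le : ∀ p, σ.al p → pos p ≤ t
  seg : ∀ p, σ.al p → segProd lt w (pos p) t = p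
  sl : ∀ p, σ.al p → σ.sl p = segProd lt w 0 (pos p)
  le : ∀ p q, σ.al p → σ.al q → (σ.le p q ↔ pos p ≤ pos q)
  lab : ∀ p q, σ.al p → σ.al q → pos p ≤ pos q → σ.lab p q = segProd lt w (pos p) (pos q)
  tot : σ.tot = segProd lt w 0 t

theorem inv_init : Inv lt w 0 init (fun _ => 0) where
  pos_le _ _ := le_rfl
  seg p hp := by rw [segProd_self]; exact hp.symm
  sl p hp := by rw [segProd_self]; rfl
  le _ _ _ _ := by simp [init]
  lab _ _ _ _ _ := by rw [segProd_self]; rfl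
  tot := by rw [segProd_self]; rfl

variable {σ : DState S} {pos : S → ℕ} {t : ℕ} {b : S}

theorem Inv.inj (h : Inv lt w t σ pos) {p q : S} (hp : σ.al p) (hq : σ.al q)
    (e : pos p = pos q) : p = q := by
  rw [← h.seg p hp, ← h.seg q hq, e]

theorem rep_some {p p' : S} (h : σ.rep b p' = some p) : σ.IsRep b p' p := by
  unfold rep at h
  split at h
  · rename_i h'
    cases h
    exact h'.choose_spec
  · cases h

theorem Inv.rep_none [Finite S] (h : Inv lt w t σ pos) {p' : S} (hr : σ.rep b p' = none) {q : S}
    (hq : σ.al q) : q * b ≠ p' := by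
  intro e
  obtain ⟨p, hp, hmin⟩ := (toFinite {q | σ.al q ∧ q * b = p'}).exists_minimalFor pos _ ⟨q, hq, e⟩
  have : ∃ p, σ.IsRep b p' p := by
    refine ⟨p, hp.1, hp.2, fun q hq e => (h.le p q hp.1 hq).2 ?_⟩
    by_contra hlt
    exact hlt (hmin ⟨hq, e⟩ (not_le.1 hlt).le)
  simp [rep, this] at hr

theorem Inv.next [Finite S] (h : Inv lt w t σ pos) :
    Inv lt w (t + 1) (σ.next (lt (w t))) (σ.nextPos (lt (w t)) t pos) := by
  have fresh : ∀ p', (σ.next (lt (w t))).al p' → σ.rep (lt (w t)) p' = none → p' = 1 := by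
    rintro p' (h1 | ⟨q, hq, e⟩) hr
    · exact h1
    · exact absurd e (h.rep_none hr hq)
  refine ⟨fun p hp => ?_, fun p hp => ?_, fun p hp => ?_, fun p q hp hq => ?_,
    fun p q hp hq hpq => ?_, ?_⟩
  · cases e : σ.rep (lt (w t)) p with
    | none => simp [nextPos, e]
    | some p0 =>
      have := h.pos_le p0 (rep_some e).1
      simp only [nextPos, e, Option.elim]; omega
  · cases e : σ.rep (lt (w t)) p with
    | none =>
      simp only [nextPos, e, Option.elim]
      rw [segProd_self, fresh p hp e]
    | some p0 =>
      have hr := rep_some e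
      simp only [nextPos, e, Option.elim]
      rw [segProd_succ (h.pos_le p0 hr.1), h.seg p0 hr.1, hr.2.1]
  · cases e : σ.rep (lt (w t)) p with
    | none => simp [nextPos, e, DState.next, h.tot, segProd_succ (Nat.zero_le t)]
    | some p0 => simpa [nextPos, e, DState.next] using h.sl p0 (rep_some e).1
  · cases e : σ.rep (lt (w t)) p with
    | none =>
      cases e' : σ.rep (lt (w t)) q with
      | none => simp [nextPos, e, e', DState.next]
      | some q0 =>
        have := h.pos_le q0 (rep_some e').1
        simp only [nextPos, e, e', DState.next, Option.elim, false_iff]; omega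
    | some p0 =>
      cases e' : σ.rep (lt (w t)) q with
      | none =>
        have := h.pos_le p0 (rep_some e).1
        simp only [nextPos, e, e', DState.next, Option.elim, true_iff]; omega
      | some q0 =>
        simpa only [nextPos, e, e', DState.next, Option.elim]
          using h.le p0 q0 (rep_some e).1 (rep_some e').1
  · cases e : σ.rep (lt (w t)) p with
    | none =>
      cases e' : σ.rep (lt (w t)) q with
      | none => simp [nextPos, e, e', DState.next, segProd_self]
      | some q0 =>
        have := h.pos_le q0 (rep_some e').1
        simp only [nextPos, e, e', Option.elim] at hpq; omega
    | some p0 =>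
      have hr := rep_some e
      cases e' : σ.rep (lt (w t)) q with
      | none =>
        simp only [nextPos, e, e', DState.next, Option.elim]
        rw [segProd_succ (h.pos_le p0 hr.1), h.seg p0 hr.1, hr.2.1]
      | some q0 =>
        simp only [nextPos, e, e', Option.elim] at hpq
        simpa only [nextPos, e, e', DState.next, Option.elim]
          using h.lab p0 q0 hr.1 (rep_some e').1 hpq
  · simp only [DState.next]
    rw [h.tot, segProd_succ (Nat.zero_le t)]

theorem rank_lt [Finite S] {p : S} : σ.rank p < Nat.card S := by
  have h : {q | σ.al q ∧ σ.le q p ∧ q ≠ p} ⊆ {p}ᶜ := fun q hq => hq.2.2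
  have h1 := ncard_le_ncard h (toFinite _)
  have h2 := ncard_add_ncard_compl {p} (toFinite _) (toFinite _)
  rw [ncard_singleton] at h2
  unfold rank
  omega

theorem out_eq_zero [Finite S] {Bad : S → S → Prop} (h : out Bad σ b = 0) (p f : S) :
    ¬ σ.Mg b p f := by
  intro hm
  have hex : ∃ m p f, σ.Mg b p f ∧ σ.rank p = m := ⟨_, p, f, hm, rfl⟩
  classical
  have hlt : Nat.find hex < Nat.card S := by
    obtain ⟨p', f', -, h2⟩ := Nat.find_spec hex
    rw [← h2]; exact rank_lt
  rw [out, dif_pos hex] at h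
  omega

theorem out_spec [Finite S] {Bad : S → S → Prop} (h : out Bad σ b ≠ 0) :
    (∀ p f, σ.Mg b p f → Nat.card S - out Bad σ b / 2 ≤ σ.rank p) ∧
      ∃ p f, σ.Mg b p f ∧ σ.rank p = Nat.card S - out Bad σ b / 2 ∧
        (Bad (σ.sl p) f ↔ Odd (out Bad σ b)) := by
  classical
  by_cases hex : ∃ m p f, σ.Mg b p f ∧ σ.rank p = m
  · have hlt : Nat.find hex < Nat.card S := by
      obtain ⟨p', f', -, h2⟩ := Nat.find_spec hex
      rw [← h2]; exact rank_lt
    have hmin : ∀ p f, σ.Mg b p f → Nat.find hex ≤ σ.rank p :=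
      fun p f hm => Nat.find_min' hex ⟨p, f, hm, rfl⟩
    by_cases hb : ∃ p f, σ.Mg b p f ∧ σ.rank p = Nat.find hex ∧ Bad (σ.sl p) f
    · have e : out Bad σ b = 2 * (Nat.card S - Nat.find hex) + 1 := by
        rw [out, dif_pos hex, if_pos hb]
      have e' : Nat.card S - out Bad σ b / 2 = Nat.find hex := by omega
      rw [e']
      obtain ⟨p, f, h1, h2, h3⟩ := hb
      exact ⟨hmin, p, f, h1, h2, iff_of_true h3 (by rw [e]; exact odd_two_mul_add_one _)⟩
    · have e : out Bad σ b = 2 * (Nat.card S - Nat.find hex) := by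
        rw [out, dif_pos hex, if_neg hb]; rfl
      have e' : Nat.card S - out Bad σ b / 2 = Nat.find hex := by omega
      rw [e']
      obtain ⟨p, f, h1, h2⟩ := Nat.find_spec hex
      refine ⟨hmin, p, f, h1, h2, iff_of_false (fun h3 => hb ⟨p, f, h1, h2, h3⟩) ?_⟩
      rw [e, Nat.not_odd_iff_even]; exact even_two_mul _
  · exact absurd (by rw [out, dif_neg hex]) h

/-- The starting positions of the alive products. -/
def starts (σ : DState S) (pos : S → ℕ) : Set ℕ := pos '' {p | σ.al p}

theorem Inv.rank_eq (h : Inv lt w t σ pos) {p : S} (hp : σ.al p) :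
    σ.rank p = {n | n ∈ σ.starts pos ∧ n < pos p}.ncard := by
  have : {n | n ∈ σ.starts pos ∧ n < pos p} = pos '' {q | σ.al q ∧ σ.le q p ∧ q ≠ p} := by
    ext n
    constructor
    · rintro ⟨⟨q, hq, rfl⟩, hlt⟩
      exact ⟨q, ⟨hq, (h.le q p hq hp).2 hlt.le, fun e => hlt.ne (congrArg pos e)⟩, rfl⟩
    · rintro ⟨q, ⟨hq, hle, hne⟩, rfl⟩
      exact ⟨⟨q, hq, rfl⟩, lt_of_le_of_ne ((h.le q p hq hp).1 hle) fun e => hne (h.inj hq hp e)⟩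
  rw [this, InjOn.ncard_image fun q hq q' hq' e => h.inj hq.1 hq'.1 e, rank]

theorem starts_next {n : ℕ} (hn : n ∈ (σ.next b).starts (σ.nextPos b t pos)) :
    n ∈ σ.starts pos ∨ n = t + 1 := by
  obtain ⟨p', -, rfl⟩ := hn
  cases e : σ.rep b p' with
  | none => exact .inr (by simp [nextPos, e])
  | some p => exact .inl ⟨p, (rep_some e).1, by simp [nextPos, e]⟩

theorem Inv.exists_merge [Finite S] (h : Inv lt w t σ pos) {n : ℕ} (hn : n ∈ σ.starts pos)
    (hn' : n ∉ (σ.next b).starts (σ.nextPos b t pos)) : ∃ p f, σ.Mg b p f ∧ pos p < n := by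
  obtain ⟨q, hq, rfl⟩ := hn
  cases e : σ.rep b (q * b) with
  | none => exact absurd rfl (h.rep_none e hq)
  | some p =>
    obtain ⟨h1, h2, h3⟩ := rep_some e
    have hne : q ≠ p := by
      rintro rfl
      exact hn' ⟨q * b, .inr ⟨q, hq, rfl⟩, by simp [nextPos, e]⟩
    have hle := h3 q hq rfl
    exact ⟨p, σ.lab p q, ⟨h1, .inl ⟨q, hq, hne, hle, h2.symm, rfl⟩⟩,
      lt_of_le_of_ne ((h.le p q h1 hq).1 hle) fun e => hne (h.inj h1 hq e).symm⟩

theorem Inv.merge [Finite S] (h : Inv lt w t σ pos) {p f : S} (hm : σ.Mg (lt (w t)) p f) :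
    ∃ n, pos p < n ∧ n ≤ t + 1 ∧ f = segProd lt w (pos p) n ∧
      segProd lt w (pos p) (t + 1) = segProd lt w n (t + 1) ∧ (n ∈ σ.starts pos ∨ n = t + 1) ∧
      n ∉ (σ.next (lt (w t))).starts (σ.nextPos (lt (w t)) t pos) := by
  obtain ⟨hp, ⟨q, hq, hne, hle, e, rfl⟩ | ⟨e, rfl⟩⟩ := hm
  · have hpq := (h.le p q hp hq).1 hle
    have hlt : pos p < pos q := lt_of_le_of_ne hpq fun e => hne (h.inj hp hq e).symm
    have hqt := h.pos_le q hq
    refine ⟨pos q, hlt, by omega, h.lab p q hp hq hpq, ?_, .inl ⟨q, hq, rfl⟩, ?_⟩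
    · rw [segProd_succ (h.pos_le p hp), segProd_succ hqt, h.seg p hp, h.seg q hq, e]
    · rintro ⟨p', hp', e'⟩
      cases er : σ.rep (lt (w t)) p' with
      | none => simp [nextPos, er] at e'; omega
      | some q' =>
        obtain ⟨h1, h2, h3⟩ := rep_some er
        simp only [nextPos, er, Option.elim] at e'
        obtain rfl := h.inj h1 hq e'
        have := (h.le _ _ hq hp).1 (h3 p hp (e ▸ h2))
        omega
  · have hpt := h.pos_le p hp
    refine ⟨t + 1, by omega, le_rfl, ?_, ?_, .inr rfl, ?_⟩
    · rw [segProd_succ hpt, h.seg p hp]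
    · rw [segProd_succ hpt, h.seg p hp, segProd_self, e]
    · rintro ⟨p', hp', e'⟩
      cases er : σ.rep (lt (w t)) p' with
      | none =>
        rcases hp' with rfl | ⟨q, hq, e2⟩
        · exact h.rep_none er hp e
        · exact h.rep_none er hq e2
      | some q' =>
        simp only [nextPos, er, Option.elim] at e'
        have := h.pos_le q' (rep_some er).1
        omega

theorem fresh_of_not_merge (h : ∀ p f, ¬ σ.Mg b p f) :
    t + 1 ∈ (σ.next b).starts (σ.nextPos b t pos) := by
  refine ⟨1, .inl rfl, ?_⟩
  cases e : σ.rep b 1 with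
  | none => simp [nextPos, e]
  | some p =>
    obtain ⟨h1, h2, -⟩ := rep_some e
    exact absurd ⟨h1, .inr ⟨h2, rfl⟩⟩ (h p (p * b))

end DState

end Determinization

section Determinization
variable {S β : Type} [Monoid S]

namespace DState

/-- The run of the deterministic automaton. -/
noncomputable def run (lt : β → S) (w : ℕ → β) : ℕ → DState S
  | 0 => init
  | t + 1 => (run lt w t).next (lt (w t))

/-- The starting positions along the run. -/
noncomputable def runPos (lt : β → S) (w : ℕ → β) : ℕ → S → ℕ
  | 0 => fun _ => 0
  | t + 1 => (run lt w t).nextPos (lt (w t)) t (runPos lt w t)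

variable {lt : β → S} {w : ℕ → β}

theorem inv_run [Finite S] (t : ℕ) : Inv lt w t (run lt w t) (runPos lt w t) := by
  induction t with
  | zero => exact inv_init
  | succ t ih => exact ih.next

/-- Alive starting positions along the run. -/
noncomputable def runStarts (lt : β → S) (w : ℕ → β) (t : ℕ) : Set ℕ :=
  (run lt w t).starts (runPos lt w t)

theorem runStarts_finite [Finite S] (t : ℕ) : (runStarts lt w t).Finite := (toFinite _).image _

theorem ncard_runStarts_le [Finite S] (t : ℕ) : (runStarts lt w t).ncard ≤ Nat.card S :=
  (ncard_image_le (toFinite _)).trans (ncard_le_card _)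

theorem runStarts_le [Finite S] {t n : ℕ} (h : n ∈ runStarts lt w t) : n ≤ t := by
  obtain ⟨p, hp, rfl⟩ := h
  exact (inv_run t).pos_le p hp

theorem mem_runStarts_of_le {t u n : ℕ} (htu : t ≤ u) (hn : n ≤ t) (h : n ∈ runStarts lt w u) :
    n ∈ runStarts lt w t := by
  induction u, htu using Nat.le_induction with
  | base => exact h
  | succ u hu ih =>
    rcases starts_next h with h | h
    · exact ih h
    · omega

theorem exists_out_ne_zero [Finite S] (Bad : S → S → Prop) (T : ℕ) :
    ∃ t, T ≤ t ∧ out Bad (run lt w t) (lt (w t)) ≠ 0 := by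
  by_contra hcon
  push Not at hcon
  have key : ∀ k, k ≤ (runStarts lt w (T + k)).ncard := by
    intro k
    induction k with
    | zero => exact Nat.zero_le _
    | succ k ih =>
      have hz := out_eq_zero (hcon (T + k) (Nat.le_add_right _ _))
      have hsub : insert (T + k + 1) (runStarts lt w (T + k)) ⊆ runStarts lt w (T + k + 1) := by
        rintro n (rfl | hn)
        · exact fresh_of_not_merge hz
        · by_contra hn'
          obtain ⟨p, f, hm, -⟩ := (inv_run (T + k)).exists_merge hn hn'
          exact hz p f hm
      have h1 := ncard_le_ncard hsub (runStarts_finite _)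
      rw [ncard_insert_of_notMem (fun h => by have := runStarts_le h; omega)
        (runStarts_finite _)] at h1
      exact (Nat.succ_le_succ ih).trans h1
  have := (key (Nat.card S + 1)).trans (ncard_runStarts_le _)
  omega

theorem starts_lt_strict [Finite S] {t n n' : ℕ} (hn : n ∈ runStarts lt w t) (h : n < n') :
    {k | k ∈ runStarts lt w t ∧ k < n}.ncard < {k | k ∈ runStarts lt w t ∧ k < n'}.ncard := by
  refine ncard_lt_ncard ⟨fun k hk => ⟨hk.1, hk.2.trans h⟩, fun hs => ?_⟩
    ((runStarts_finite t).subset fun k hk => hk.1)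
  exact lt_irrefl _ (hs ⟨hn, h⟩).2

theorem out_bdd [Finite S] (Bad : S → S → Prop) :
    ∃ B, ∀ (σ : DState S) b, out Bad σ b ≤ B := by
  obtain ⟨B, hB⟩ := (finite_range fun x : DState S × S => out Bad x.1 x.2).bddAbove
  exact ⟨B, fun σ b => hB ⟨(σ, b), rfl⟩⟩

/-- Every word has a factorization into equal blocks, from which the acceptance of the run can be
read off. -/
theorem exists_factorization [Finite S] (Bad : S → S → Prop) :
    ∃ (f : S) (x : ℕ → ℕ), StrictMono x ∧ (∀ k, segProd lt w (x k) (x (k + 1)) = f) ∧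
      (OddDom (fun t => out Bad (run lt w t) (lt (w t))) ↔ Bad (segProd lt w 0 (x 0)) f) := by
  set o : ℕ → ℕ := fun t => out Bad (run lt w t) (lt (w t)) with ho
  obtain ⟨P, hfr, hev⟩ := exists_dom (c := o) ⟨_, fun t => (out_bdd Bad).choose_spec _ _⟩
  have hP : P ≠ 0 := by
    rintro rfl
    obtain ⟨T, hT⟩ := eventually_atTop.1 hev
    obtain ⟨t, ht, h⟩ := exists_out_ne_zero (lt := lt) (w := w) Bad T
    exact h (Nat.le_zero.1 (hT t ht))
  set m := Nat.card S - P / 2 with hm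
  obtain ⟨T, hT⟩ := eventually_atTop.1 hev
  have hrank : ∀ t, T ≤ t → ∀ p f, (run lt w t).Mg (lt (w t)) p f → m ≤ (run lt w t).rank p := by
    intro t ht p f hmg
    have h0 : o t ≠ 0 := fun h => out_eq_zero h p f hmg
    have h1 := (out_spec h0).1 p f hmg
    have h2 := hT t ht
    have : o t / 2 ≤ P / 2 := Nat.div_le_div_right h2
    change Nat.card S - o t / 2 ≤ _ at h1
    omega
  have hspec : ∀ t, o t = P → ∃ p f, (run lt w t).Mg (lt (w t)) p f ∧ (run lt w t).rank p = m ∧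
      (Bad ((run lt w t).sl p) f ↔ Odd P) := by
    intro t ht
    have h0 : o t ≠ 0 := by rw [ht]; exact hP
    obtain ⟨p, f, h1, h2, h3⟩ := (out_spec h0).2
    refine ⟨p, f, h1, ?_, ?_⟩
    · rw [h2, hm, ← ht]
    · rw [h3, ← ht]
  have hodd : OddDom o ↔ Odd P := by
    constructor
    · rintro ⟨p, hp, h1, h2⟩
      rwa [dom_unique hfr h1 hev h2]
    · exact fun h => ⟨P, h, hfr, hev⟩
  obtain ⟨t0, ht0, hot0⟩ := frequently_atTop.1 hfr T
  obtain ⟨p0, f0, hm0, hr0, -⟩ := hspec t0 hot0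
  set n0 := runPos lt w t0 p0 with hn0
  have hstay : ∀ t, t0 ≤ t → n0 ∈ runStarts lt w t ∧
      {n | n ∈ runStarts lt w t ∧ n < n0}.ncard = m := by
    intro t ht
    induction t, ht using Nat.le_induction with
    | base => exact ⟨⟨p0, hm0.1, rfl⟩, by rw [← hr0, (inv_run t0).rank_eq hm0.1]; rfl⟩
    | succ t ht ih =>
      have hkeep : ∀ n ∈ runStarts lt w t, n ≤ n0 → n ∈ runStarts lt w (t + 1) := by
        intro n hn hle
        by_contra hn'
        obtain ⟨p, f, hmg, hlt⟩ := (inv_run t).exists_merge hn hn'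
        have h1 := hrank t (ht0.trans ht) p f hmg
        rw [(inv_run t).rank_eq hmg.1] at h1
        have h2 := starts_lt_strict (lt := lt) (w := w) (t := t) ⟨p, hmg.1, rfl⟩
          (hlt.trans_le hle)
        rw [ih.2] at h2
        exact absurd h1 (not_le.2 h2)
      refine ⟨hkeep n0 ih.1 le_rfl, ?_⟩
      rw [← ih.2]
      congr 1
      ext n
      constructor
      · rintro ⟨h1, h2⟩
        have := runStarts_le ih.1
        exact ⟨mem_runStarts_of_le (Nat.le_succ t) (by omega) h1, h2⟩
      · exact fun ⟨h1, h2⟩ => ⟨hkeep n h1 h2.le, h2⟩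
  have hmerge : ∃ᶠ t in atTop, ∃ f n, n0 < n ∧ n ≤ t + 1 ∧ f = segProd lt w n0 n ∧
      segProd lt w n0 (t + 1) = segProd lt w n (t + 1) ∧
      (n ∈ runStarts lt w t ∨ n = t + 1) ∧ n ∉ runStarts lt w (t + 1) ∧
      (Bad (segProd lt w 0 n0) f ↔ Odd P) := by
    refine (hfr.and_eventually (eventually_ge_atTop t0)).mono ?_
    rintro t ⟨hot, ht⟩
    obtain ⟨p, f, hmg, hr, hb⟩ := hspec t hot
    have hpn : runPos lt w t p = n0 := by
      have h1 : {n | n ∈ runStarts lt w t ∧ n < runPos lt w t p}.ncard = m := by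
        rw [← hr, (inv_run t).rank_eq hmg.1]; rfl
      obtain ⟨h2, h3⟩ := hstay t ht
      rcases lt_trichotomy (runPos lt w t p) n0 with h | h | h
      · have := starts_lt_strict (lt := lt) (w := w) (t := t) ⟨p, hmg.1, rfl⟩ h
        omega
      · exact h
      · have := starts_lt_strict h2 h
        omega
    obtain ⟨n, h1, h2, h3, h4, h5, h6⟩ := (inv_run t).merge hmg
    rw [(inv_run t).sl p hmg.1, hpn] at hb
    rw [hpn] at h1 h3 h4
    exact ⟨f, n, h1, h2, h3, h4, h5, h6, hb⟩
  have hf : ∃ f, ∃ᶠ t in atTop, ∃ n, n0 < n ∧ n ≤ t + 1 ∧ f = segProd lt w n0 n ∧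
      segProd lt w n0 (t + 1) = segProd lt w n (t + 1) ∧
      (n ∈ runStarts lt w t ∨ n = t + 1) ∧ n ∉ runStarts lt w (t + 1) ∧
      (Bad (segProd lt w 0 n0) f ↔ Odd P) := by
    by_contra hcon
    have h2 := eventually_all.2 fun f => not_frequently.1 (not_exists.1 hcon f)
    obtain ⟨t, ⟨f, h⟩, h3⟩ := (hmerge.and_eventually h2).exists
    exact h3 f h
  obtain ⟨f, hf⟩ := hf
  have hbad : Bad (segProd lt w 0 n0) f ↔ Odd P := by
    obtain ⟨t, n, -, -, -, -, -, -, h⟩ := hf.exists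
    exact h
  have hbig : ∀ B, ∃ n u, B < n ∧ n0 < n ∧ n ≤ u ∧ segProd lt w n0 n = f ∧
      segProd lt w n0 u = segProd lt w n u := by
    intro B
    by_contra hcon
    have hfi := Nat.frequently_atTop_iff_infinite.1 hf
    choose! g hg using fun t (ht : t ∈ {t | ∃ n, n0 < n ∧ n ≤ t + 1 ∧ f = segProd lt w n0 n ∧
      segProd lt w n0 (t + 1) = segProd lt w n (t + 1) ∧
      (n ∈ runStarts lt w t ∨ n = t + 1) ∧ n ∉ runStarts lt w (t + 1) ∧
      (Bad (segProd lt w 0 n0) f ↔ Odd P)}) => ht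
    have hne : ∀ t ∈ {t | ∃ n, n0 < n ∧ n ≤ t + 1 ∧ f = segProd lt w n0 n ∧
      segProd lt w n0 (t + 1) = segProd lt w n (t + 1) ∧
      (n ∈ runStarts lt w t ∨ n = t + 1) ∧ n ∉ runStarts lt w (t + 1) ∧
      (Bad (segProd lt w 0 n0) f ↔ Odd P)}, ∀ t' ∈ {t | ∃ n, n0 < n ∧ n ≤ t + 1 ∧
      f = segProd lt w n0 n ∧ segProd lt w n0 (t + 1) = segProd lt w n (t + 1) ∧
      (n ∈ runStarts lt w t ∨ n = t + 1) ∧ n ∉ runStarts lt w (t + 1) ∧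
      (Bad (segProd lt w 0 n0) f ↔ Odd P)}, t < t' → g t ≠ g t' := by
      intro t ht t' ht' hlt e
      obtain ⟨-, h2, -, -, -, h6, -⟩ := hg t ht
      obtain ⟨-, -, -, -, h5, -⟩ := hg t' ht'
      rw [← e] at h5
      rcases h5 with h5 | h5
      · exact h6 (mem_runStarts_of_le hlt h2 h5)
      · omega
    refine hfi (Finite.of_finite_image ((finite_Iic B).subset ?_) (f := g) ?_)
    · rintro _ ⟨t, ht, rfl⟩
      by_contra hlt
      obtain ⟨h1, h2, h3, h4, -⟩ := hg t ht
      exact hcon ⟨g t, t + 1, not_le.1 hlt, h1, h2, h3.symm, h4⟩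
    · intro t ht t' ht' e
      rcases lt_trichotomy t t' with h | h | h
      · exact absurd e (hne t ht t' ht' h)
      · exact h
      · exact absurd e.symm (hne t' ht' t ht h)
  choose nn uu h1 h2 h3 h4 h5 using hbig
  let x : ℕ → ℕ × ℕ := fun k => Nat.rec (n0, n0) (fun _ y => (nn y.2, uu y.2)) k
  have hx0 : x 0 = (n0, n0) := rfl
  have hxs : ∀ k, x (k + 1) = (nn (x k).2, uu (x k).2) := fun _ => rfl
  have hx : ∀ k, n0 ≤ (x k).1 ∧ (x k).1 ≤ (x k).2 ∧
      segProd lt w n0 (x k).2 = segProd lt w (x k).1 (x k).2 := by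
    intro k
    cases k with
    | zero => rw [hx0]; exact ⟨le_rfl, le_rfl, rfl⟩
    | succ k => rw [hxs]; exact ⟨(h2 _).le, h3 _, h5 _⟩
  refine ⟨f, fun k => (x k).1, strictMono_nat_of_lt_succ fun k => ?_, fun k => ?_, ?_⟩
  · rw [hxs]
    exact (hx k).2.1.trans_lt (h1 _)
  · dsimp only
    rw [hxs]
    obtain ⟨ha, hb, hc⟩ := hx k
    rw [← segProd_mul hb (h1 _).le, ← hc, segProd_mul (ha.trans hb) (h1 _).le, h4]
  · rw [hodd, ← hbad]
    exact Iff.rfl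

end DState

end Determinization

section Traces

theorem frequently_succ {P : ℕ → Prop} : (∃ᶠ t in atTop, P (t + 1)) ↔ ∃ᶠ t in atTop, P t := by
  have := frequently_map (m := fun t : ℕ => t + 1) (f := atTop) (P := P)
  rw [map_add_atTop_eq_nat] at this
  exact this.symm

theorem eventually_succ {P : ℕ → Prop} : (∀ᶠ t in atTop, P (t + 1)) ↔ ∀ᶠ t in atTop, P t := by
  have := eventually_map (m := fun t : ℕ => t + 1) (f := atTop) (P := P)
  rw [map_add_atTop_eq_nat] at this
  exact this.symm

theorem oddDom_shift {c : ℕ → ℕ} : OddDom (fun t => c (t + 1)) ↔ OddDom c := by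
  refine exists_congr fun p => and_congr_right fun _ => and_congr ?_ ?_
  · exact frequently_succ (P := fun t => c t = p)
  · exact eventually_succ (P := fun t => c t ≤ p)

theorem block_dom {c x : ℕ → ℕ} (hx : StrictMono x) {p : ℕ} (h1 : ∃ᶠ t in atTop, c t = p)
    (h2 : ∀ᶠ t in atTop, c t ≤ p) :
    (∃ᶠ k in atTop, (Finset.Ico (x k) (x (k + 1))).sup c = p) ∧
      ∀ᶠ k in atTop, (Finset.Ico (x k) (x (k + 1))).sup c ≤ p := by
  obtain ⟨T, hT⟩ := eventually_atTop.1 h2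
  have hle : ∀ k, T ≤ k → (Finset.Ico (x k) (x (k + 1))).sup c ≤ p := fun k hk =>
    Finset.sup_le fun t ht => hT t ((hk.trans (hx.id_le k)).trans (Finset.mem_Ico.1 ht).1)
  refine ⟨frequently_atTop.2 fun K => ?_, eventually_atTop.2 ⟨T, hle⟩⟩
  obtain ⟨t, ht, hc⟩ := frequently_atTop.1 h1 (x (max K T))
  have hex : ∃ k, t < x (k + 1) := ⟨t, (hx.id_le (t + 1))⟩
  classical
  set k := Nat.find hex with hk
  have hk1 : t < x (k + 1) := Nat.find_spec hex
  have hKk : max K T ≤ k := by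
    by_contra hlt
    have : x (k + 1) ≤ x (max K T) := hx.monotone (by omega)
    omega
  have hk2 : x k ≤ t := by
    rcases Nat.eq_zero_or_pos k with h0 | h0
    · have := hx.monotone (Nat.zero_le (max K T))
      rw [h0]; omega
    · have := Nat.find_min hex (m := k - 1) (by omega)
      rw [show k - 1 + 1 = k by omega] at this
      omega
  refine ⟨k, (le_max_left _ _).trans hKk, le_antisymm (hle k ((le_max_right _ _).trans hKk)) ?_⟩
  rw [← hc]
  exact Finset.le_sup (f := c) (Finset.mem_Ico.2 ⟨hk2, hk1⟩)

theorem oddDom_block {c x : ℕ → ℕ} (hx : StrictMono x) (hc : ∃ B, ∀ t, c t ≤ B) :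
    OddDom (fun k => (Finset.Ico (x k) (x (k + 1))).sup c) ↔ OddDom c := by
  constructor
  · rintro ⟨p, hp, h1, h2⟩
    obtain ⟨q, h3, h4⟩ := exists_dom hc
    obtain ⟨h5, h6⟩ := block_dom hx h3 h4
    exact ⟨q, dom_unique h1 h5 h2 h6 ▸ hp, h3, h4⟩
  · rintro ⟨p, hp, h1, h2⟩
    exact ⟨p, hp, block_dom hx h1 h2⟩

/-- Profiles of finite words: the pairs of states joined by a trace, with its maximal colour. -/
def Prof (Q : Type) (d : ℕ) : Type := Q → Fin (d + 1) → Q → Prop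

variable {Q β : Type} {d : ℕ}

instance [Finite Q] : Finite (Prof Q d) := inferInstanceAs (Finite (Q → Fin (d + 1) → Q → Prop))

instance : Monoid (Prof Q d) where
  one := fun q c q' => c = 0 ∧ q = q'
  mul f g := fun q c q' => ∃ r c₁ c₂, f q c₁ r ∧ g r c₂ q' ∧ c = max c₁ c₂
  mul_assoc f g h := by
    funext q c q'
    apply propext
    constructor
    · rintro ⟨r, _, c₃, ⟨s, c₁, c₂, h1, h2, rfl⟩, h3, rfl⟩
      exact ⟨s, c₁, _, h1, ⟨r, c₂, c₃, h2, h3, rfl⟩, max_assoc _ _ _⟩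
    · rintro ⟨s, c₁, _, h1, ⟨r, c₂, c₃, h2, h3, rfl⟩, rfl⟩
      exact ⟨r, _, c₃, ⟨s, c₁, c₂, h1, h2, rfl⟩, h3, (max_assoc _ _ _).symm⟩
  one_mul f := by
    funext q c q'
    apply propext
    constructor
    · rintro ⟨r, _, c₂, ⟨rfl, rfl⟩, h3, rfl⟩
      rwa [max_eq_right (Fin.zero_le _)]
    · intro h
      exact ⟨q, 0, c, ⟨rfl, rfl⟩, h, (max_eq_right (Fin.zero_le _)).symm⟩
  mul_one f := by
    funext q c q'
    apply propext
    constructor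
    · rintro ⟨r, c₁, _, h3, ⟨rfl, rfl⟩, rfl⟩
      rwa [max_eq_left (Fin.zero_le _)]
    · intro h
      exact ⟨q', c, 0, h, ⟨rfl, rfl⟩, (max_eq_left (Fin.zero_le _)).symm⟩

/-- The profile of a letter. -/
def letterProf (d : ℕ) (stp : β → Q → ℕ → Q → Prop) (b : β) : Prof Q d :=
  fun q c q' => stp b q c q'

variable {stp : β → Q → ℕ → Q → Prop} {w : ℕ → β}

theorem segProd_of_trace (hd : ∀ b q c q', stp b q c q' → c ≤ d) {p : ℕ → Q} {c : ℕ → ℕ} {i : ℕ} :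
    ∀ {j : ℕ}, i ≤ j → (∀ k, i ≤ k → k < j → stp (w k) (p k) (c k) (p (k + 1))) →
      ∃ e : Fin (d + 1), (e : ℕ) = (Finset.Ico i j).sup c ∧
        segProd (letterProf d stp) w i j (p i) e (p j) := by
  intro j hj
  induction j, hj using Nat.le_induction with
  | base =>
    intro _
    refine ⟨0, by simp, ?_⟩
    rw [segProd_self]
    exact ⟨rfl, rfl⟩
  | succ j hj ih =>
    intro h
    obtain ⟨e, he, h1⟩ := ih fun k hk hk' => h k hk (by omega)
    have h2 := h j hj (by omega)
    let e' : Fin (d + 1) := ⟨c j, Nat.lt_succ_of_le (hd _ _ _ _ h2)⟩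
    refine ⟨max e e', ?_, ?_⟩
    · rw [← Finset.insert_Ico_right_eq_Ico_add_one hj, Finset.sup_insert, ← he, Fin.coe_max]
      exact max_comm _ _
    · rw [segProd_succ hj]
      exact ⟨p j, e, e', h1, h2, rfl⟩

theorem trace_of_segProd {i : ℕ} :
    ∀ {j : ℕ}, i ≤ j → ∀ {q e q'}, segProd (letterProf d stp) w i j q e q' →
      ∃ (p : ℕ → Q) (c : ℕ → ℕ), p i = q ∧ p j = q' ∧ (e : ℕ) = (Finset.Ico i j).sup c ∧
        ∀ k, i ≤ k → k < j → stp (w k) (p k) (c k) (p (k + 1)) := by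
  intro j hj
  induction j, hj using Nat.le_induction with
  | base =>
    intro q e q' h
    rw [segProd_self] at h
    obtain ⟨rfl, rfl⟩ := h
    exact ⟨fun _ => q, fun _ => 0, rfl, rfl, by simp, fun k h1 h2 => by omega⟩
  | succ j hj ih =>
    intro q e q' h
    rw [segProd_succ hj] at h
    obtain ⟨r, c₁, c₂, h1, h2, rfl⟩ := h
    obtain ⟨p, c, rfl, rfl, he, h4⟩ := ih h1
    classical
    refine ⟨update p (j + 1) q', update c j c₂, ?_, by simp, ?_, ?_⟩
    · rw [update_of_ne (by omega)]
    · rw [← Finset.insert_Ico_right_eq_Ico_add_one hj, Finset.sup_insert, update_self,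
        Fin.coe_max, he, max_comm]
      congr 1
      refine Finset.sup_congr rfl fun k hk => ?_
      rw [Finset.mem_Ico] at hk
      rw [update_of_ne (by omega)]
    · intro k hk hk'
      rcases Nat.lt_or_ge k j with hlt | hge
      · rw [update_of_ne (by omega), update_of_ne (by omega), update_of_ne (by omega)]
        exact h4 k hk hlt
      · obtain rfl : k = j := by omega
        rw [update_of_ne (by omega), update_self, update_self]
        exact h2

/-- Glueing sequences that are given on consecutive intervals. -/
theorem exists_glue {y : ℕ → ℕ} (hy0 : y 0 = 0) (hy : Monotone y) (hu : ∀ n, ∃ k, n < y k) :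
    ∃ blk : ℕ → ℕ, ∀ n, y (blk n) ≤ n ∧ n < y (blk n + 1) ∧
      ∀ k, y k ≤ n → n < y (k + 1) → blk n = k := by
  classical
  have hex : ∀ n, ∃ k, n < y (k + 1) := fun n => by
    obtain ⟨k, hk⟩ := hu n
    exact ⟨k, hk.trans_le (hy (by omega))⟩
  refine ⟨fun n => Nat.find (hex n), fun n => ?_⟩
  have h1 := Nat.find_spec (hex n)
  have h2 : y (Nat.find (hex n)) ≤ n := by
    rcases Nat.eq_zero_or_pos (Nat.find (hex n)) with h0 | h0
    · rw [h0, hy0]; omega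
    · have := Nat.find_min (hex n) (m := Nat.find (hex n) - 1) (by omega)
      rw [show Nat.find (hex n) - 1 + 1 = Nat.find (hex n) by omega] at this
      omega
  refine ⟨h2, h1, fun k hk hk' => ?_⟩
  rcases lt_trichotomy (Nat.find (hex n)) k with h | h | h
  · have := hy (show Nat.find (hex n) + 1 ≤ k by omega); omega
  · exact h
  · have := hy (show k + 1 ≤ Nat.find (hex n) by omega); omega

/-- There is a trace from `q₀` through `w` whose dominating colour is odd. -/
def BadTrace (stp : β → Q → ℕ → Q → Prop) (q₀ : Q) (w : ℕ → β) : Prop :=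
  ∃ (q : ℕ → Q) (c : ℕ → ℕ), q 0 = q₀ ∧ (∀ i, stp (w i) (q i) (c i) (q (i + 1))) ∧ OddDom c

theorem badTrace_iff (hd : ∀ b q c q', stp b q c q' → c ≤ d) {q₀ : Q} {f : Prof Q d} {x : ℕ → ℕ}
    (hx : StrictMono x) (hf : ∀ k, segProd (letterProf d stp) w (x k) (x (k + 1)) = f) :
    BadTrace stp q₀ w ↔ ∃ (q : ℕ → Q) (c : ℕ → Fin (d + 1)),
      (∃ c₀, segProd (letterProf d stp) w 0 (x 0) q₀ c₀ (q 0)) ∧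
      (∀ i, f (q i) (c i) (q (i + 1))) ∧ OddDom (fun i => (c i : ℕ)) := by
  constructor
  · rintro ⟨q, c, rfl, hq, hc⟩
    choose e he hs using fun k => segProd_of_trace hd (w := w) (p := q) (c := c)
      (hx.monotone (Nat.le_add_right k 1)) fun k _ _ => hq k
    obtain ⟨e₀, -, h0⟩ := segProd_of_trace hd (w := w) (p := q) (c := c)
      (Nat.zero_le (x 0)) fun k _ _ => hq k
    refine ⟨fun k => q (x k), e, ⟨e₀, h0⟩, fun k => hf k ▸ hs k, ?_⟩
    simp only [he]
    exact (oddDom_block hx ⟨d, fun t => hd _ _ _ _ (hq t)⟩).2 hc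
  · rintro ⟨q, c, ⟨c₀, h0⟩, hq, hc⟩
    let y : ℕ → ℕ := fun k => Nat.casesOn k 0 x
    let qq : ℕ → Q := fun k => Nat.casesOn k q₀ q
    let cc : ℕ → Fin (d + 1) := fun k => Nat.casesOn k c₀ c
    have hy : Monotone y := monotone_nat_of_le_succ fun k => by
      cases k with
      | zero => exact Nat.zero_le _
      | succ k => exact hx.monotone (Nat.le_add_right k 1)
    have hseg : ∀ k, segProd (letterProf d stp) w (y k) (y (k + 1)) (qq k) (cc k) (qq (k + 1)) := by
      intro k
      cases k with
      | zero => exact h0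
      | succ k =>
        have := hq k
        rw [← hf k] at this
        exact this
    choose p e hp1 hp2 hce hst using fun k => trace_of_segProd (hy (Nat.le_add_right k 1)) (hseg k)
    obtain ⟨blk, hblk⟩ := exists_glue (y := y) rfl hy fun n => ⟨n + 2, hx.id_le (n + 1)⟩
    have key : ∀ k n, y k ≤ n → n ≤ y (k + 1) → p (blk n) n = p k n := by
      intro k n h1 h2
      rcases h2.lt_or_eq with h2 | rfl
      · rw [(hblk n).2.2 k h1 h2]
      · obtain ⟨h3, h4, -⟩ := hblk (y (k + 1))
        have hle : k + 1 ≤ blk (y (k + 1)) := by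
          by_contra hlt
          have := hy (show blk (y (k + 1)) + 1 ≤ k + 1 by omega)
          omega
        have : ∀ m, k + 1 ≤ m → y m ≤ y (k + 1) → p m (y (k + 1)) = p k (y (k + 1)) := by
          intro m hm
          induction m, hm using Nat.le_induction with
          | base => intro _; rw [hp1, hp2]
          | succ m hm ih =>
            intro h
            have e1 : y m = y (k + 1) := le_antisymm ((hy (Nat.le_add_right m 1)).trans h) (hy hm)
            have e2 : y (m + 1) = y (k + 1) := le_antisymm h (hy (show k + 1 ≤ m + 1 by omega))
            rw [← ih e1.le, ← e2, hp1, hp2]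
        exact this _ hle h3
    refine ⟨fun n => p (blk n) n, fun n => e (blk n) n, ?_, fun n => ?_, ?_⟩
    · exact (key 0 0 le_rfl (Nat.zero_le _)).trans (hp1 0)
    · obtain ⟨h1, h2, -⟩ := hblk n
      dsimp only
      rw [key (blk n) (n + 1) (by omega) h2]
      exact hst _ n h1 h2
    · refine (oddDom_block hx ⟨d, fun n => ?_⟩).1 ?_
      · obtain ⟨h1, h2, -⟩ := hblk n
        exact hd _ _ _ _ (hst (blk n) n h1 h2)
      · refine hc.congr fun k => (hce (k + 1)).trans ?_
        refine Finset.sup_congr rfl fun n hn => ?_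
        obtain ⟨h1, h2⟩ := Finset.mem_Ico.1 hn
        rw [(hblk n).2.2 (k + 1) h1 h2]

/-- Deterministic parity automata on infinite words. -/
structure DPA (β : Type) where
  St : Type
  fin : Finite St
  s₀ : St
  δ : β → St → St
  pri : St → ℕ

attribute [instance] DPA.fin

/-- The run of a deterministic automaton. -/
def DPA.run (D : DPA β) (w : ℕ → β) : ℕ → D.St
  | 0 => D.s₀
  | t + 1 => D.δ (w t) (D.run w t)

theorem exists_dpa [Finite Q] (hd : ∀ b q c q', stp b q c q' → c ≤ d) (q₀ : Q) :
    ∃ D : DPA β, ∀ w, OddDom (fun t => D.pri (D.run w t)) ↔ BadTrace stp q₀ w := by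
  let Bad : Prof Q d → Prof Q d → Prop := fun s f => ∃ (q : ℕ → Q) (c : ℕ → Fin (d + 1)),
      (∃ c₀, s q₀ c₀ (q 0)) ∧ (∀ i, f (q i) (c i) (q (i + 1))) ∧ OddDom (fun i => (c i : ℕ))
  obtain ⟨B, hB⟩ := DState.out_bdd Bad
  let D : DPA β :=
    { St := DState (Prof Q d) × Fin (B + 1)
      fin := inferInstance
      s₀ := (DState.init, 0)
      δ := fun b s => (s.1.next (letterProf d stp b),
        ⟨DState.out Bad s.1 (letterProf d stp b), Nat.lt_succ_of_le (hB _ _)⟩)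
      pri := fun s => s.2 }
  refine ⟨D, fun w => ?_⟩
  have hrun : ∀ t, (D.run w t).1 = DState.run (letterProf d stp) w t := by
    intro t
    induction t with
    | zero => rfl
    | succ t ih => exact congrArg (fun s => DState.next s (letterProf d stp (w t))) ih
  obtain ⟨f, x, hx, hf, h⟩ := DState.exists_factorization (lt := letterProf d stp) (w := w) Bad
  rw [badTrace_iff hd hx hf, ← oddDom_shift]
  refine Iff.trans ?_ h
  have : ∀ t, D.pri (D.run w (t + 1)) =
      DState.out Bad (DState.run (letterProf d stp) w t) (letterProf d stp (w t)) := fun t =>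
    congrArg (fun s => DState.out Bad s (letterProf d stp (w t))) (hrun t)
  simp only [this]

end Traces

section FixDefs
variable {𝓁 : Type} {A : Finset Act} (D : Aut (Option 𝓁) A) (qin : D.Q)

namespace Aut

/-- A trace step: either follow the choice made for `r`, or pass through the bound variable. -/
def stp (ctop : ℕ) (b : Set D.Q × (D.Q → D.Q)) (r : D.Q) (c : ℕ) (r' : D.Q) : Prop :=
  (c = D.pri r ∧ r' = b.2 r) ∨ (r ∈ b.1 ∧ c = ctop ∧ r' = b.2 qin)

/-- The states whose chosen transition mentions the bound variable. -/
def flag (τ : D.Q → D.T) : Set D.Q := {r | none ∈ D.lit (τ r)}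

/-- Closure of a set of states under unfolding the bound variable. -/
def bar (m f : Set D.Q) : Set D.Q := {r | r ∈ m ∨ (r = qin ∧ ∃ r' ∈ m, r' ∈ f)}

/-- The successor of a state of the fixpoint automaton. -/
def nx (K : DPA (Set D.Q × (D.Q → D.Q))) (e : Set D.Q × K.St) (b : Set D.Q × (D.Q → D.Q)) :
    Set D.Q × K.St :=
  (b.2 '' D.bar qin e.1 b.1, K.δ b e.2)

/-- Transitions of the fixpoint automaton: a choice of transitions for all states in the content,
and a set of choices of successors. -/
structure FT (K : DPA (Set D.Q × (D.Q → D.Q))) where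
  e : Set D.Q × K.St
  τ : D.Q → D.T
  Z : A → Set (D.Q → D.Q)
  src : ∀ r ∈ D.bar qin e.1 (D.flag τ), D.src (τ r) = r
  sub : ∀ a, ∀ ζ ∈ Z a, ∀ r ∈ D.bar qin e.1 (D.flag τ), ζ r ∈ D.suc (τ r) a
  hit : ∀ a, ∀ r ∈ D.bar qin e.1 (D.flag τ), ∀ u ∈ D.suc (τ r) a, ∃ ζ ∈ Z a, ζ r = u

instance (K : DPA (Set D.Q × (D.Q → D.Q))) : Finite (FT D qin K) := by
  refine Finite.of_injective
    (fun x : FT D qin K => ((x.e, x.τ, x.Z) :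
      (Set D.Q × K.St) × (D.Q → D.T) × (A → Set (D.Q → D.Q)))) ?_
  rintro ⟨e, τ, Z, _, _, _⟩ ⟨e', τ', Z', _, _, _⟩ h
  simp only [Prod.mk.injEq] at h
  obtain ⟨rfl, rfl, rfl⟩ := h
  rfl

/-- The automaton for a fixpoint. -/
def fixAut (K : DPA (Set D.Q × (D.Q → D.Q))) : Aut 𝓁 A where
  Q := Set D.Q × K.St
  T := FT D qin K
  finQ := inferInstance
  finT := inferInstance
  src x := x.e
  lit x := {l | ∃ r ∈ D.bar qin x.e.1 (D.flag x.τ), some l ∈ D.lit (x.τ r)}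
  lit_fin x := by
    have : (⋃ r, D.lit (x.τ r)).Finite := finite_iUnion fun r => D.lit_fin _
    refine (this.preimage (f := some) (Option.some_injective _).injOn).subset ?_
    rintro l ⟨r, -, h⟩
    exact mem_iUnion.2 ⟨r, h⟩
  suc x a := {e' | ∃ ζ ∈ x.Z a, e' = D.nx qin K x.e (D.flag x.τ, ζ)}
  pri e := K.pri e.2

end Aut
end FixDefs

section FixLower
variable {𝓁 : Type} {A : Finset Act} {D : Aut (Option 𝓁) A} {qin : D.Q}
  {M : Frame Act Atom} {Lv : 𝓁 → Set M.W}

namespace Aut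

variable (D qin M Lv) in
/-- The equations of `D`, together with an equation for the bound variable. -/
def openF (o : Option D.Q) (ρ : Option D.Q → Set M.W) : Set M.W :=
  D.step M (optCons (ρ none) Lv) (o.getD qin) (fun q => ρ (some q))

theorem openF_pfq (hM : MF M) (hL : ∀ l, Lv l ∈ M.Adm) (o : Option D.Q) :
    PFQ M (openF D qin M Lv o) := by
  intro e
  have hfin : ∀ t, Finite (D.lit t) := fun t => D.lit_fin t
  have : PF M (fun ρ => ⋃ t : {t // D.src t = o.getD qin},
      (⋂ l : D.lit t, (optCons (ρ (e none)) Lv : Option 𝓁 → Set M.W) l) ∩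
      nab M (D.suc t) (fun p => ρ (e (some p)))) := by
    refine PF.iUnion hM fun t => PF.inter hM (PF.iInter hM fun l => ?_)
      (nab_pfq hM _ (fun p => e (some p)))
    rcases l with ⟨_ | l, hl⟩
    · exact PF.var hM _
    · exact PF.const (hL l)
  refine this.congr fun ρ => ?_
  ext w
  simp [openF, step, lits, and_left_comm]

theorem fx_congr {W : Type} {Adm : Set (Set W)} (hc : ∀ T ∈ Adm, Tᶜ ∈ Adm) {f g : Set W → Set W}
    (h : ∀ T ∈ Adm, f T = g T) (b : Bool) : fx Adm b f = fx Adm b g := by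
  have key : ∀ f g : Set W → Set W, (∀ T ∈ Adm, f T = g T) → lfpA Adm f = lfpA Adm g := by
    intro f g h
    unfold lfpA
    congr 1
    ext T
    exact and_congr_right fun hT => by rw [h T hT]
  cases b
  · simp only [fx, gfpA, Bool.false_eq_true, if_false]
    rw [key _ _ fun T hT => by rw [h _ (hc T hT)]]
  · simpa [fx] using key f g h

variable (D qin M Lv) in
/-- The fixpoint of the meaning of `qin` in the bound variable. -/
noncomputable def fixVal (b : Bool) : Set M.W :=
  fx M.Adm b (fun T => D.val M (optCons T Lv) qin)

variable (D) in
/-- A colour for the bound variable. -/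
def IsTop (b : Bool) (ctop : ℕ) : Prop := (∀ q, D.pri q ≤ ctop) ∧ decide (Odd ctop) = b

theorem exists_isTop (b : Bool) : ∃ ctop, D.IsTop b ctop := by
  obtain ⟨B, hB⟩ := (finite_range D.pri).bddAbove
  cases b
  · exact ⟨2 * B, fun q => (hB (mem_range_self q)).trans (by omega), by simp⟩
  · exact ⟨2 * B + 1, fun q => (hB (mem_range_self q)).trans (by omega), by simp⟩

theorem openSol (hM : MF M) (hL : ∀ l, Lv l ∈ M.Adm) {b : Bool} {ctop : ℕ} (hc : D.IsTop b ctop) :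
    solR M.Adm (optCons (Nat.card D.Q) D.rk) (optCons ctop D.pri) (Nat.card D.Q + 1)
      (openF D qin M Lv) =
    optCons (fixVal D qin M Lv b) (D.val M (optCons (fixVal D qin M Lv b) Lv)) := by
  obtain ⟨h1, h2⟩ := solR_option (Adm := M.Adm) (F := openF D qin M Lv) D.ranking hc.1
  have e0 : solR M.Adm (optCons (Nat.card D.Q) D.rk) (optCons ctop D.pri) (Nat.card D.Q + 1)
      (openF D qin M Lv) none = fixVal D qin M Lv b := by
    rw [h1, hc.2, fixVal]
    refine fx_congr hM.compl_mem (fun T hT => ?_) b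
    have hL' : ∀ l, (optCons T Lv : Option 𝓁 → Set M.W) l ∈ M.Adm := by
      rintro (_ | l)
      exacts [hT, hL l]
    rw [← D.val_step hM hL' qin]
    rfl
  funext o
  cases o with
  | none => exact e0
  | some q =>
    rw [h2 q, e0]
    rfl

theorem fixVal_adm (hM : MF M) (hL : ∀ l, Lv l ∈ M.Adm) (b : Bool) :
    fixVal D qin M Lv b ∈ M.Adm := by
  obtain ⟨ctop, hc⟩ := D.exists_isTop b
  have h := (mkAnn hM (D.ranking.option hc.1) (openF_pfq (D := D) (qin := qin) hM hL)).U_adm _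
    (fun _ => hM.univ_mem) none
  have e := congrFun (mkAnn_y hM (D.ranking.option hc.1) (openF_pfq (D := D) (qin := qin) hM hL)) none
  rw [openSol hM hL hc] at e
  change _ = fixVal D qin M Lv b at e
  rw [← e]
  exact h

theorem optCons_adm {T : Set M.W} (hT : T ∈ M.Adm) (hL : ∀ l, Lv l ∈ M.Adm) (l : Option 𝓁) :
    (optCons T Lv : Option 𝓁 → Set M.W) l ∈ M.Adm := by
  rcases l with _ | l
  exacts [hT, hL l]

theorem fixVal_unfold (hM : MF M) (hL : ∀ l, Lv l ∈ M.Adm) (b : Bool) :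
    D.val M (optCons (fixVal D qin M Lv b) Lv) qin = fixVal D qin M Lv b := by
  obtain ⟨ctop, hc⟩ := D.exists_isTop b
  have h := (mkAnn hM (D.ranking.option hc.1) (openF_pfq (D := D) (qin := qin) hM hL)).y_unf none
  rw [mkAnn_y, openSol hM hL hc] at h
  rw [← D.val_step hM (optCons_adm (fixVal_adm hM hL b) hL) qin]
  exact h

theorem val_mono_var (hM : MF M) (hL : ∀ l, Lv l ∈ M.Adm) {T T' : Set M.W} (hT : T ∈ M.Adm)
    (hT' : T' ∈ M.Adm) (h : T ⊆ T') (q : D.Q) :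
    D.val M (optCons T Lv) q ⊆ D.val M (optCons T' Lv) q := by
  refine D.val_le_of_sim D hM (optCons_adm hT hL) (optCons_adm hT' hL) Eq
    (fun q q' h => by rw [h]) ?_ rfl
  rintro q _ rfl t ht
  refine ⟨t, ht, ?_, fun a => ⟨fun s hs => ⟨s, hs, rfl⟩, fun s hs => ⟨s, hs, rfl⟩⟩⟩
  rintro w hw (_ | l) hl
  · exact h (hw none hl)
  · exact hw (some l) hl

theorem image_mem_nx {K : DPA (Set D.Q × (D.Q → D.Q))} {e : Set D.Q × K.St} {f : Set D.Q}
    {ζ : D.Q → D.Q} {r : D.Q} (hr : r ∈ D.bar qin e.1 f) : ζ r ∈ (D.nx qin K e (f, ζ)).1 :=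
  ⟨r, hr, rfl⟩

theorem fixAut_le (hM : MF M) (hL : ∀ l, Lv l ∈ M.Adm) {b : Bool} {ctop : ℕ}
    (hc : D.IsTop b ctop) (hq : ∀ t, D.src t = qin → none ∉ D.lit t) {qs : D.Q}
    {K : DPA (Set D.Q × (D.Q → D.Q))}
    (hK : ∀ w, BadTrace (D.stp qin ctop) qs w → OddDom (fun t => K.pri (K.run w t))) :
    (D.fixAut qin K).val M Lv ({qs}, K.s₀) ⊆ D.val M (optCons (fixVal D qin M Lv b) Lv) qs := by
  intro w hw
  by_contra hw'
  have hr' := D.ranking.option hc.1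
  have hr : Ranking (fun o => (optCons ctop D.pri : Option D.Q → ℕ) o + 1)
      (optCons (Nat.card D.Q) D.rk) (Nat.card D.Q + 1) :=
    ⟨hr'.inj, hr'.lt, hr'.surj, fun p q h => Nat.succ_le_succ (hr'.pri_le p q h)⟩
  let A₂ := mkAnn hM hr (F := fun o ρ => (openF D qin M Lv o (fun p => (ρ p)ᶜ))ᶜ)
    fun o => (openF_pfq hM hL o).dual hM
  have hA₂ : A₂.y = fun o => ((optCons (fixVal D qin M Lv b)
      (D.val M (optCons (fixVal D qin M Lv b) Lv)) : Option D.Q → Set M.W) o)ᶜ := by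
    rw [mkAnn_y, solR_dual hr', openSol hM hL hc]
  let Φ := D.fixAut qin K
  let CA := {p : (Set D.Q × K.St) × D.Q // p.2 ∈ p.1.1}
  let CB := {p : FT D qin K × D.Q × Bool //
    p.2.1 ∈ p.1.e.1 ∧ (p.2.2 = true → p.2.1 ∈ D.flag p.1.τ)}
  let cur : CB → D.Q := fun p => if p.1.2.2 then qin else p.1.2.1
  have hcur : ∀ p : CB, cur p ∈ D.bar qin p.1.1.e.1 (D.flag p.1.1.τ) := by
    rintro ⟨⟨x, r, b⟩, h1, h2⟩
    dsimp only [cur]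
    split_ifs with hb
    · exact Or.inr ⟨rfl, r, h1, h2 hb⟩
    · exact Or.inl h1
  let S : CA ⊕ CB → CA ⊕ CB → Prop := fun c c' =>
    match c, c' with
    | .inl p, .inr x => x.1.1.e = p.1.1 ∧ x.1.2.1 = p.1.2
    | .inr x, .inl p => ∃ ζ, p.1.1 = D.nx qin K x.1.1.e (D.flag x.1.1.τ, ζ) ∧ p.1.2 = ζ (cur x)
    | _, _ => False
  obtain ⟨c, hc0, hcS, h1, h2⟩ := exists_path_two (C := CA ⊕ CB) hM
    (Φ.ann hM hL) A₂ (fun _ => univ) (fun _ => hM.univ_mem)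
    (Sum.elim (fun p => some p.1.1) (fun _ => none))
    (Sum.elim (fun p => some (some p.1.2)) (fun x => if x.1.2.2 then some none else none))
    (Sum.elim (fun p ρ => ρ p.1.1) (fun x ρ => Φ.lits M Lv x.1.1 ∩ nab M (Φ.suc x.1.1) ρ))
    (Sum.elim (fun p ρ => ρ (some p.1.2))
      (fun x ρ => (nab M (D.suc (x.1.1.τ x.1.2.1)) fun q => (ρ (some q))ᶜ)ᶜ))
    (by
      rintro (p | x)
      · exact PFQ.var hM _
      · intro e
        exact PF.inter hM (PF.const (Φ.lits_adm hM hL _)) (nab_pfq hM _ e))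
    (by
      rintro (p | x)
      · exact PFQ.var hM _
      · intro e
        exact (nab_pfq hM (D.suc (x.1.1.τ x.1.2.1))).dual hM (fun q => e (some q)))
    S
    (by
      rintro (⟨⟨e, r⟩, hr⟩ | x) v₁ v₂ - - - - w - hu₁ hu₂
      · obtain ⟨y, rfl, hl, hn⟩ := hu₁
        by_cases hx : r ∈ D.flag y.τ ∧ w ∈ v₂ none
        · exact ⟨.inr ⟨(y, r, true), hr, fun _ => hx.1⟩, ⟨rfl, rfl⟩, w, trivial, ⟨hl, hn⟩, hx.2⟩
        · refine ⟨.inr ⟨(y, r, false), hr, fun h => absurd h (by simp)⟩, ⟨rfl, rfl⟩, w, trivial, ⟨hl, hn⟩,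
            fun hn' => hu₂ ⟨y.τ r, y.src r (Or.inl hr), ?_, hn'⟩⟩
          rintro (_ | l) hl'
          · exact fun h => hx ⟨hl', h⟩
          · exact hl l ⟨r, Or.inl hr, hl'⟩
      · have hcx := hcur x
        have hfail : w ∉ nab M (D.suc (x.1.1.τ (cur x))) fun q => (v₂ (some q))ᶜ := by
          obtain ⟨⟨y, r, b⟩, hx1, hx2⟩ := x
          cases b with
          | false => exact hu₂
          | true =>
            refine fun hn' => hu₂ ⟨y.τ qin, y.src qin hcx, ?_, hn'⟩
            rintro (_ | l) hl'
            · exact absurd hl' (hq _ (y.src qin hcx))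
            · exact hu₁.1 l ⟨qin, hcx, hl'⟩
        obtain ⟨w', e', q', ⟨ζ, rfl, rfl⟩, h1, h2⟩ := nab_conflict
          (Z := fun e' q' => ∃ ζ, e' = D.nx qin K x.1.1.e (D.flag x.1.1.τ, ζ) ∧ q' = ζ (cur x))
          (v₂ := fun q => v₂ (some q)) hu₁.2 hfail (by
            intro a
            constructor
            · rintro _ ⟨ζ, hζ, rfl⟩
              exact ⟨_, x.1.1.sub a ζ hζ _ hcx, ζ, rfl, rfl⟩
            · intro u hu
              obtain ⟨ζ, hζ, rfl⟩ := x.1.1.hit a _ hcx u hu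
              exact ⟨_, ⟨ζ, hζ, rfl⟩, ζ, rfl, rfl⟩)
        exact ⟨.inl ⟨(_, ζ (cur x)), image_mem_nx hcx⟩, ⟨ζ, rfl, rfl⟩, w', trivial, h1, h2⟩)
    (c₀ := .inl ⟨(({qs}, K.s₀), qs), rfl⟩) (w₀ := w) trivial
    (by dsimp only [Sum.elim_inl, Option.elim]; rw [Φ.ann_y hM hL]; exact hw)
    (by dsimp only [Sum.elim_inl, Option.elim]; rw [hA₂]; exact hw')
  have hstep : ∀ t, ∃ p x, c (2 * t) = .inl p ∧ c (2 * t + 1) = .inr x := by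
    have hA : ∀ t p, c t = .inl p → ∃ x, c (t + 1) = .inr x := by
      intro t p hp
      have := hcS t
      rw [hp] at this
      rcases h : c (t + 1) with p' | x
      · rw [h] at this; exact this.elim
      · exact ⟨x, rfl⟩
    have hB : ∀ t x, c t = .inr x → ∃ p, c (t + 1) = .inl p := by
      intro t x hp
      have := hcS t
      rw [hp] at this
      rcases h : c (t + 1) with p' | x'
      · exact ⟨p', rfl⟩
      · rw [h] at this; exact this.elim
    intro t
    induction t with
    | zero => exact ⟨_, (hA 0 _ hc0).choose, hc0, (hA 0 _ hc0).choose_spec⟩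
    | succ t ih =>
      obtain ⟨p, x, -, hx⟩ := ih
      obtain ⟨p', hp'⟩ := hB _ _ hx
      obtain ⟨x', hx'⟩ := hA _ _ hp'
      exact ⟨p', x', hp', hx'⟩
  choose p x hp hx using hstep
  have hAB : ∀ t, (x t).1.1.e = (p t).1.1 ∧ (x t).1.2.1 = (p t).1.2 := fun t => by
    have := hcS (2 * t)
    rwa [hp, hx] at this
  have hBA : ∀ t, ∃ ζ, (p (t + 1)).1.1 = D.nx qin K (x t).1.1.e (D.flag (x t).1.1.τ, ζ) ∧
      (p (t + 1)).1.2 = ζ (cur (x t)) := fun t => by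
    have := hcS (2 * t + 1)
    rwa [hx, show 2 * t + 1 + 1 = 2 * (t + 1) by ring, hp] at this
  choose ζ hζ1 hζ2 using hBA
  have hp0 : p 0 = ⟨(({qs}, K.s₀), qs), rfl⟩ := Sum.inl_injective ((hp 0).symm.trans hc0)
  let wd : ℕ → Set D.Q × (D.Q → D.Q) := fun t => (D.flag (x t).1.1.τ, ζ t)
  have hrun : ∀ t, (p t).1.1.2 = K.run wd t := by
    intro t
    induction t with
    | zero => rw [hp0]; rfl
    | succ t ih => rw [hζ1, (hAB t).1, nx, ih]; rfl
  have h2d : StrictMono fun k : ℕ => 2 * k := fun a b h => by dsimp only; omega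
  have hsup : ∀ (g : ℕ → ℕ) k, (Finset.Ico (2 * k) (2 * (k + 1))).sup g =
      max (g (2 * k)) (g (2 * k + 1)) := by
    intro g k
    have : Finset.Ico (2 * k) (2 * (k + 1)) = {2 * k, 2 * k + 1} := by
      ext i; simp only [Finset.mem_Ico, Finset.mem_insert, Finset.mem_singleton]; omega
    rw [this, Finset.sup_insert, Finset.sup_singleton]
  obtain ⟨B₁, hB₁⟩ := (finite_range K.pri).bddAbove
  refine h1 ((oddDom_block h2d ⟨B₁, fun t => ?_⟩).1 ?_)
  · rcases c t with p | x
    · exact hB₁ (mem_range_self _)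
    · exact Nat.zero_le _
  have e1 : ∀ t, K.pri (K.run wd t) = (Finset.Ico (2 * t) (2 * (t + 1))).sup fun t =>
      Option.elim (Sum.elim (fun p : CA => some p.1.1) (fun _ => none) (c t)) 0
        (Φ.ann hM hL).pri := by
    intro t
    rw [hsup, hp, hx, ← hrun]
    exact (max_eq_left (Nat.zero_le _)).symm
  refine (hK wd ⟨fun t => (p t).1.2, fun t => if (x t).1.2.2 then ctop else D.pri (p t).1.2,
    congrArg (fun p : CA => p.1.2) hp0, fun t => ?_, ?_⟩).congr e1
  · dsimp only [stp]
    rw [hζ2]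
    rcases hb : (x t).1.2.2 with _ | _
    · left
      simp only [cur, hb, (hAB t).2]
      exact ⟨rfl, rfl⟩
    · right
      simp only [cur, hb]
      exact ⟨(hAB t).2 ▸ (x t).2.2 hb, rfl, rfl⟩
  · by_contra hcon
    refine h2 ((oddDom_block h2d ⟨ctop + 1, fun t => ?_⟩).1
      (((oddDom_succ_iff ⟨ctop, fun t => ?_⟩).2 hcon).congr fun t => ?_))
    · rcases c t with p | x
      · exact Nat.succ_le_succ (hc.1 _)
      · dsimp only [Sum.elim_inr]
        split_ifs
        · exact le_rfl
        · exact Nat.zero_le _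
    · split_ifs
      exacts [le_rfl, hc.1 _]
    · rw [hsup, hp, hx]
      dsimp only [Sum.elim_inr, Sum.elim_inl]
      rcases hb : (x t).1.2.2 with _ | _
      · exact (max_eq_left (Nat.zero_le _)).symm
      · exact (max_eq_right (Nat.succ_le_succ (hc.1 _))).symm

end Aut
end FixLower

theorem oddDom_add {c : ℕ → ℕ} (n : ℕ) : OddDom (fun t => c (t + n)) ↔ OddDom c := by
  induction n with
  | zero => rfl
  | succ n ih =>
    rw [← ih, ← oddDom_shift (c := fun t => c (t + n))]
    simp only [add_assoc, add_comm 1 n]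

theorem eventually_const_of_antitone {f : ℕ → ℕ} (h : ∀ᶠ t in atTop, f (t + 1) ≤ f t) :
    ∃ T, (∀ t ≥ T, f (t + 1) ≤ f t) ∧ ∀ t ≥ T, f t = f T := by
  obtain ⟨T₀, hT₀⟩ := eventually_atTop.1 h
  have hanti : ∀ s ≥ T₀, ∀ t ≥ s, f t ≤ f s := by
    intro s hs t ht
    induction t, ht using Nat.le_induction with
    | base => exact le_rfl
    | succ t ht ih => exact (hT₀ t (hs.trans ht)).trans ih
  obtain ⟨T, hT, hmin⟩ : ∃ T ≥ T₀, ∀ t ≥ T₀, f T ≤ f t := by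
    have hne : ∃ m, ∃ t ≥ T₀, f t = m := ⟨_, T₀, le_rfl, rfl⟩
    classical
    obtain ⟨T, hT, e⟩ := Nat.find_spec hne
    exact ⟨T, hT, fun t ht => e ▸ Nat.find_min' hne ⟨t, ht, rfl⟩⟩
  exact ⟨T, fun t ht => hT₀ t (hT.le.trans ht), fun t ht =>
    le_antisymm (hanti T hT t ht) (hmin t (hT.le.trans ht))⟩

theorem exists_min_key {σ : Type} (key : σ → ℕ) {p : σ → Prop} (h : ∃ i, p i) :
    ∃ i, p i ∧ ∀ j, p j → key i ≤ key j := by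
  have hne : ∃ m, ∃ i, p i ∧ key i = m := ⟨_, h.choose, h.choose_spec, rfl⟩
  classical
  obtain ⟨i, hi, e⟩ := Nat.find_spec hne
  exact ⟨i, hi, fun j hj => e ▸ Nat.find_min' hne ⟨j, hj, rfl⟩⟩

section Upper
variable {𝓁 : Type} {A : Finset Act} {D : Aut (Option 𝓁) A} {qin : D.Q}
  {M : Frame Act Atom} {Lv : 𝓁 → Set M.W}

namespace Aut

/-- Closure of a set of states under unfolding, if this is internal. -/
def barI (int : Prop) (qin : D.Q) (m f : Set D.Q) : Set D.Q :=
  {r | r ∈ m ∨ (int ∧ r = qin ∧ ∃ r' ∈ m, r' ∈ f)}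

variable (D qin M Lv) in
/-- A system of equations whose states witness sets of states of `D`. -/
structure Prov (Vx : Set M.W) (ctop : ℕ) where
  Θ : Type
  fin : Finite Θ
  ann : Ann M Θ
  con : Θ → Set D.Q
  int : Prop
  ok : Θ → Prop
  Step : Θ → Set D.Q × (D.Q → D.Q) → Θ → Prop
  unf : ∀ θ v w, ok θ → w ∈ ann.F θ v → ∃ (τ : D.Q → D.T) (Mv : A → Set ((D.Q → D.Q) × Θ)),
    (∀ r ∈ barI int qin (con θ) (D.flag τ), D.src (τ r) = r ∧ ∀ l, some l ∈ D.lit (τ r) → w ∈ Lv l) ∧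
    (¬ int → ∀ r ∈ con θ, r ∈ D.flag τ → w ∈ Vx) ∧
    (∀ a, ∀ z ∈ Mv a, ok z.2 ∧ Step θ (D.flag τ, z.1) z.2 ∧
      ∀ r ∈ barI int qin (con θ) (D.flag τ), z.1 r ∈ D.suc (τ r) a ∧ z.1 r ∈ con z.2) ∧
    (∀ a : A, ∀ w' ∈ M.R a w, ∃ z ∈ Mv a, w' ∈ v z.2) ∧
    (∀ a : A, ∀ r ∈ barI int qin (con θ) (D.flag τ), ∀ u ∈ D.suc (τ r) a, ∃ z ∈ Mv a, z.1 r = u ∧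
      ∃ w' ∈ M.R a w, w' ∈ v z.2)
  acc : ∀ (θ : ℕ → Θ) (β : ℕ → Set D.Q × (D.Q → D.Q)) (q : ℕ → D.Q) (c : ℕ → ℕ),
    (∀ t, ok (θ t)) → (∀ t, Step (θ t) (β t) (θ (t + 1))) → (∀ t, q t ∈ con (θ t)) →
    (∀ t, (c t = D.pri (q t) ∧ q (t + 1) = (β t).2 (q t)) ∨
      (int ∧ q t ∈ (β t).1 ∧ c t = ctop ∧ q (t + 1) = (β t).2 qin)) →
    OddDom c → OddDom (fun t => ann.pri (θ t))

attribute [instance] Prov.fin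

variable {Vx : Set M.W} {ctop : ℕ}

/-- The provider in each slot: one main slot, and auxiliary ones. -/
abbrev slotProv (Pm Pθ : Prov D qin M Lv Vx ctop) {N : ℕ} (i : Option (Fin N)) :
    Prov D qin M Lv Vx ctop :=
  i.elim Pm fun _ => Pθ

/-- The precedence of slots; the main slot comes last. -/
def slotKey {N : ℕ} (i : Option (Fin N)) : ℕ := i.elim N fun j => j

theorem slotKey_injective {N : ℕ} : Injective (slotKey (N := N)) := by
  rintro (_ | i) (_ | j) h
  · rfl
  · exact absurd h.symm (Nat.ne_of_lt j.2)
  · exact absurd h (Nat.ne_of_lt i.2)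
  · exact congrArg some (Fin.ext h)

theorem slotKey_le {N : ℕ} (i : Option (Fin N)) : slotKey i ≤ N := by
  rcases i with _ | i
  exacts [le_rfl, i.2.le]

/-- Forget the slot of a state. -/
def slotId {Pm Pθ : Prov D qin M Lv Vx ctop} {N : ℕ} :
    ∀ i : Option (Fin N), (slotProv Pm Pθ i).Θ → Pm.Θ ⊕ Pθ.Θ
  | none, x => .inl x
  | some _, x => .inr x

theorem slotId_con {Pm Pθ : Prov D qin M Lv Vx ctop} {N : ℕ} :
    ∀ (i j : Option (Fin N)) (x : (slotProv Pm Pθ i).Θ) (y : (slotProv Pm Pθ j).Θ),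
      slotId i x = slotId j y → (slotProv Pm Pθ i).con x = (slotProv Pm Pθ j).con y
  | none, none, _, _, h => congrArg _ (Sum.inl_injective h)
  | some _, some _, _, _, h => congrArg _ (Sum.inr_injective h)
  | none, some _, _, _, h => by cases h
  | some _, none, _, _, h => by cases h

variable (K : DPA (Set D.Q × (D.Q → D.Q))) (Pm Pθ : Prov D qin M Lv Vx ctop) (N : ℕ)

/-- Configurations: a state of the fixpoint automaton and threads covering its content. -/
structure SlotInv (c : (Set D.Q × K.St) × ∀ i : Option (Fin N), Option (slotProv Pm Pθ i).Θ) :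
    Prop where
  cover : ∀ r ∈ c.1.1, ∃ i θ, c.2 i = some θ ∧ r ∈ (slotProv Pm Pθ i).con θ
  ok : ∀ i θ, c.2 i = some θ → (slotProv Pm Pθ i).ok θ
  inj : ∀ (i j : Fin N) (θ : Pθ.Θ), c.2 (some i) = some θ → c.2 (some j) = some θ → i = j

/-- The configurations satisfying the invariant. -/
abbrev SlotCfg := {c : (Set D.Q × K.St) × ∀ i : Option (Fin N), Option (slotProv Pm Pθ i).Θ //
  SlotInv K Pm Pθ N c}

/-- What is recorded about one round. -/
def SlotStep (c c' : SlotCfg K Pm Pθ N) (kept : Option (Option (Fin N)) → Prop) : Prop :=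
  ∃ (f : Set D.Q) (s : D.Q → D.Q) (β : Option (Fin N) → Set D.Q × (D.Q → D.Q))
    (pos : D.Q → Option (Fin N)),
    c'.1.1 = D.nx qin K c.1.1 (f, s) ∧ kept none ∧
    (∀ r j θ, c.1.2 j = some θ → r ∈ (slotProv Pm Pθ j).con θ → slotKey (pos r) ≤ slotKey j) ∧
    (∀ r, (r ∈ f ↔ r ∈ (β (pos r)).1) ∧ s r = (β (pos r)).2 r) ∧
    (∀ i θ θ', c.1.2 i = some θ → c'.1.2 i = some θ' →
      (slotProv Pm Pθ i).Step θ (β i) θ' ∧ kept (some i)) ∧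
    (∀ r ∈ D.bar qin c.1.1.1 f, ∃ j θ', slotKey j ≤ slotKey (pos r) ∧ c'.1.2 j = some θ' ∧
      s r ∈ (slotProv Pm Pθ j).con θ') ∧
    ∀ r ∈ c.1.1.1, r ∈ f → ((slotProv Pm Pθ (pos r)).int → slotKey (pos qin) ≤ slotKey (pos r)) ∧
      (¬ (slotProv Pm Pθ (pos r)).int → pos qin ≠ none)

variable {K Pm Pθ N}

theorem slot_insert (hN : N = Nat.card Pθ.Θ) {θ₀ : Pθ.Θ} (hθ : Vx ⊆ Pθ.ann.y θ₀)
    (hok : Pθ.ok θ₀) (hq : qin ∈ Pθ.con θ₀) (c : SlotCfg K Pm Pθ N)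
    (v : ∀ i : Option (Fin N), (slotProv Pm Pθ i).Θ → Set M.W) {w : M.W}
    (hw : ∀ i θ, c.1.2 i = some θ → w ∈ (slotProv Pm Pθ i).ann.F θ (v i)) :
    ∃ (th : ∀ i : Option (Fin N), Option (slotProv Pm Pθ i).Θ)
      (U : ∀ i : Option (Fin N), (slotProv Pm Pθ i).Θ → Set M.W),
      (∀ i θ, c.1.2 i = some θ → th i = some θ) ∧
      (∀ i θ, th i = some θ → (slotProv Pm Pθ i).ok θ ∧ w ∈ (slotProv Pm Pθ i).ann.F θ (U i)) ∧
      (∀ i, (c.1.2 i).isSome → U i = v i) ∧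
      (∀ i, c.1.2 i = none → U i = (slotProv Pm Pθ i).ann.y) ∧
      (w ∈ Vx → ∃ (j : Fin N) (θ : Pθ.Θ), th (some j) = some θ ∧ qin ∈ Pθ.con θ) := by
  classical
  let U : ∀ i : Option (Fin N), (slotProv Pm Pθ i).Θ → Set M.W := fun i =>
    if (c.1.2 i).isSome then v i else (slotProv Pm Pθ i).ann.y
  have hU1 : ∀ i, (c.1.2 i).isSome → U i = v i := fun i h => if_pos h
  have hU2 : ∀ i, c.1.2 i = none → U i = (slotProv Pm Pθ i).ann.y := fun i h =>
    if_neg (by rw [h]; simp)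
  have hold : ∀ i θ, c.1.2 i = some θ →
      (slotProv Pm Pθ i).ok θ ∧ w ∈ (slotProv Pm Pθ i).ann.F θ (U i) := fun i θ h =>
    ⟨c.2.ok i θ h, by rw [hU1 i (by rw [h]; rfl)]; exact hw i θ h⟩
  by_cases hins : w ∈ Vx ∧ ∀ j : Fin N, c.1.2 (some j) ≠ some θ₀
  · obtain ⟨hx, hne⟩ := hins
    obtain ⟨j₀, hj₀⟩ : ∃ j : Fin N, c.1.2 (some j) = none := by
      by_contra hcon
      push Not at hcon
      choose g hg using fun j => Option.ne_none_iff_exists'.1 (hcon j)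
      have hinj : Injective fun o : Option (Fin N) => (o.elim θ₀ g : Pθ.Θ) := by
        rintro (_ | i) (_ | j) h
        · rfl
        · exact absurd ((hg j).trans (congrArg some h.symm)) (hne j)
        · exact absurd ((hg i).trans (congrArg some h)) (hne i)
        · exact congrArg some (c.2.inj i j (g i) (hg i) ((hg j).trans (congrArg some h.symm)))
      have := Nat.card_le_card_of_injective _ hinj
      rw [← hN] at this
      simp at this
    refine ⟨update c.1.2 (some j₀) (some θ₀), U, ?_, ?_, hU1, hU2, fun _ => ⟨j₀, θ₀, ?_, hq⟩⟩
    · intro i θ h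
      rw [update_of_ne _ _ _]
      · exact h
      · rintro rfl
        rw [hj₀] at h
        cases h
    · intro i θ h
      by_cases hi : i = some j₀
      · subst hi
        rw [update_self] at h
        obtain rfl := Option.some_injective _ h
        refine ⟨hok, ?_⟩
        rw [hU2 _ hj₀]
        exact (Pθ.ann.y_unf θ₀).symm ▸ hθ hx
      · rw [update_of_ne hi] at h
        exact hold i θ h
    · exact update_self ..
  · refine ⟨c.1.2, U, fun _ _ h => h, hold, hU1, hU2, fun hx => ?_⟩
    by_contra hcon
    exact hins ⟨hx, fun j hj => hcon ⟨j, θ₀, hj, hq⟩⟩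

end Aut
end Upper

section Upper
variable {𝓁 : Type} {A : Finset Act} {D : Aut (Option 𝓁) A} {qin : D.Q}
  {M : Frame Act Atom} {Lv : 𝓁 → Set M.W}
  {Vx : Set M.W} {ctop : ℕ} {K : DPA (Set D.Q × (D.Q → D.Q))}
  {Pm Pθ : Aut.Prov D qin M Lv Vx ctop} {N : ℕ}

namespace Aut

theorem slot_round (hN : N = Nat.card Pθ.Θ) {θ₀ : Pθ.Θ} (hθ : Vx ⊆ Pθ.ann.y θ₀)
    (hok : Pθ.ok θ₀) (hqθ : qin ∈ Pθ.con θ₀) (θm : Pm.Θ) (t₀ : D.T)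
    (hq : ∀ t, D.src t = qin → none ∉ D.lit t) (c : SlotCfg K Pm Pθ N)
    (vT : Set D.Q × K.St → Set M.W)
    (v : ∀ i : Option (Fin N), (slotProv Pm Pθ i).Θ → Set M.W) {w : M.W}
    (hwT : w ∉ (D.fixAut qin K).step M Lv c.1.1 fun q => (vT q)ᶜ)
    (hw : ∀ i θ, c.1.2 i = some θ → w ∈ (slotProv Pm Pθ i).ann.F θ (v i)) :
    ∃ (c' : SlotCfg K Pm Pθ N) (kept : Option (Option (Fin N)) → Prop),
      SlotStep K Pm Pθ N c c' kept ∧ ∃ w' ∈ vT c'.1.1, ∀ i θ', c'.1.2 i = some θ' →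
        (kept (some i) → w' ∈ v i θ') ∧ (¬ kept (some i) → w' ∈ (slotProv Pm Pθ i).ann.y θ') := by
  classical
  obtain ⟨th, U, hth, hU, hUv, hUy, hins⟩ := slot_insert hN hθ hok hqθ c v hw
  have hsel : ∀ i : Option (Fin N), ∃ (τ : D.Q → D.T)
      (Mv : A → Set ((D.Q → D.Q) × (slotProv Pm Pθ i).Θ)), ∀ θ, th i = some θ →
      (∀ r ∈ barI (slotProv Pm Pθ i).int qin ((slotProv Pm Pθ i).con θ) (D.flag τ),
        D.src (τ r) = r ∧ ∀ l, some l ∈ D.lit (τ r) → w ∈ Lv l) ∧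
      (¬ (slotProv Pm Pθ i).int → ∀ r ∈ (slotProv Pm Pθ i).con θ, r ∈ D.flag τ → w ∈ Vx) ∧
      (∀ a, ∀ z ∈ Mv a, (slotProv Pm Pθ i).ok z.2 ∧
        (slotProv Pm Pθ i).Step θ (D.flag τ, z.1) z.2 ∧
        ∀ r ∈ barI (slotProv Pm Pθ i).int qin ((slotProv Pm Pθ i).con θ) (D.flag τ),
          z.1 r ∈ D.suc (τ r) a ∧ z.1 r ∈ (slotProv Pm Pθ i).con z.2) ∧
      (∀ a : A, ∀ w' ∈ M.R a w, ∃ z ∈ Mv a, w' ∈ U i z.2) ∧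
      (∀ a : A, ∀ r ∈ barI (slotProv Pm Pθ i).int qin ((slotProv Pm Pθ i).con θ) (D.flag τ),
        ∀ u ∈ D.suc (τ r) a, ∃ z ∈ Mv a, z.1 r = u ∧ ∃ w' ∈ M.R a w, w' ∈ U i z.2) := by
    intro i
    rcases h : th i with _ | θ
    · exact ⟨fun _ => t₀, fun _ => ∅, fun θ h => by cases h⟩
    · obtain ⟨τ, Mv, hτ⟩ := (slotProv Pm Pθ i).unf θ (U i) w (hU i θ h).1 (hU i θ h).2
      refine ⟨τ, Mv, fun θ' h' => ?_⟩
      obtain rfl := Option.some_injective _ h'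
      exact hτ
  choose τ Mv hsel using hsel
  let Nn : Option (Fin N) → Set D.Q := fun i => {r | ∃ θ, th i = some θ ∧
    r ∈ barI (slotProv Pm Pθ i).int qin ((slotProv Pm Pθ i).con θ) (D.flag (τ i))}
  have hpos : ∀ r, ∃ i, (∃ i, r ∈ Nn i) → r ∈ Nn i ∧ ∀ j, r ∈ Nn j → slotKey i ≤ slotKey j := by
    intro r
    by_cases h : ∃ i, r ∈ Nn i
    · obtain ⟨i, hi⟩ := exists_min_key slotKey h
      exact ⟨i, fun _ => hi⟩
    · exact ⟨none, fun h' => absurd h' h⟩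
  choose pos hpos using hpos
  let τs : D.Q → D.T := fun r => τ (pos r) r
  have hjump : ∀ r ∈ c.1.1.1, r ∈ D.flag τs →
      ((slotProv Pm Pθ (pos r)).int → qin ∈ Nn (pos r)) ∧
      (¬ (slotProv Pm Pθ (pos r)).int → ∃ j : Fin N, qin ∈ Nn (some j)) := by
    intro r hr hf
    obtain ⟨i, θ, h1, h2⟩ := c.2.cover r hr
    obtain ⟨⟨θ', h3, h4⟩, -⟩ := hpos r ⟨i, θ, hth i θ h1, Or.inl h2⟩
    have hrq : r ≠ qin := by
      rintro rfl
      exact hq _ ((hsel _ θ' h3).1 _ h4).1 hf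
    rcases h4 with h4 | ⟨-, h4, -⟩
    · refine ⟨fun hi => ⟨θ', h3, Or.inr ⟨hi, rfl, r, h4, hf⟩⟩, fun hi => ?_⟩
      obtain ⟨j, θ'', h5, h6⟩ := hins ((hsel _ θ' h3).2.1 hi r h4 hf)
      exact ⟨j, θ'', h5, Or.inl h6⟩
    · exact absurd h4 hrq
  have hbar : ∀ r ∈ D.bar qin c.1.1.1 (D.flag τs), r ∈ Nn (pos r) := by
    rintro r (hr | ⟨rfl, r', hr', hf⟩)
    · obtain ⟨i, θ, h1, h2⟩ := c.2.cover r hr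
      exact (hpos r ⟨i, θ, hth i θ h1, Or.inl h2⟩).1
    · by_cases hi : (slotProv Pm Pθ (pos r')).int
      · exact (hpos _ ⟨_, (hjump r' hr' hf).1 hi⟩).1
      · obtain ⟨j, hj⟩ := (hjump r' hr' hf).2 hi
        exact (hpos _ ⟨_, hj⟩).1
  have hinh : ∀ i : Option (Fin N), Nonempty (slotProv Pm Pθ i).Θ := by
    rintro (_ | i)
    exacts [⟨θm⟩, ⟨θ₀⟩]
  let JZ : A → M.W → Set (∀ i : Option (Fin N), (D.Q → D.Q) × (slotProv Pm Pθ i).Θ) :=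
    fun a w' => {z | ∀ i θ, th i = some θ → z i ∈ Mv i a ∧ w' ∈ U i (z i).2}
  have hJ : ∀ a : A, ∀ w' ∈ M.R a w, ∃ z, z ∈ JZ a w' := by
    intro a w' hw'
    have : ∀ i : Option (Fin N), ∃ z : (D.Q → D.Q) × (slotProv Pm Pθ i).Θ,
        ∀ θ, th i = some θ → z ∈ Mv i a ∧ w' ∈ U i z.2 := by
      intro i
      rcases h : th i with _ | θ
      · exact ⟨(id, (hinh i).some), fun θ h => by cases h⟩
      · obtain ⟨z, hz, hz'⟩ := (hsel i θ h).2.2.2.1 a w' hw'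
        exact ⟨z, fun _ _ => ⟨hz, hz'⟩⟩
    choose z hz using this
    exact ⟨z, hz⟩
  let ζ : (∀ i : Option (Fin N), (D.Q → D.Q) × (slotProv Pm Pθ i).Θ) → D.Q → D.Q :=
    fun z r => (z (pos r)).1 r
  let x : FT D qin K :=
    { e := c.1.1
      τ := τs
      Z := fun a => {s | ∃ w' ∈ M.R a w, ∃ z ∈ JZ a w', s = ζ z}
      src := fun r hr => by
        obtain ⟨θ, h1, h2⟩ := hbar r hr
        exact ((hsel _ θ h1).1 r h2).1
      sub := by
        rintro a _ ⟨w', hw', z, hz, rfl⟩ r hr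
        obtain ⟨θ, h1, h2⟩ := hbar r hr
        exact ((hsel _ θ h1).2.2.1 a _ (hz _ θ h1).1).2.2 r h2 |>.1
      hit := by
        intro a r hr u hu
        obtain ⟨θ, h1, h2⟩ := hbar r hr
        obtain ⟨z₁, hz₁, rfl, w', hw', hw''⟩ := (hsel _ θ h1).2.2.2.2 a r h2 u hu
        obtain ⟨z, hz⟩ := hJ a w' hw'
        refine ⟨_, ⟨w', hw', update z (pos r) z₁, ?_, rfl⟩, ?_⟩
        · intro i θ' h'
          by_cases hi : i = pos r
          · subst hi
            rw [update_self]
            exact ⟨hz₁, hw''⟩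
          · rw [update_of_ne hi]
            exact hz i θ' h'
        · simp [ζ] }
  have hnab : w ∉ nab M ((D.fixAut qin K).suc x) fun q => (vT q)ᶜ := by
    refine fun h => hwT ⟨x, rfl, ?_, h⟩
    rintro l ⟨r, hr, hl⟩
    obtain ⟨θ, h1, h2⟩ := hbar r hr
    exact ((hsel _ θ h1).1 r h2).2 l hl
  obtain ⟨a, w', z, hz, hw'⟩ : ∃ a w' z, z ∈ JZ a w' ∧
      w' ∈ vT (D.nx qin K c.1.1 (D.flag τs, ζ z)) := by
    obtain ⟨a, ⟨_, ⟨_, ⟨w', hw', z, hz, rfl⟩, rfl⟩, h⟩ | ⟨w', hw', h⟩⟩ := not_nab hnab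
    · exact ⟨a, w', z, hz, h w' hw'⟩
    · obtain ⟨z, hz⟩ := hJ a w' hw'
      exact ⟨a, w', z, hz, h _ ⟨_, ⟨w', hw', z, hz, rfl⟩, rfl⟩⟩
  let dup : Option (Fin N) → Prop := fun i => ∃ j : Option (Fin N), slotKey j < slotKey i ∧
    (th j).isSome ∧ slotId j (z j).2 = slotId i (z i).2
  let k' : ∀ i : Option (Fin N), Option (slotProv Pm Pθ i).Θ := fun i =>
    if (th i).isSome ∧ ¬ dup i then some (z i).2 else none
  have hk' : ∀ i θ', k' i = some θ' → (th i).isSome ∧ ¬ dup i ∧ θ' = (z i).2 := by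
    intro i θ' h
    dsimp only [k'] at h
    split_ifs at h with h1
    exact ⟨h1.1, h1.2, (Option.some_injective _ h).symm⟩
  have hcov : ∀ i θ, th i = some θ → ∀ r ∈ barI (slotProv Pm Pθ i).int qin
      ((slotProv Pm Pθ i).con θ) (D.flag (τ i)), ∃ j θ', slotKey j ≤ slotKey i ∧ k' j = some θ' ∧
        (z i).1 r ∈ (slotProv Pm Pθ j).con θ' := by
    intro i θ hi r hr
    obtain ⟨j, ⟨h1, h2⟩, h3⟩ := exists_min_key slotKey
      (p := fun j : Option (Fin N) => (th j).isSome ∧ slotId j (z j).2 = slotId i (z i).2)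
      ⟨i, by rw [hi]; rfl, rfl⟩
    have hnd : ¬ dup j := by
      rintro ⟨j', h4, h5, h6⟩
      exact absurd (h3 j' ⟨h5, h6.trans h2⟩) (not_le.2 h4)
    refine ⟨j, (z j).2, h3 i ⟨by rw [hi]; rfl, rfl⟩, if_pos ⟨h1, hnd⟩, ?_⟩
    rw [slotId_con _ _ _ _ h2]
    exact (((hsel i θ hi).2.2.1 a _ (hz i θ hi).1).2.2 r hr).2
  have hinv : SlotInv K Pm Pθ N (D.nx qin K c.1.1 (D.flag τs, ζ z), k') := by
    refine ⟨?_, ?_, ?_⟩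
    · rintro _ ⟨r, hr, rfl⟩
      obtain ⟨θ, h1, h2⟩ := hbar r hr
      obtain ⟨j, θ', -, h3, h4⟩ := hcov _ θ h1 r h2
      exact ⟨j, θ', h3, h4⟩
    · intro i θ' h
      obtain ⟨h1, -, rfl⟩ := hk' i θ' h
      obtain ⟨θ, h1⟩ := Option.isSome_iff_exists.1 h1
      exact ((hsel i θ h1).2.2.1 a _ (hz i θ h1).1).1
    · intro i j θ hi hj
      obtain ⟨h1, h2, h3⟩ := hk' _ _ hi
      obtain ⟨h4, h5, h6⟩ := hk' _ _ hj
      rcases lt_trichotomy i j with h | h | h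
      · exact absurd ⟨some i, h, h1, congrArg Sum.inr (h3.symm.trans h6)⟩ h5
      · exact h
      · exact absurd ⟨some j, h, h4, congrArg Sum.inr (h6.symm.trans h3)⟩ h2
  refine ⟨⟨_, hinv⟩, fun o => o.elim True fun i => (c.1.2 i).isSome ∧ (k' i).isSome,
    ⟨D.flag τs, ζ z, fun i => (D.flag (τ i), (z i).1), pos, rfl, trivial, ?_, ?_, ?_, ?_, ?_⟩,
    w', hw', ?_⟩
  · intro r j θ h1 h2
    have : r ∈ Nn j := ⟨θ, hth j θ h1, Or.inl h2⟩
    exact (hpos r ⟨j, this⟩).2 j this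
  · exact fun r => ⟨Iff.rfl, rfl⟩
  · intro i θ θ' h1 h2
    obtain ⟨h3, -, rfl⟩ := hk' _ _ h2
    have h4 := hth i θ h1
    refine ⟨((hsel i θ h4).2.2.1 a _ (hz i θ h4).1).2.1, ?_⟩
    exact ⟨by rw [h1]; rfl, Option.isSome_iff_exists.2 ⟨_, h2⟩⟩
  · intro r hr
    obtain ⟨θ, h1, h2⟩ := hbar r hr
    exact hcov _ θ h1 r h2
  · intro r hr hf
    refine ⟨fun hi => ?_, fun hi => ?_⟩
    · have := (hjump r hr hf).1 hi
      exact (hpos _ ⟨_, this⟩).2 _ this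
    · obtain ⟨j, hj⟩ := (hjump r hr hf).2 hi
      have := (hpos _ ⟨_, hj⟩).2 _ hj
      intro h
      rw [h] at this
      exact absurd this (not_le.2 j.2)
  · intro i θ' h
    obtain ⟨h1, -, rfl⟩ := hk' _ _ h
    obtain ⟨θ, h1⟩ := Option.isSome_iff_exists.1 h1
    have h2 := (hz i θ h1).2
    refine ⟨fun hk => ?_, fun hk => ?_⟩
    · rwa [hUv i hk.1] at h2
    · rwa [hUy i ?_] at h2
      by_contra hne
      exact hk ⟨Option.isSome_iff_ne_none.2 hne, Option.isSome_iff_exists.2 ⟨_, h⟩⟩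

theorem slot_trace (hint : Pθ.int ∨ Even ctop) (hpri : ∀ q, D.pri q ≤ ctop)
    {c : ℕ → SlotCfg K Pm Pθ N} {kept : ℕ → Option (Option (Fin N)) → Prop}
    (hS : ∀ t, SlotStep K Pm Pθ N (c t) (c (t + 1)) (kept t))
    {qs : D.Q} (h0 : (c 0).1.1 = ({qs}, K.s₀))
    (hK : ∀ w, OddDom (fun t => K.pri (K.run w t)) → BadTrace (D.stp qin ctop) qs w)
    (hodd : OddDom fun t => K.pri (c t).1.1.2) :
    ∃ i, (∀ᶠ t in atTop, kept t (some i)) ∧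
      OddDom (fun t => ((c t).1.2 i).elim 0 (slotProv Pm Pθ i).ann.pri) := by
  choose f s β pos he hkT hmin hag hstep hcov hjmp using hS
  let wd : ℕ → Set D.Q × (D.Q → D.Q) := fun t => (f t, s t)
  have hrun : ∀ t, (c t).1.1.2 = K.run wd t := by
    intro t
    induction t with
    | zero => rw [h0]; rfl
    | succ t ih => rw [he, nx, ih]; rfl
  obtain ⟨q, cc, hq0, hst, hcc⟩ := hK wd (hodd.congr fun t => by rw [hrun])
  have hr : ∀ t, ∃ r, q (t + 1) = s t r ∧
      ((r = q t ∧ cc t = D.pri (q t)) ∨ (r = qin ∧ q t ∈ f t ∧ cc t = ctop)) := by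
    intro t
    rcases hst t with ⟨h1, h2⟩ | ⟨h1, h2, h3⟩
    · exact ⟨q t, h2, Or.inl ⟨rfl, h1⟩⟩
    · exact ⟨qin, h3, Or.inr ⟨rfl, h1, h2⟩⟩
  choose r hrq hrc using hr
  have hbar : ∀ t, q t ∈ (c t).1.1.1 → r t ∈ D.bar qin (c t).1.1.1 (f t) := by
    intro t ht
    rcases hrc t with ⟨h, -⟩ | ⟨h, h', -⟩
    · rw [h]; exact Or.inl ht
    · exact Or.inr ⟨h, q t, ht, h'⟩
  have hmem : ∀ t, q t ∈ (c t).1.1.1 := by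
    intro t
    induction t with
    | zero => rw [h0, hq0]; rfl
    | succ t ih =>
      rw [he, hrq]
      exact image_mem_nx (hbar t ih)
  choose j θ' hj hj1 hj2 using fun t => hcov t (r t) (hbar t (hmem t))
  have hle1 : ∀ t, slotKey (pos (t + 1) (q (t + 1))) ≤ slotKey (j t) := fun t =>
    hmin (t + 1) _ _ _ (hj1 t) (by rw [hrq]; exact hj2 t)
  -- eventually, no jump leaves its slot upwards
  have hev : ∀ᶠ t in atTop, slotKey (pos t (r t)) ≤ slotKey (pos t (q t)) ∧
      (¬ (slotProv Pm Pθ (pos t (q t))).int → slotKey (pos t (r t)) = slotKey (pos t (q t)) →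
        r t = q t ∧ cc t = D.pri (q t)) := by
    rcases hint with hint | hint
    · refine Eventually.of_forall fun t => ?_
      rcases hrc t with ⟨h, h'⟩ | ⟨h, h', -⟩
      · exact ⟨by rw [h], fun _ _ => ⟨h, h'⟩⟩
      · rw [h]
        have := hjmp t (q t) (hmem t) h'
        by_cases hi : (slotProv Pm Pθ (pos t (q t))).int
        · exact ⟨this.1 hi, fun h => absurd hi h⟩
        · have hn : pos t (q t) = none := by
            rcases hp : pos t (q t) with _ | i
            · rfl
            · rw [hp] at hi
              exact absurd hint hi
          rw [hn]
          refine ⟨slotKey_le _, fun _ h => absurd (slotKey_injective h) (this.2 hi)⟩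
    · obtain ⟨p, hp, hfr, hp'⟩ := hcc
      have hlt : p < ctop := by
        obtain ⟨t, ht⟩ := hfr.exists
        refine lt_of_le_of_ne (ht ▸ ?_) ?_
        · rcases hrc t with ⟨-, h⟩ | ⟨-, -, h⟩
          · rw [h]; exact hpri _
          · exact h.le
        · rintro rfl
          exact (Nat.not_odd_iff_even.2 hint) hp
      filter_upwards [hp'] with t ht
      rcases hrc t with ⟨h, h'⟩ | ⟨-, -, h⟩
      · exact ⟨by rw [h], fun _ _ => ⟨h, h'⟩⟩
      · omega
  have hanti : ∀ᶠ t in atTop, slotKey (pos (t + 1) (q (t + 1))) ≤ slotKey (pos t (q t)) :=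
    hev.mono fun t ht => (hle1 t).trans ((hj t).trans ht.1)
  obtain ⟨T₁, hT₁⟩ := eventually_atTop.1 hev
  obtain ⟨T₂, -, hT₂⟩ := eventually_const_of_antitone
    (f := fun t => slotKey (pos t (q t))) hanti
  let T := max T₁ T₂
  let i := pos T (q T)
  have hkey : ∀ t ≥ T, slotKey (pos t (q t)) = slotKey i := fun t ht =>
    (hT₂ t ((le_max_right _ _).trans ht)).trans (hT₂ T (le_max_right _ _)).symm
  have hpq : ∀ t ≥ T, pos t (q t) = i := fun t ht => slotKey_injective (hkey t ht)
  have hpr : ∀ t ≥ T, pos t (r t) = i ∧ j t = i := by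
    intro t ht
    have h1 := (hT₁ t ((le_max_left _ _).trans ht)).1
    have h2 := hj t
    have h3 := hle1 t
    rw [hkey (t + 1) (by omega)] at h3
    rw [hkey t ht] at h1
    exact ⟨slotKey_injective (by omega), slotKey_injective (by omega)⟩
  have hpres : ∀ t ≥ T, ∃ θ, (c (t + 1)).1.2 i = some θ ∧
      q (t + 1) ∈ (slotProv Pm Pθ i).con θ := by
    intro t ht
    obtain ⟨-, h2⟩ := hpr t ht
    have h3 := hj1 t
    have h4 := hj2 t
    rw [← hrq] at h4
    revert h3 h4
    generalize θ' t = x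
    revert x
    rw [h2]
    exact fun x h3 h4 => ⟨x, h3, h4⟩
  have : Nonempty (slotProv Pm Pθ i).Θ := ⟨(hpres T le_rfl).choose⟩
  choose! ϑ hϑ hϑq using hpres
  refine ⟨i, ?_, ?_⟩
  · refine eventually_atTop.2 ⟨T + 1, fun t ht => ?_⟩
    obtain ⟨t, rfl⟩ : ∃ s, t = s + 1 := ⟨t - 1, by omega⟩
    exact (hstep (t + 1) i _ _ (hϑ t (by omega)) (hϑ (t + 1) (by omega))).2
  · rw [← oddDom_add (T + 1)]
    have key := (slotProv Pm Pθ i).acc (fun t => ϑ (t + T)) (fun t => β (t + (T + 1)) i)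
      (fun t => q (t + (T + 1))) (fun t => cc (t + (T + 1)))
      (fun t => (c (t + T + 1)).2.ok i _ (hϑ (t + T) (by omega)))
      (fun t => by
        have := (hstep (t + T + 1) i _ _ (hϑ (t + T) (by omega)) (hϑ (t + T + 1) (by omega))).1
        rwa [show t + 1 + T = t + T + 1 by omega])
      (fun t => hϑq (t + T) (by omega))
      (fun t => by
        have ht : t + (T + 1) ≥ T := by omega
        generalize hs : t + (T + 1) = u at ht ⊢
        rw [show t + 1 + (T + 1) = u + 1 by omega, hrq, (hag u _).2, (hpr u ht).1]
        rcases hrc u with ⟨h1, h2⟩ | ⟨h1, h2, h3⟩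
        · exact Or.inl ⟨h2, by rw [h1]⟩
        · by_cases hi : (slotProv Pm Pθ i).int
          · refine Or.inr ⟨hi, ?_, h3, by rw [h1]⟩
            have := (hag u (q u)).1.1 h2
            rwa [hpq u ht] at this
          · have := (hT₁ u ((le_max_left _ _).trans ht)).2 (by rwa [hpq u ht])
              (by rw [(hpr u ht).1, hpq u ht])
            exact Or.inl ⟨this.2, by rw [this.1]⟩)
      ((oddDom_add (T + 1)).2 hcc)
    refine key.congr fun t => ?_
    have : (c (t + (T + 1))).1.2 i = some (ϑ (t + T)) := hϑ (t + T) (by omega)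
    rw [this]
    rfl

theorem le_fixAut (hM : MF M) (hL : ∀ l, Lv l ∈ M.Adm) (hint : Pθ.int ∨ Even ctop)
    (hpri : ∀ q, D.pri q ≤ ctop) (hq : ∀ t, D.src t = qin → none ∉ D.lit t) {qs : D.Q}
    (hK : ∀ w, OddDom (fun t => K.pri (K.run w t)) → BadTrace (D.stp qin ctop) qs w)
    {θ₀ : Pθ.Θ} (hθ : Vx ⊆ Pθ.ann.y θ₀) (hok : Pθ.ok θ₀) (hqθ : qin ∈ Pθ.con θ₀)
    {θm : Pm.Θ} (hokm : Pm.ok θm) (hqm : qs ∈ Pm.con θm) :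
    Pm.ann.y θm ⊆ (D.fixAut qin K).val M Lv ({qs}, K.s₀) := by
  intro w hw
  by_contra hw'
  let Φ := D.fixAut qin K
  obtain ⟨τ₀, -⟩ := Pm.unf θm Pm.ann.y w hokm (by rw [Pm.ann.y_unf]; exact hw)
  let N := Nat.card Pθ.Θ
  let X : Arena M (Option (Option (Fin N))) (SlotCfg K Pm Pθ N) :=
    { Q := fun o => Option.rec (Set D.Q × K.St) (fun i => (slotProv Pm Pθ i).Θ) o
      A := fun o => Option.rec (Φ.coann hM hL) (fun i => (slotProv Pm Pθ i).ann) o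
      ent := fun c o => Option.rec (some c.1.1) (fun i => c.1.2 i) o
      pf := fun _ _ _ => univ
      K := fun _ => univ }
  have fin : ∀ i, Finite (X.Q i) := by
    rintro (_ | i)
    · exact (inferInstance : Finite (Set D.Q × K.St))
    · exact (inferInstance : Finite (slotProv Pm Pθ i).Θ)
  have hX : X.Good := ⟨fun _ _ _ _ _ => le_rfl, fun _ _ _ _ => hM.univ_mem, fun _ => hM.univ_mem⟩
  have hSt : X.HStep (SlotStep K Pm Pθ N) := by
    intro c v hv hy w _ hw
    obtain ⟨c', kept, hS, w', hw'T, hw'⟩ := slot_round rfl hθ hok hqθ θm (τ₀ qin) hq c (v none)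
      (fun i => v (some i)) (w := w) (hw none) (fun i θ hi => by
        have := hw (some i)
        dsimp only [Arena.unf] at this
        rw [show X.ent c (some i) = some θ from hi] at this
        exact this)
    refine ⟨c', kept, hS, w', trivial, ?_⟩
    obtain ⟨_, _, _, _, -, hkn, -⟩ := id hS
    rintro (_ | i)
    · exact ⟨fun _ => hw'T, fun h => absurd hkn h⟩
    · rcases hi : c'.1.2 i with _ | θ'
      · have : X.ent c' (some i) = none := hi
        dsimp only [Arena.land]
        rw [this]
        exact ⟨fun _ => trivial, fun _ => trivial⟩
      · have : X.ent c' (some i) = some θ' := hi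
        dsimp only [Arena.land]
        rw [this]
        exact hw' i θ' hi
  let k₀ : ∀ i : Option (Fin N), Option (slotProv Pm Pθ i).Θ := fun o =>
    Option.rec (some θm) (fun _ => none) o
  have hinv : SlotInv K Pm Pθ N (({qs}, K.s₀), k₀) := by
    refine ⟨?_, ?_, ?_⟩
    · rintro r rfl
      exact ⟨none, θm, rfl, hqm⟩
    · rintro (_ | i) θ h
      · obtain rfl := Option.some_injective _ h
        exact hokm
      · cases h
    · intro i j θ h
      cases h
  have hco : w ∈ (Φ.coann hM hL).y (({qs}, K.s₀) : Set D.Q × K.St) := by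
    rw [Φ.coann_y hM hL]
    exact hw'
  obtain ⟨c, kept, hc0, hst, hod⟩ := @Arena.exists_path _ _ M _ _ X _ _ fin hM hX _ hSt ⟨_, hinv⟩
    ⟨w, trivial, mem_iInter.2 (by
      rintro (_ | _ | i)
      · exact hco
      · exact hw
      · trivial)⟩
  have hT : OddDom fun t => K.pri (c t).1.1.2 := by
    by_contra hcon
    refine hod none (Eventually.of_forall fun t => ?_) (((oddDom_succ_iff ?_).2 hcon).congr fun t => rfl)
    · obtain ⟨_, _, _, _, -, h, -⟩ := hst t
      exact h
    · obtain ⟨B, hB⟩ := (finite_range K.pri).bddAbove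
      exact ⟨B, fun t => hB (mem_range_self _)⟩
  obtain ⟨i, hi, ho⟩ := slot_trace hint hpri hst (by rw [hc0]) hK hT
  exact hod (some i) hi (ho.congr fun t => rfl)

end Aut
end Upper

theorem DPA.run_congr {β : Type} (K : DPA β) {w w' : ℕ → β} {n : ℕ} (h : ∀ i < n, w i = w' i) :
    K.run w n = K.run w' n := by
  induction n with
  | zero => rfl
  | succ n ih =>
    simp only [DPA.run]
    rw [h n n.lt_succ_self, ih fun i hi => h i (hi.trans n.lt_succ_self)]

section Upper
variable {𝓁 : Type} {A : Finset Act} {D : Aut (Option 𝓁) A} {qin : D.Q}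
  {M : Frame Act Atom} {Lv : 𝓁 → Set M.W}
  {Vx : Set M.W} {ctop : ℕ} {K : DPA (Set D.Q × (D.Q → D.Q))}

namespace Aut

variable (D qin ctop) in
/-- A single state of `D`. -/
noncomputable def threadProv (hM : MF M) (hL : ∀ l, Lv l ∈ M.Adm) (hVx : Vx ∈ M.Adm) :
    Prov D qin M Lv Vx ctop where
  Θ := D.Q
  fin := inferInstance
  ann := D.ann hM (optCons_adm hVx hL)
  con θ := {θ}
  int := False
  ok _ := True
  Step θ b θ' := θ' = b.2 θ
  unf := by
    rintro _ v w - ⟨t, rfl, hl, hn⟩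
    have hbar : ∀ r ∈ barI False qin {D.src t} (D.flag fun _ => t), r = D.src t := by
      rintro r (h | ⟨h, -⟩)
      exacts [h, h.elim]
    refine ⟨fun _ => t, fun a => {z | ∃ u ∈ D.suc t a, z = (fun _ => u, u)}, ?_, ?_, ?_, ?_, ?_⟩
    · intro r hr
      exact ⟨(hbar r hr).symm, fun l hl' => hl (some l) hl'⟩
    · intro _ r _ hf
      exact hl none hf
    · rintro a _ ⟨u, hu, rfl⟩
      exact ⟨trivial, rfl, fun r _ => ⟨hu, rfl⟩⟩
    · intro a w' hw'
      obtain ⟨u, hu, h⟩ := (hn a).2 w' hw'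
      exact ⟨_, ⟨u, hu, rfl⟩, h⟩
    · intro a r _ u hu
      obtain ⟨w', hw', h⟩ := (hn a).1 u hu
      exact ⟨_, ⟨u, hu, rfl⟩, rfl, w', hw', h⟩
  acc := by
    intro θ β q c _ hs hq hc ho
    refine ho.congr fun t => ?_
    rcases hc t with ⟨h, -⟩ | ⟨h, -⟩
    · rw [h, show q t = θ t from hq t]
      rfl
    · exact h.elim

variable (D qin ctop K) in
/-- The states of the fixpoint automaton that are reachable by traces from `qin`. -/
def Reach (e : Set D.Q × K.St) : Prop :=
  ∃ (n : ℕ) (w : ℕ → Set D.Q × (D.Q → D.Q)), K.run w n = e.2 ∧ ∀ q ∈ e.1, ∃ (p : ℕ → D.Q) (c : ℕ → ℕ),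
    p 0 = qin ∧ p n = q ∧ ∀ i < n, D.stp qin ctop (w i) (p i) (c i) (p (i + 1))

theorem Reach.nx {e : Set D.Q × K.St} (h : Reach D qin ctop K e) (b : Set D.Q × (D.Q → D.Q)) :
    Reach D qin ctop K (D.nx qin K e b) := by
  classical
  obtain ⟨n, w, hw, ht⟩ := h
  refine ⟨n + 1, update w n b, ?_, ?_⟩
  · simp only [DPA.run, update_self, Aut.nx]
    rw [← hw, K.run_congr fun i hi => update_of_ne hi.ne b w]
  · have key : ∀ r ∈ e.1, ∀ c' r', D.stp qin ctop b r c' r' → ∃ (p : ℕ → D.Q) (c : ℕ → ℕ),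
        p 0 = qin ∧ p (n + 1) = r' ∧
        ∀ i < n + 1, D.stp qin ctop (update w n b i) (p i) (c i) (p (i + 1)) := by
      intro r hr c' r' hstp
      obtain ⟨p, c, h0, h1, h2⟩ := ht r hr
      refine ⟨update p (n + 1) r', update c n c', ?_, ?_, ?_⟩
      · rw [update_of_ne (by omega), h0]
      · rw [update_self]
      · intro i hi
        rcases Nat.lt_succ_iff_lt_or_eq.1 hi with hi | rfl
        · rw [update_of_ne hi.ne, update_of_ne hi.ne, update_of_ne (by omega),
            update_of_ne (by omega)]
          exact h2 i hi
        · rw [update_self, update_self, update_self, update_of_ne (by omega), h1]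
          exact hstp
    rintro _ ⟨r, hr | ⟨rfl, r', hr', hf⟩, rfl⟩
    · exact key r hr _ _ (Or.inl ⟨rfl, rfl⟩)
    · exact key r' hr' _ _ (Or.inr ⟨hf, rfl, rfl⟩)

/-- The states of the fixpoint automaton itself. -/
noncomputable def fixProv (hM : MF M) (hL : ∀ l, Lv l ∈ M.Adm) (Vx : Set M.W)
    (hK : ∀ w, BadTrace (D.stp qin ctop) qin w → OddDom (fun t => K.pri (K.run w t))) :
    Prov D qin M Lv Vx ctop where
  Θ := Set D.Q × K.St
  fin := inferInstance
  ann := (D.fixAut qin K).ann hM hL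
  con e := e.1
  int := True
  ok := Reach D qin ctop K
  Step e b e' := e' = D.nx qin K e b
  unf := by
    rintro _ v w hok ⟨x, rfl, hl, hn⟩
    have hbar : ∀ r ∈ barI True qin x.e.1 (D.flag x.τ), r ∈ D.bar qin x.e.1 (D.flag x.τ) := by
      rintro r (h | ⟨-, h⟩)
      exacts [Or.inl h, Or.inr h]
    refine ⟨x.τ, fun a => {z | z.1 ∈ x.Z a ∧ z.2 = D.nx qin K x.e (D.flag x.τ, z.1)},
      ?_, ?_, ?_, ?_, ?_⟩
    · intro r hr
      exact ⟨x.src r (hbar r hr), fun l hl' => hl l ⟨r, hbar r hr, hl'⟩⟩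
    · exact fun h => absurd trivial h
    · rintro a ⟨s, z⟩ ⟨hs, hz⟩
      obtain rfl : z = D.nx qin K x.e (D.flag x.τ, s) := hz
      exact ⟨Reach.nx hok _, rfl, fun r hr => ⟨x.sub a s hs r (hbar r hr),
        image_mem_nx (hbar r hr)⟩⟩
    · intro a w' hw'
      obtain ⟨_, ⟨s, hs, rfl⟩, h⟩ := (hn a).2 w' hw'
      exact ⟨(s, _), ⟨hs, rfl⟩, h⟩
    · intro a r hr u hu
      obtain ⟨s, hs, rfl⟩ := x.hit a r (hbar r hr) u hu
      obtain ⟨w', hw', h⟩ := (hn a).1 _ ⟨s, hs, rfl⟩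
      exact ⟨(s, _), ⟨hs, rfl⟩, rfl, w', hw', h⟩
  acc := by
    intro θ β q c hok hs hq hc ho
    obtain ⟨n, w, hw, ht⟩ := hok 0
    obtain ⟨p, c', h0, h1, h2⟩ := ht _ (hq 0)
    let w' : ℕ → Set D.Q × (D.Q → D.Q) := fun i => if i < n then w i else β (i - n)
    have hw' : ∀ t, w' (t + n) = β t := fun t => by
      simp only [w', if_neg (show ¬ t + n < n by omega), Nat.add_sub_cancel]
    have hrun : ∀ t, K.run w' (t + n) = (θ t).2 := by
      intro t
      induction t with
      | zero =>
        rw [Nat.zero_add, ← hw]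
        exact K.run_congr fun i hi => if_pos hi
      | succ t ih =>
        rw [show t + 1 + n = t + n + 1 by omega, hs t]
        simp only [DPA.run, nx]
        rw [ih, hw']
    have : OddDom (fun t => K.pri (K.run w' t)) := by
      refine hK w' ⟨fun i => if i < n then p i else q (i - n),
        fun i => if i < n then c' i else c (i - n), ?_, ?_, ?_⟩
      · rcases Nat.eq_zero_or_pos n with rfl | hn
        · simpa using h1.symm.trans h0
        · simpa only [if_pos hn] using h0
      · intro i
        rcases lt_or_ge i n with hi | hi
        · have e : (if i + 1 < n then p (i + 1) else q (i + 1 - n)) = p (i + 1) := by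
            split_ifs with h
            · rfl
            · obtain rfl : n = i + 1 := by omega
              rw [Nat.sub_self, h1]
          simp only [w', if_pos hi, e]
          exact h2 i hi
        · obtain ⟨t, rfl⟩ : ∃ t, i = t + n := ⟨i - n, by omega⟩
          rw [hw']
          simp only [if_neg (show ¬ t + n < n by omega), if_neg (show ¬ t + n + 1 < n by omega),
            Nat.add_sub_cancel, show t + n + 1 - n = t + 1 by omega]
          rcases hc t with h | ⟨-, h, h', h''⟩
          · exact Or.inl h
          · exact Or.inr ⟨h, h', h''⟩
      · rw [← oddDom_add n]
        refine ho.congr fun t => ?_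
        simp only [if_neg (show ¬ t + n < n by omega), Nat.add_sub_cancel]
    refine ((oddDom_add n).2 this).congr fun t => ?_
    rw [hrun]
    rfl

theorem reach_init : Reach D qin ctop K ({qin}, K.s₀) :=
  ⟨0, fun _ => (∅, id), rfl, fun q hq => ⟨fun _ => qin, fun _ => 0, rfl, (Eq.symm hq), by simp⟩⟩

theorem stp_le (hpri : ∀ q, D.pri q ≤ ctop) {b : Set D.Q × (D.Q → D.Q)} {q : D.Q} {c : ℕ}
    {q' : D.Q} (h : D.stp qin ctop b q c q') : c ≤ ctop := by
  rcases h with ⟨rfl, -⟩ | ⟨-, rfl, -⟩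
  exacts [hpri _, le_rfl]

variable (D) in
/-- Closure under fixpoints. -/
theorem exists_fixAut (hq : ∀ t, D.src t = qin → none ∉ D.lit t) (b : Bool) (qs : D.Q) :
    ∃ (Φ : Aut 𝓁 A) (e : Φ.Q), (∀ (M : Frame Act Atom) (Lv : 𝓁 → Set M.W), MF M →
      (∀ l, Lv l ∈ M.Adm) → Φ.val M Lv e = D.val M (optCons (fixVal D qin M Lv b) Lv) qs) ∧
      ∀ x l, l ∈ Φ.lit x → ∃ t, some l ∈ D.lit t := by
  obtain ⟨ctop, hc⟩ := D.exists_isTop b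
  have hex := fun qs : D.Q => exists_dpa (β := Set D.Q × (D.Q → D.Q)) (stp := D.stp qin ctop)
    (fun _ _ _ _ => stp_le hc.1) qs
  choose K hK using hex
  refine ⟨D.fixAut qin (K qs), ({qs}, (K qs).s₀), fun M Lv hM hL => Subset.antisymm
    (fixAut_le hM hL hc hq fun w => (hK qs w).2) ?_, ?_⟩
  · cases b with
    | false =>
      have hev : Even ctop := by simpa using hc.2
      have hv := fixVal_adm (D := D) (qin := qin) hM hL false
      have := le_fixAut (Pm := threadProv D qin ctop hM hL hv)
        (Pθ := threadProv D qin ctop hM hL hv) (K := K qs) (qs := qs) hM hL (Or.inr hev) hc.1 hq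
        (fun w => (hK qs w).1) (θ₀ := qin) (θm := qs) (by
          change _ ⊆ (D.ann hM (optCons_adm hv hL)).y qin
          rw [D.ann_y hM (optCons_adm hv hL), fixVal_unfold hM hL]) trivial rfl trivial rfl
      change (D.ann hM (optCons_adm hv hL)).y qs ⊆ _ at this
      rwa [D.ann_y hM (optCons_adm hv hL)] at this
    | true =>
      let Vx := (D.fixAut qin (K qin)).val M Lv (({qin}, (K qin).s₀) : Set D.Q × (K qin).St)
      have hV : Vx ∈ M.Adm := Aut.val_adm _ hM hL _
      have key : ∀ q, D.val M (optCons Vx Lv) q ⊆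
          (D.fixAut qin (K q)).val M Lv (({q}, (K q).s₀) : Set D.Q × (K q).St) := by
        intro q
        have := le_fixAut (Pm := threadProv D qin ctop hM hL hV)
          (Pθ := fixProv (K := K qin) (ctop := ctop) hM hL Vx fun w => (hK qin w).2)
          (K := K q) (qs := q) hM hL (Or.inl trivial) hc.1 hq
          (fun w => (hK q w).1) (θ₀ := (({qin}, (K qin).s₀) : Set D.Q × (K qin).St)) (θm := q) (by
            change _ ⊆ ((D.fixAut qin (K qin)).ann hM hL).y (({qin}, (K qin).s₀) : Set D.Q × (K qin).St)
            rw [Aut.ann_y _ hM hL]) reach_init rfl trivial rfl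
        change (D.ann hM (optCons_adm hV hL)).y q ⊆ _ at this
        rwa [D.ann_y hM (optCons_adm hV hL)] at this
      have hfv : fixVal D qin M Lv true ⊆ Vx := by
        rw [fixVal]
        exact lfpA_subset hV (key qin)
      exact (val_mono_var hM hL (fixVal_adm hM hL true) hV hfv qs).trans (key qs)
  · rintro x l ⟨r, -, h⟩
    exact ⟨_, h⟩

end Aut
end Upper

namespace Aut
variable {L L' : Type} {A : Finset Act} {M : Frame Act Atom} {Lv : L → Set M.W}

/-- An embedding of automata preserves the accepted sets. -/
theorem val_embed (D : Aut L A) (E : Aut L' A) {Lv' : L' → Set M.W} (hM : MF M)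
    (hL : ∀ l, Lv l ∈ M.Adm) (hL' : ∀ l, Lv' l ∈ M.Adm) (j : D.Q → E.Q)
    (hpri : ∀ q, E.pri (j q) = D.pri q)
    (h₁ : ∀ t, ∃ t', E.src t' = j (D.src t) ∧ E.lits M Lv' t' = D.lits M Lv t ∧
      ∀ a, E.suc t' a = j '' D.suc t a)
    (h₂ : ∀ t' q, E.src t' = j q → ∃ t, D.src t = q ∧ E.lits M Lv' t' = D.lits M Lv t ∧
      ∀ a, E.suc t' a = j '' D.suc t a) (q : D.Q) :
    E.val M Lv' (j q) = D.val M Lv q := by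
  apply Subset.antisymm
  · refine E.val_le_of_sim D hM hL' hL (fun p q => p = j q) ?_ ?_ rfl
    · rintro _ q rfl
      exact hpri q
    · rintro _ q rfl t' ht'
      obtain ⟨t, ht, hl, hs⟩ := h₂ t' q ht'
      refine ⟨t, ht, hl.subset, fun a => ?_⟩
      rw [hs]
      exact ⟨fun s ⟨r, hr, e⟩ => ⟨r, hr, e.symm⟩, fun r hr => ⟨j r, ⟨r, hr, rfl⟩, rfl⟩⟩
  · refine D.val_le_of_sim E hM hL hL' (fun q p => p = j q) ?_ ?_ rfl
    · rintro q _ rfl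
      exact (hpri q).symm
    · rintro _ _ rfl t rfl
      obtain ⟨t', ht', hl, hs⟩ := h₁ t
      refine ⟨t', ht', hl.superset, fun a => ?_⟩
      rw [hs]
      exact ⟨fun r hr => ⟨j r, ⟨r, hr, rfl⟩, rfl⟩, fun s ⟨r, hr, e⟩ => ⟨r, hr, e.symm⟩⟩

/-- Relabelling of letters. -/
def map (D : Aut L A) (g : L → L') : Aut L' A where
  Q := D.Q
  T := D.T
  finQ := D.finQ
  finT := D.finT
  src := D.src
  lit t := g '' D.lit t
  lit_fin t := (D.lit_fin t).image g
  suc := D.suc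
  pri := D.pri

theorem val_map (D : Aut L A) (g : L → L') {Lv' : L' → Set M.W} (hM : MF M)
    (hL : ∀ l, Lv l ∈ M.Adm) (hL' : ∀ l, Lv' l ∈ M.Adm)
    (h : ∀ t, ∀ l ∈ D.lit t, Lv l = Lv' (g l)) (q : D.Q) :
    (D.map g).val M Lv' q = D.val M Lv q := by
  have hl : ∀ t, (D.map g).lits M Lv' t = D.lits M Lv t := by
    intro t
    ext w
    constructor
    · intro hw l hl
      rw [h t l hl]
      exact hw _ ⟨l, hl, rfl⟩
    · rintro hw _ ⟨l, hl, rfl⟩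
      rw [← h t l hl]
      exact hw l hl
  exact D.val_embed (D.map g) hM hL hL' id (fun _ => rfl)
    (fun t => ⟨t, rfl, hl t, fun a => (image_id _).symm⟩)
    (fun t q ht => ⟨t, ht, hl t, fun a => (image_id _).symm⟩) q

/-- Disjoint union. -/
def sum (D E : Aut L A) : Aut L A where
  Q := D.Q ⊕ E.Q
  T := D.T ⊕ E.T
  finQ := inferInstance
  finT := inferInstance
  src := Sum.map D.src E.src
  lit := Sum.elim D.lit E.lit
  lit_fin := by
    rintro (t | t)
    exacts [D.lit_fin t, E.lit_fin t]
  suc t a := Sum.elim (fun t => Sum.inl '' D.suc t a) (fun t => Sum.inr '' E.suc t a) t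
  pri := Sum.elim D.pri E.pri

theorem val_sum_inl (D E : Aut L A) (hM : MF M) (hL : ∀ l, Lv l ∈ M.Adm) (q : D.Q) :
    (D.sum E).val M Lv (Sum.inl q : D.Q ⊕ E.Q) = D.val M Lv q := by
  refine D.val_embed (D.sum E) hM hL hL Sum.inl (fun _ => rfl)
    (fun t => ⟨Sum.inl t, rfl, rfl, fun a => rfl⟩) ?_ q
  rintro (t | t) q h
  · exact ⟨t, Sum.inl_injective h, rfl, fun a => rfl⟩
  · exact absurd h (Sum.inr_ne_inl)

theorem val_sum_inr (D E : Aut L A) (hM : MF M) (hL : ∀ l, Lv l ∈ M.Adm) (q : E.Q) :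
    (D.sum E).val M Lv (Sum.inr q : D.Q ⊕ E.Q) = E.val M Lv q := by
  refine E.val_embed (D.sum E) hM hL hL Sum.inr (fun _ => rfl)
    (fun t => ⟨Sum.inr t, rfl, rfl, fun a => rfl⟩) ?_ q
  rintro (t | t) q h
  · exact absurd h (Sum.inl_ne_inr)
  · exact ⟨t, Sum.inr_injective h, rfl, fun a => rfl⟩

/-- Extension of an automaton by a trivial state and an initial state. -/
def ext (D : Aut L A) (N : Type) [Finite N] (lit : N → Set L) (lit_fin : ∀ n, (lit n).Finite)
    (suc : N → A → Set (Option D.Q)) : Aut L A where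
  Q := Option (Option D.Q)
  T := D.T ⊕ Set A ⊕ N
  finQ := inferInstance
  finT := inferInstance
  src := Sum.elim (fun t => some (some (D.src t))) (Sum.elim (fun _ => some none) fun _ => none)
  lit := Sum.elim D.lit (Sum.elim (fun _ => ∅) lit)
  lit_fin := by
    rintro (t | t | t)
    exacts [D.lit_fin t, finite_empty, lit_fin t]
  suc t a := Sum.elim (fun t => (fun q => some (some q)) '' D.suc t a)
    (Sum.elim (fun B => {s | s = some none ∧ a ∈ B}) fun n => some '' suc n a) t
  pri := optCons 0 (optCons 0 D.pri)

section Ext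
variable (D : Aut L A) {N : Type} [Finite N] {lit : N → Set L} {lit_fin : ∀ n, (lit n).Finite}
  {suc : N → A → Set (Option D.Q)}

theorem val_ext_some (hM : MF M) (hL : ∀ l, Lv l ∈ M.Adm) (q : D.Q) :
    (D.ext N lit lit_fin suc).val M Lv (some (some q) : Option (Option D.Q)) = D.val M Lv q := by
  refine D.val_embed (D.ext N lit lit_fin suc) hM hL hL (fun q => some (some q)) (fun _ => rfl)
    (fun t => ⟨Sum.inl t, rfl, rfl, fun a => rfl⟩) ?_ q
  rintro (t | t | t) q h
  · exact ⟨t, Option.some_injective _ (Option.some_injective _ h), rfl, fun a => rfl⟩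
  · exact absurd (Option.some_injective _ h) (by simp)
  · exact absurd h (Option.some_ne_none _).symm

theorem val_ext_top (hM : MF M) (hL : ∀ l, Lv l ∈ M.Adm) :
    (D.ext N lit lit_fin suc).val M Lv (some none : Option (Option D.Q)) = univ := by
  rw [eq_univ_iff_forall]
  intro w
  by_contra hw
  set E := D.ext N lit lit_fin suc with hE
  let top : E.Q := (some none : Option (Option D.Q))
  have hy : w ∈ (E.coann hM hL).y top := by rw [E.coann_y hM hL]; exact hw
  obtain ⟨c, -, -, -, h⟩ := exists_path_two (C := Unit) hM
    (E.coann hM hL) (E.coann hM hL) (fun _ => univ) (fun _ => hM.univ_mem)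
    (fun _ => none) (fun _ => some top) (fun _ _ => univ) (fun _ ρ => ρ top)
    (fun c _ => PF.const hM.univ_mem) (fun c => PFQ.var hM _) (fun _ _ => True) (by
      rintro - v₁ v₂ - - - - w - h₁ h₂
      let B : Set A := {a | (M.R a w).Nonempty}
      have : w ∉ nab M (E.suc (Sum.inr (Sum.inl B))) fun p => (v₂ p)ᶜ :=
        fun h => h₂ ⟨Sum.inr (Sum.inl B), rfl, fun l hl => hl.elim, h⟩
      obtain ⟨a, ⟨s, ⟨rfl, ⟨w', hw'⟩⟩, h⟩ | ⟨w', hw', h⟩⟩ := not_nab this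
      · exact ⟨(), trivial, w', trivial, trivial, h w' hw'⟩
      · exact ⟨(), trivial, w', trivial, trivial, h top ⟨rfl, w', hw'⟩⟩)
    (c₀ := ()) (w₀ := w) trivial trivial hy
  refine h ((oddDom_succ_iff (c := fun _ => 0) ⟨0, fun _ => le_rfl⟩).2 ?_)
  rintro ⟨d, hd, hf, -⟩
  obtain ⟨t, ht⟩ := hf.exists
  exact absurd hd (by simp [← ht])

end Ext
end Aut

namespace Aut
variable {L : Type} {A : Finset Act} {P : Set L}

section
variable {M : Frame Act Atom} {Lv : L → Set M.W}

theorem val_ext_none (D : Aut L A) {N : Type} [Finite N] {lit : N → Set L}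
    {lit_fin : ∀ n, (lit n).Finite} {suc : N → A → Set (Option D.Q)} (hM : MF M)
    (hL : ∀ l, Lv l ∈ M.Adm) :
    (D.ext N lit lit_fin suc).val M Lv (none : Option (Option D.Q)) =
      {w | ∃ n, (∀ l ∈ lit n, w ∈ Lv l) ∧ w ∈ nab M (suc n) (optCons univ (D.val M Lv))} := by
  refine (Aut.val_step _ hM hL _).symm.trans ?_
  have hv : ∀ o : Option D.Q, (D.ext N lit lit_fin suc).val M Lv (some o : Option (Option D.Q)) =
      (optCons univ (D.val M Lv) : Option D.Q → Set M.W) o := by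
    rintro (_ | q)
    · exact D.val_ext_top hM hL
    · exact D.val_ext_some hM hL q
  have hn : ∀ n, nab M ((D.ext N lit lit_fin suc).suc (Sum.inr (Sum.inr n)))
      ((D.ext N lit lit_fin suc).val M Lv) = nab M (suc n) (optCons univ (D.val M Lv)) := by
    intro n
    ext w
    simp only [nab, ← hv, mem_ofPred_eq]
    refine forall_congr' fun a => and_congr ?_ (forall₂_congr fun w' _ => ?_)
    · exact forall_mem_image
    · exact exists_mem_image
  ext w
  constructor
  · rintro ⟨t | t | n, ht, hl, h⟩
    · exact absurd ht (Option.some_ne_none _)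
    · exact absurd ht (Option.some_ne_none _)
    · exact ⟨n, hl, hn n ▸ h⟩
  · rintro ⟨n, hl, h⟩
    exact ⟨Sum.inr (Sum.inr n), rfl, hl, (hn n).symm ▸ h⟩

/-- The automaton without states. -/
def emp : Aut L A where
  Q := Empty
  T := Empty
  finQ := inferInstance
  finT := inferInstance
  src := id
  lit := Empty.elim
  lit_fin t := t.elim
  suc t := t.elim
  pri := Empty.elim

end

variable (Atom A) in
/-- The operation `f` is computed by an automaton with letters in `P`. -/
def Rep (P : Set L) (f : ∀ M : Frame Act Atom, (L → Set M.W) → Set M.W) : Prop :=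
  ∃ (D : Aut L A) (q : D.Q), (∀ t, D.lit t ⊆ P) ∧ ∀ (M : Frame Act Atom) (Lv : L → Set M.W),
    MF M → (∀ l, Lv l ∈ M.Adm) → D.val M Lv q = f M Lv

theorem rep_lit {l : L} (hl : l ∈ P) : Rep Atom A P fun _ Lv => Lv l := by
  refine ⟨emp.ext (Set A) (fun _ => {l}) (fun _ => finite_singleton l)
    (fun B a => {o | o = none ∧ a ∈ B}), (none : Option (Option Empty)), ?_, ?_⟩
  · rintro (t | t | t)
    · exact t.elim
    · exact empty_subset _
    · exact singleton_subset_iff.2 hl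
  · intro M Lv hM hL
    refine (val_ext_none _ hM hL).trans ?_
    ext w
    constructor
    · rintro ⟨B, h, -⟩
      exact h l rfl
    · intro h
      refine ⟨{a | (M.R a w).Nonempty}, fun _ hl => hl ▸ h, fun a => ⟨?_, ?_⟩⟩
      · rintro _ ⟨rfl, w', hw'⟩
        exact ⟨w', hw', trivial⟩
      · exact fun w' hw' => ⟨none, ⟨rfl, w', hw'⟩, trivial⟩

theorem rep_empty : Rep Atom A P fun _ _ => ∅ := by
  refine ⟨emp.ext Empty Empty.elim (fun n => n.elim) (fun n => n.elim),
    (none : Option (Option Empty)), ?_, ?_⟩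
  · rintro (t | t | t)
    · exact t.elim
    · exact empty_subset _
    · exact t.elim
  · intro M Lv hM hL
    refine (val_ext_none _ hM hL).trans ?_
    exact eq_empty_of_forall_notMem fun w ⟨n, _⟩ => n.elim

theorem rep_univ : Rep Atom A P fun _ _ => univ := by
  refine ⟨emp.ext Empty Empty.elim (fun n => n.elim) (fun n => n.elim),
    (some none : Option (Option Empty)), ?_, ?_⟩
  · rintro (t | t | t)
    · exact t.elim
    · exact empty_subset _
    · exact t.elim
  · exact fun M Lv hM hL => val_ext_top _ hM hL

variable {f g : ∀ M : Frame Act Atom, (L → Set M.W) → Set M.W}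

theorem Rep.union (hf : Rep Atom A P f) (hg : Rep Atom A P g) :
    Rep Atom A P fun M Lv => f M Lv ∪ g M Lv := by
  obtain ⟨D, p, hD, hf⟩ := hf
  obtain ⟨E, q, hE, hg⟩ := hg
  have hS : ∀ t, (D.sum E).lit t ⊆ P := by
    rintro (t | t)
    exacts [hD t, hE t]
  let p' : (D.sum E).Q := (Sum.inl p : D.Q ⊕ E.Q)
  let q' : (D.sum E).Q := (Sum.inr q : D.Q ⊕ E.Q)
  refine ⟨(D.sum E).ext {t : (D.sum E).T // (D.sum E).src t = p' ∨ (D.sum E).src t = q'}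
    (fun t => (D.sum E).lit t) (fun t => (D.sum E).lit_fin t)
    (fun t a => some '' (D.sum E).suc t a), (none : Option (Option (D.sum E).Q)), ?_, ?_⟩
  · rintro (t | t | t)
    · exact hS t
    · exact empty_subset _
    · exact hS t
  · intro M Lv hM hL
    refine (val_ext_none _ hM hL).trans ?_
    have ef : (D.sum E).step M Lv p' ((D.sum E).val M Lv) = f M Lv :=
      ((D.sum E).val_step hM hL p').trans ((val_sum_inl D E hM hL p).trans (hf M Lv hM hL))
    have eg : (D.sum E).step M Lv q' ((D.sum E).val M Lv) = g M Lv :=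
      ((D.sum E).val_step hM hL q').trans ((val_sum_inr D E hM hL q).trans (hg M Lv hM hL))
    dsimp only
    rw [← ef, ← eg]
    have hn : ∀ t, nab M (fun a => some '' (D.sum E).suc t a)
        (optCons univ ((D.sum E).val M Lv)) = nab M ((D.sum E).suc t) ((D.sum E).val M Lv) := by
      intro t
      ext w
      exact forall_congr' fun a => and_congr forall_mem_image
        (forall₂_congr fun w' _ => exists_mem_image)
    ext w
    constructor
    · rintro ⟨⟨t, ht | ht⟩, hl, h⟩
      · exact Or.inl ⟨t, ht, hl, hn t ▸ h⟩
      · exact Or.inr ⟨t, ht, hl, hn t ▸ h⟩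
    · rintro (⟨t, ht, hl, h⟩ | ⟨t, ht, hl, h⟩)
      · exact ⟨⟨t, Or.inl ht⟩, hl, (hn t).symm ▸ h⟩
      · exact ⟨⟨t, Or.inr ht⟩, hl, (hn t).symm ▸ h⟩

theorem Rep.box (hf : Rep Atom A P f) {a : Act} (ha : a ∈ A) :
    Rep Atom A P fun M Lv => M.bx a (f M Lv) := by
  obtain ⟨D, p, hD, hf⟩ := hf
  refine ⟨D.ext (Set A) (fun _ => ∅) (fun _ => finite_empty)
    (fun B b => {o | b ∈ B ∧ o = open Classical in if b = a then some p else none}),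
    (none : Option (Option D.Q)), ?_, ?_⟩
  · rintro (t | t | t)
    · exact hD t
    · exact empty_subset _
    · exact empty_subset _
  · intro M Lv hM hL
    refine (val_ext_none _ hM hL).trans ?_
    dsimp only
    rw [← hf M Lv hM hL]
    ext w
    constructor
    · rintro ⟨B, -, h⟩ w' hw'
      obtain ⟨_, ⟨-, rfl⟩, hs⟩ := (h ⟨a, ha⟩).2 w' hw'
      rwa [if_pos rfl] at hs
    · intro h
      refine ⟨{b | (M.R b w).Nonempty}, fun _ hl => hl.elim, fun b => ?_⟩
      have key : ∀ w' ∈ M.R b w, w' ∈ (optCons univ (D.val M Lv) : Option D.Q → Set M.W)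
          (open Classical in if (b : Act) = a then some p else none) := by
        intro w' hw'
        split_ifs with hb
        · exact h w' (hb ▸ hw')
        · trivial
      constructor
      · rintro _ ⟨⟨w', hw'⟩, rfl⟩
        exact ⟨w', hw', key w' hw'⟩
      · exact fun w' hw' => ⟨_, ⟨⟨w', hw'⟩, rfl⟩, key w' hw'⟩

theorem Rep.dia (hf : Rep Atom A P f) {a : Act} (ha : a ∈ A) :
    Rep Atom A P fun M Lv => M.dm a (f M Lv) := by
  obtain ⟨D, p, hD, hf⟩ := hf
  refine ⟨D.ext (Set A) (fun _ => ∅) (fun _ => finite_empty)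
    (fun B b => {o | o = none ∧ b ∈ B ∨ o = some p ∧ (b : Act) = a}),
    (none : Option (Option D.Q)), ?_, ?_⟩
  · rintro (t | t | t)
    · exact hD t
    · exact empty_subset _
    · exact empty_subset _
  · intro M Lv hM hL
    refine (val_ext_none _ hM hL).trans ?_
    dsimp only
    rw [← hf M Lv hM hL]
    ext w
    constructor
    · rintro ⟨B, -, h⟩
      exact (h ⟨a, ha⟩).1 (some p) (Or.inr ⟨rfl, rfl⟩)
    · rintro ⟨w', hw', h⟩
      refine ⟨{b | (M.R b w).Nonempty}, fun _ hl => hl.elim, fun b => ⟨?_, ?_⟩⟩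
      · rintro _ (⟨rfl, v, hv⟩ | ⟨rfl, hb⟩)
        · exact ⟨v, hv, trivial⟩
        · exact ⟨w', hb ▸ hw', h⟩
      · exact fun v hv => ⟨none, Or.inl ⟨rfl, v, hv⟩, trivial⟩

end Aut

theorem fx_congr_iff {W : Type} {Adm : Set (Set W)} (hc : ∀ T ∈ Adm, Tᶜ ∈ Adm)
    {f g : Set W → Set W} {b : Bool} (h₁ : b = true → ∀ T ∈ Adm, f T ⊆ T ↔ g T ⊆ T)
    (h₂ : b = false → ∀ T ∈ Adm, T ⊆ f T ↔ T ⊆ g T) : fx Adm b f = fx Adm b g := by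
  have key : ∀ f g : Set W → Set W, (∀ T ∈ Adm, f T ⊆ T ↔ g T ⊆ T) → lfpA Adm f = lfpA Adm g := by
    intro f g h
    unfold lfpA
    congr 1
    ext T
    exact and_congr_right fun hT => h T hT
  cases b
  · simp only [fx, gfpA, Bool.false_eq_true, if_false]
    rw [key _ _ fun T hT => ?_]
    have := h₂ rfl _ (hc T hT)
    rwa [compl_subset_comm, compl_subset_comm (t := g Tᶜ)] at this
  · simpa [fx] using key f g (h₁ rfl)

namespace Aut
variable {L : Type} {A : Finset Act} {P : Set L}
variable {f g : ∀ M : Frame Act Atom, (L → Set M.W) → Set M.W}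

theorem nab_some {D : Aut L A} {M : Frame Act Atom} (t : D.T) (v : D.Q → Set M.W) :
    nab M (fun a => some '' D.suc t a) (optCons univ v) = nab M (D.suc t) v := by
  ext w
  exact forall_congr' fun a => and_congr forall_mem_image
    (forall₂_congr fun w' _ => exists_mem_image)

theorem Rep.fix {P : Set (Option L)} {f : ∀ M : Frame Act Atom, (Option L → Set M.W) → Set M.W}
    (hf : Rep Atom A P f) (b : Bool) : Rep Atom A {l | some l ∈ P} fun M Lv =>
      fx M.Adm b fun T => f M (optCons T Lv) := by
  obtain ⟨D, p, hD, hf⟩ := hf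
  let E := D.ext {t : D.T // D.src t = p ∧ (b = true → none ∉ D.lit t)}
    (fun t => D.lit t \ {none}) (fun t => (D.lit_fin t).subset sdiff_subset)
    (fun t a => some '' D.suc t a)
  let q₀ : E.Q := (none : Option (Option D.Q))
  obtain ⟨Φ, e, hΦ, hl⟩ := exists_fixAut (Atom := Atom) E (qin := q₀) (by
    rintro (t | t | t) h
    · exact absurd h (Option.some_ne_none _)
    · exact absurd h (Option.some_ne_none _)
    · exact fun h => h.2 rfl) b q₀
  refine ⟨Φ, e, fun x l hx => ?_, fun M Lv hM hL => ?_⟩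
  · obtain ⟨t | t | t, ht⟩ := hl x l hx
    · exact hD _ ht
    · exact ht.elim
    · exact hD _ ht.1
  · rw [hΦ M Lv hM hL, fixVal_unfold hM hL b]
    have hE : ∀ T ∈ M.Adm, E.val M (optCons T Lv) q₀ = {w | ∃ t, D.src t = p ∧
        (b = true → none ∉ D.lit t) ∧ (∀ l, some l ∈ D.lit t → w ∈ Lv l) ∧
        w ∈ nab M (D.suc t) (D.val M (optCons T Lv))} := by
      intro T hT
      refine (D.val_ext_none hM (optCons_adm hT hL)).trans ?_
      ext w
      constructor
      · rintro ⟨⟨t, h1, h2⟩, h3, h4⟩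
        rw [nab_some t] at h4
        exact ⟨t, h1, h2, fun l hl => h3 (some l) ⟨hl, Option.some_ne_none _⟩, h4⟩
      · rintro ⟨t, h1, h2, h3, h4⟩
        refine ⟨⟨t, h1, h2⟩, ?_, by rwa [nab_some t]⟩
        rintro (_ | l) ⟨hl, hl'⟩
        · exact absurd rfl hl'
        · exact h3 l hl
    have hF : ∀ T ∈ M.Adm, f M (optCons T Lv) = {w | ∃ t, D.src t = p ∧
        (none ∈ D.lit t → w ∈ T) ∧ (∀ l, some l ∈ D.lit t → w ∈ Lv l) ∧
        w ∈ nab M (D.suc t) (D.val M (optCons T Lv))} := by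
      intro T hT
      rw [← hf M _ hM (optCons_adm hT hL), ← D.val_step hM (optCons_adm hT hL) p]
      ext w
      constructor
      · rintro ⟨t, h1, h2, h3⟩
        exact ⟨t, h1, fun h => h2 none h, fun l hl => h2 (some l) hl, h3⟩
      · rintro ⟨t, h1, h2, h3, h4⟩
        refine ⟨t, h1, ?_, h4⟩
        rintro (_ | l) hl
        exacts [h2 hl, h3 l hl]
    refine fx_congr_iff hM.compl_mem ?_ ?_
    · rintro rfl T hT
      rw [hE T hT, hF T hT]
      constructor
      · rintro h w ⟨t, h1, h2, h3⟩
        by_cases hn : none ∈ D.lit t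
        · exact h2 hn
        · exact h ⟨t, h1, fun _ => hn, h3⟩
      · rintro h w ⟨t, h1, h2, h3⟩
        exact h ⟨t, h1, fun hn => absurd hn (h2 rfl), h3⟩
    · rintro rfl T hT
      rw [hE T hT, hF T hT]
      constructor
      · intro h w hw
        obtain ⟨t, h1, h2, h3⟩ := h hw
        exact ⟨t, h1, fun _ => hw, h3⟩
      · intro h w hw
        obtain ⟨t, h1, h2, h3⟩ := h hw
        exact ⟨t, h1, nofun, h3⟩

theorem Rep.inter (hf : Rep Atom A P f) (hg : Rep Atom A P g) :
    Rep Atom A P fun M Lv => f M Lv ∩ g M Lv := by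
  obtain ⟨D, p, hD, hf⟩ := hf
  obtain ⟨E, q, hE, hg⟩ := hg
  let S := (D.sum E).map (some : L → Option L)
  let p' : S.Q := (Sum.inl p : D.Q ⊕ E.Q)
  let q' : S.Q := (Sum.inr q : D.Q ⊕ E.Q)
  let X := S.ext {t : S.T // S.src t = p'} (fun t => insert none (S.lit t))
    (fun t => (S.lit_fin t).insert none) (fun t a => some '' S.suc t a)
  let q₀ : X.Q := (none : Option (Option S.Q))
  let q₁ : X.Q := (some (some q') : Option (Option S.Q))
  have hS : ∀ t, none ∉ S.lit t := by
    rintro t ⟨l, -, h⟩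
    exact absurd h (Option.some_ne_none _)
  have hSP : ∀ t l, some l ∈ S.lit t → l ∈ P := by
    rintro (t | t) l ⟨l', h, e⟩
    · exact hD t (Option.some_injective _ e ▸ h)
    · exact hE t (Option.some_injective _ e ▸ h)
  obtain ⟨Φ, e, hΦ, hl⟩ := exists_fixAut (Atom := Atom) X (qin := q₁) (by
    rintro (t | t | t) h
    · exact hS t
    · exact absurd (Option.some_injective _ h).symm (Option.some_ne_none _)
    · exact absurd h.symm (Option.some_ne_none _)) false q₀
  refine ⟨Φ, e, fun x l hx => ?_, fun M Lv hM hL => ?_⟩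
  · obtain ⟨t | t | t, ht⟩ := hl x l hx
    · exact hSP _ _ ht
    · exact ht.elim
    · exact hSP _ _ (ht.resolve_left (Option.some_ne_none _))
  · rw [hΦ M Lv hM hL]
    set V := fixVal X q₁ M Lv false with hV
    have hVa : V ∈ M.Adm := fixVal_adm hM hL false
    have hL' := optCons_adm hVa hL
    have hmap : ∀ r : D.Q ⊕ E.Q, S.val M (optCons V Lv) r = (D.sum E).val M Lv r :=
      fun r => (D.sum E).val_map some hM hL hL' (fun _ _ _ => rfl) r
    have hVg : V = g M Lv := by
      have := fixVal_unfold (D := X) (qin := q₁) hM hL false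
      rw [← hV] at this
      rw [← this]
      exact (S.val_ext_some hM hL' q').trans ((hmap _).trans
        ((val_sum_inr D E hM hL q).trans (hg M Lv hM hL)))
    have hfS : S.step M (optCons V Lv) p' (S.val M (optCons V Lv)) = f M Lv :=
      (S.val_step hM hL' p').trans ((hmap _).trans
        ((val_sum_inl D E hM hL p).trans (hf M Lv hM hL)))
    refine (S.val_ext_none hM hL').trans ?_
    dsimp only
    rw [← hfS, ← hVg]
    ext w
    constructor
    · rintro ⟨⟨t, ht⟩, h1, h2⟩
      rw [nab_some t] at h2
      exact ⟨⟨t, ht, fun l hl => h1 l (Or.inr hl), h2⟩, h1 none (Or.inl rfl)⟩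
    · rintro ⟨⟨t, ht, h1, h2⟩, h3⟩
      refine ⟨⟨t, ht⟩, ?_, by rwa [nab_some t]⟩
      rintro l (rfl | hl)
      exacts [h3, h1 l hl]

theorem Rep.map {L' : Type} (hf : Rep Atom A P f) (k : L → L') :
    ∃ f' : ∀ M : Frame Act Atom, (L' → Set M.W) → Set M.W, Rep Atom A (k '' P) f' ∧
      ∀ (M : Frame Act Atom) Lv Lv', MF M → (∀ l, Lv l ∈ M.Adm) → (∀ l, Lv' l ∈ M.Adm) →
        (∀ l ∈ P, Lv l = Lv' (k l)) → f' M Lv' = f M Lv := by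
  obtain ⟨D, p, hD, hf⟩ := hf
  refine ⟨fun M Lv' => (D.map k).val M Lv' p,
    ⟨D.map k, p, fun t => image_mono (hD t), fun _ _ _ _ => rfl⟩, ?_⟩
  intro M Lv Lv' hM hL hL' h
  exact (D.val_map k hM hL hL' (fun t l hl => h l (hD t hl)) p).trans (hf M Lv hM hL)

end Aut

/-- Literals: signed atoms and variables. -/
abbrev Lit (Atom : Type) := (Atom ⊕ ℕ) × Bool

/-- Value of a literal. -/
def litVal (M : Frame Act Atom) (ρ : Env M.W) : Lit Atom → Set M.W
  | (.inl p, true) => M.V p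
  | (.inl p, false) => (M.V p)ᶜ
  | (.inr n, true) => ρ n
  | (.inr n, false) => (ρ n)ᶜ

theorem litVal_adm {M : Frame Act Atom} (hM : MF M) {ρ : Env M.W} (hρ : ∀ n, ρ n ∈ M.Adm) :
    ∀ l, litVal M ρ l ∈ M.Adm := by
  rintro ⟨p | n, _ | _⟩
  exacts [hM.compl_mem _ (hM.atom_mem p), hM.atom_mem p, hM.compl_mem _ (hρ n), hρ n]

/-- The literals compatible with the polarities of the variables in `φ` (for `c = true`) or in its
negation (for `c = false`). -/
def polLits (φ : Fm Act Atom) (c : Bool) : Set (Lit Atom) :=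
  {l | ∀ x b, Polin b x φ → ∀ s, l = (.inr x, s) → s = (b == c)}

/-- All actions in the formula belong to `A`. -/
def ActsIn (A : Set Act) : Fm Act Atom → Prop
  | .atom _ => True
  | .ff => True
  | .neg φ => ActsIn A φ
  | .imp φ ψ => ActsIn A φ ∧ ActsIn A ψ
  | .box a φ => a ∈ A ∧ ActsIn A φ
  | .var _ => True
  | .mu φ => ActsIn A φ

theorem ActsIn.mono {A B : Set Act} (h : A ⊆ B) {φ : Fm Act Atom} (hφ : ActsIn A φ) :
    ActsIn B φ := by
  induction φ with
  | atom | ff | var => trivial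
  | neg φ ih | mu φ ih => exact ih hφ
  | imp φ ψ ih₁ ih₂ => exact ⟨ih₁ hφ.1, ih₂ hφ.2⟩
  | box a φ ih => exact ⟨h hφ.1, ih hφ.2⟩

theorem exists_actsIn (φ : Fm Act Atom) : ∃ A : Finset Act, ActsIn A φ := by
  classical
  induction φ with
  | atom | ff | var => exact ⟨∅, trivial⟩
  | neg φ ih | mu φ ih => exact ih
  | imp φ ψ ih₁ ih₂ =>
    obtain ⟨A, hA⟩ := ih₁
    obtain ⟨B, hB⟩ := ih₂
    exact ⟨A ∪ B, hA.mono (by simp), hB.mono (by simp)⟩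
  | box a φ ih =>
    obtain ⟨A, hA⟩ := ih
    exact ⟨insert a A, by simp, hA.mono (by simp)⟩

/-- Removal of the variable with index `0`. -/
def unbindLit : Lit Atom → Option (Lit Atom)
  | (.inl p, s) => some (.inl p, s)
  | (.inr 0, _) => none
  | (.inr (n + 1), s) => some (.inr n, s)

theorem Aut.Rep.mono {L : Type} {A : Finset Act} {P P' : Set L}
    {f : ∀ M : Frame Act Atom, (L → Set M.W) → Set M.W} (hf : Rep Atom A P f) (h : P ⊆ P') :
    Rep Atom A P' f := by
  obtain ⟨D, p, hD, hf⟩ := hf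
  exact ⟨D, p, fun t => (hD t).trans h, hf⟩

open Aut in
/-- Every formula and its negation is equivalent to an automaton over all `μ`-frames. -/
theorem exists_rep {A : Finset Act} (φ : Fm Act Atom) (hφ : Wf φ) (hA : ActsIn A φ) (c : Bool) :
    ∃ f, Rep Atom A (polLits φ c) f ∧ ∀ (M : Frame Act Atom) (ρ : Env M.W), MF M →
      (∀ n, ρ n ∈ M.Adm) → f M (litVal M ρ) = bif c then semA M φ ρ else (semA M φ ρ)ᶜ := by
  induction φ generalizing c with
  | atom p =>
    refine ⟨_, rep_lit (l := (.inl p, c)) ?_, ?_⟩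
    · rintro x b - s h
      simp at h
    · intro M ρ _ _
      cases c <;> rfl
  | ff =>
    cases c
    · exact ⟨_, rep_univ, fun M ρ _ _ => by simp [semA]⟩
    · exact ⟨_, rep_empty, fun M ρ _ _ => by simp [semA]⟩
  | neg φ ih =>
    obtain ⟨f, hf, h⟩ := ih hφ hA (!c)
    refine ⟨f, hf.mono ?_, fun M ρ hM hρ => ?_⟩
    · rintro l hl x b (_ | _ | _ | _ | hb) s hs
      rw [hl x _ hb s hs]
      cases b <;> cases c <;> rfl
    · rw [h M ρ hM hρ]
      cases c <;> simp [semA]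
  | imp φ ψ ih₁ ih₂ =>
    obtain ⟨f, hf, h₁⟩ := ih₁ hφ.1 hA.1 (!c)
    obtain ⟨g, hg, h₂⟩ := ih₂ hφ.2 hA.2 c
    have hf' : Rep Atom A (polLits (.imp φ ψ) c) f := hf.mono (by
      intro l hl x b hb s hs
      cases hb with
      | imp h1 h2 =>
        rw [hl x _ h1 s hs]
        cases b <;> cases c <;> rfl)
    have hg' : Rep Atom A (polLits (.imp φ ψ) c) g := hg.mono (by
      intro l hl x b hb s hs
      cases hb with
      | imp h1 h2 => exact hl x _ h2 s hs)
    cases c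
    · refine ⟨_, hf'.inter hg', fun M ρ hM hρ => ?_⟩
      simp [semA, h₁ M ρ hM hρ, h₂ M ρ hM hρ, compl_union]
    · refine ⟨_, hf'.union hg', fun M ρ hM hρ => ?_⟩
      simp [semA, h₁ M ρ hM hρ, h₂ M ρ hM hρ]
  | box a φ ih =>
    obtain ⟨f, hf, h⟩ := ih hφ hA.2 c
    have hf' : Rep Atom A (polLits (.box a φ) c) f := hf.mono (by
      intro l hl x b hb s hs
      cases hb with
      | box _ h1 => exact hl x _ h1 s hs)
    cases c
    · refine ⟨_, hf'.dia hA.1, fun M ρ hM hρ => ?_⟩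
      simp only [h M ρ hM hρ, semA, cond_false]
      ext w
      simp [Frame.dm, Frame.bx]
    · refine ⟨_, hf'.box hA.1, fun M ρ hM hρ => ?_⟩
      simp [semA, h M ρ hM hρ]
  | var n =>
    refine ⟨_, rep_lit (l := (.inr n, c)) ?_, ?_⟩
    · rintro x b hb s h
      simp only [Prod.mk.injEq, Sum.inr.injEq] at h
      obtain ⟨rfl, rfl⟩ := h
      cases hb with
      | varPos => simp
      | varNeg h => exact absurd rfl h
    · intro M ρ _ _
      cases c <;> rfl
  | mu φ ih =>
    obtain ⟨f, hf, h⟩ := ih hφ.2 hA c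
    obtain ⟨f', hf', h'⟩ := hf.map unbindLit
    refine ⟨_, (hf'.fix c).mono ?_, fun M ρ hM hρ => ?_⟩
    · rintro l ⟨⟨p | _ | n, s'⟩, hl', e⟩ x b hb s rfl
      · simp [unbindLit] at e
      · simp [unbindLit] at e
      · cases hb with
        | mu hb =>
          simp only [unbindLit, Option.some.injEq, Prod.mk.injEq, Sum.inr.injEq] at e
          obtain ⟨rfl, rfl⟩ := e
          exact hl' _ _ hb _ rfl
    · have hc : ∀ T ∈ M.Adm, (bif c then T else Tᶜ) ∈ M.Adm := by
        intro T hT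
        cases c
        exacts [hM.compl_mem T hT, hT]
      have hcons : ∀ T ∈ M.Adm, ∀ n, Env.cons T ρ n ∈ M.Adm := by
        rintro T hT (_ | n)
        exacts [hT, hρ n]
      have key : ∀ T ∈ M.Adm, f' M (optCons T (litVal M ρ)) =
          bif c then semA M φ (Env.cons (bif c then T else Tᶜ) ρ)
            else (semA M φ (Env.cons (bif c then T else Tᶜ) ρ))ᶜ := by
        intro T hT
        rw [← h M _ hM (hcons _ (hc T hT))]
        refine h' M _ _ hM (litVal_adm hM (hcons _ (hc T hT)))
          (optCons_adm hT (litVal_adm hM hρ)) ?_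
        rintro ⟨p | _ | n, s⟩ hl
        · cases s <;> rfl
        · have := hl 0 true hφ.1 s rfl
          subst this
          cases c <;> simp [litVal, Env.cons, unbindLit, optCons]
        · cases s <;> rfl
      refine (fx_congr hM.compl_mem key c).trans ?_
      clear key h' hf' h hf ih
      cases c
      · have := fx_compl (Adm := M.Adm) (f := fun T => semA M φ (Env.cons T ρ)) true
        simp only [cond_false, semA, Bool.not_true, fx, if_true] at this ⊢
        exact this.symm
      · simp only [cond_true, semA, fx, if_true]

/-- A Kripke model, all of whose subsets are admissible. -/
def fullFrame {S : Type} (V : Atom → Set S) (R : Act → S → Set S) : Frame Act Atom := ⟨S, V, R, univ⟩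

theorem fullFrame_mf {S : Type} (V : Atom → Set S) (R : Act → S → Set S) : MF (fullFrame V R) :=
  ⟨trivial, fun _ _ => trivial, fun _ => trivial, fun _ _ _ => trivial⟩

theorem semA_fullFrame {S : Type} (V : Atom → Set S) (R : Act → S → Set S) (φ : Fm Act Atom)
    (ρ : Env S) : semA (fullFrame V R) φ ρ = sem V R φ ρ := by
  induction φ generalizing ρ with
  | atom | ff | var => rfl
  | neg φ ih => exact congrArg compl (ih ρ)
  | imp φ ψ ih₁ ih₂ => exact congrArg₂ (fun s t => sᶜ ∪ t) (ih₁ ρ) (ih₂ ρ)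
  | box a φ ih => exact congrArg ((fullFrame V R).bx a) (ih ρ)
  | mu φ ih =>
    refine congrArg sInter (Set.ext fun T => ?_)
    change (T ∈ univ ∧ semA (fullFrame V R) φ (Env.cons T ρ) ⊆ T) ↔ sem V R φ (Env.cons T ρ) ⊆ T
    have e := ih (Env.cons T ρ)
    exact ⟨fun h => e.symm.subset.trans h.2, fun h => ⟨trivial, e.subset.trans h⟩⟩

/-- A sequence with finitely many values has a value of highest rank among those that are taken
infinitely often. -/
theorem exists_top_frequently {Q : Type} [Finite Q] (rk : Q → ℕ) (c : ℕ → Q) :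
    ∃ q, (∃ᶠ t in atTop, c t = q) ∧ ∀ᶠ t in atTop, rk (c t) ≤ rk q := by
  have hev : ∀ᶠ t in atTop, ∃ᶠ s in atTop, c s = c t := by
    have : ∀ᶠ t in atTop, ∀ q, (¬ ∃ᶠ s in atTop, c s = q) → c t ≠ q := by
      refine eventually_all.2 fun q => ?_
      by_cases h : ∃ᶠ s in atTop, c s = q
      · exact Eventually.of_forall fun t h' => absurd h h'
      · exact (not_frequently.1 h).mono fun t ht _ => ht
    exact this.mono fun t ht => by_contra fun h => ht _ h rfl
  obtain ⟨t₀, ht₀⟩ := hev.exists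
  obtain ⟨q, hq, hmax⟩ := exists_max_image {q | ∃ᶠ s in atTop, c s = q} rk (toFinite _) ⟨_, ht₀⟩
  exact ⟨q, hq, hev.mono fun t ht => hmax _ ht⟩

section Model
variable {A : Finset Act} (D : Aut (Lit Atom) A) {M : Frame Act Atom} {ρ : Env M.W}

open Classical in
/-- The guard forbidding the states in `G`. -/
noncomputable def forbid {Q W : Type} (G : Set Q) (p : Q) : Set W := if p ∈ G then ∅ else univ

theorem forbid_adm {Q : Type} (hM : MF M) (G : Set Q) (p : Q) : (forbid G p : Set M.W) ∈ M.Adm := by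
  unfold forbid
  split_ifs
  exacts [hM.empty_mem, hM.univ_mem]

/-- Update of the forbidden states when visiting `q`. -/
def nextForbid {M : Frame Act Atom} {Q : Type} (An : Ann M Q) (q : Q) (G : Set Q) : Set Q :=
  {p | p ∈ G ∧ An.rk q ≤ An.rk p ∨ p = q ∧ Odd (An.pri q)}

theorem nonempty_next {M : Frame Act Atom} {Q : Type} (hM : MF M) (An : Ann M Q) {q : Q} {G : Set Q}
    (h : (An.U (forbid G) q).Nonempty) : (An.F q (An.U (forbid (nextForbid An q G)))).Nonempty := by
  have hcut : ∀ p, p ≠ q ∨ ¬ Odd (An.pri q) →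
      (forbid (nextForbid An q G) p : Set M.W) = cutRank An.rk q (forbid G) p := by
    intro p hp
    have hp' : p ∈ nextForbid An q G ↔ p ∈ G ∧ An.rk q ≤ An.rk p :=
      ⟨fun h => h.resolve_right fun h' => hp.elim (· h'.1) (· h'.2), Or.inl⟩
    unfold forbid cutRank
    beta_reduce
    split_ifs <;> tauto
  by_cases ho : Odd (An.pri q)
  · have hq : q ∉ G := by
      intro hq
      obtain ⟨w, hw⟩ := h
      have := An.U_guard _ (forbid_adm hM G) q hw
      simp [forbid, hq] at this
    have := An.U_str _ (forbid_adm hM G) q ho univ hM.univ_mem (by rwa [univ_inter])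
      (forbid (nextForbid An q G)) (by
        rw [forbid, if_pos (show q ∈ nextForbid An q G from Or.inr ⟨rfl, ho⟩), sdiff_univ]) fun p hp => hcut p (Or.inl hp)
    rwa [univ_inter] at this
  · have : (forbid (nextForbid An q G) : Q → Set M.W) = cutRank An.rk q (forbid G) :=
      funext fun p => hcut p (Or.inr ho)
    rw [this]
    exact h.mono (An.U_unf _ (forbid_adm hM G) q)

theorem not_oddDom_forbid {M : Frame Act Atom} {Q : Type} [Finite Q] (hM : MF M) (An : Ann M Q)
    (q : ℕ → Q) (G : ℕ → Set Q) (h : ∀ t, (An.U (forbid (G t)) (q t)).Nonempty)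
    (hG : ∀ t, G (t + 1) = nextForbid An (q t) (G t)) : ¬ OddDom fun t => An.pri (q t) := by
  rintro ⟨p, hp, hf, hle⟩
  obtain ⟨r, hr, hrk⟩ := exists_top_frequently An.rk q
  have hpr : An.pri r = p := by
    apply le_antisymm
    · obtain ⟨t, ht, h'⟩ := (hr.and_eventually hle).exists
      rwa [← ht]
    · obtain ⟨t, ht, h'⟩ := (hf.and_eventually hrk).exists
      rw [← ht]
      exact An.rk_pri _ _ h'
  obtain ⟨T, hT⟩ := eventually_atTop.1 hrk
  obtain ⟨t₀, h0, ht0⟩ := frequently_atTop.1 hr T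
  have key : ∀ n, r ∈ G (t₀ + 1 + n) := by
    intro n
    induction n with
    | zero => rw [Nat.add_zero, hG]; exact Or.inr ⟨ht0.symm, by rw [ht0, hpr]; exact hp⟩
    | succ n ih =>
      rw [← Nat.add_assoc, hG]
      exact Or.inl ⟨ih, hT _ (by omega)⟩
  obtain ⟨t₁, h1, ht1⟩ := frequently_atTop.1 hr (t₀ + 1)
  obtain ⟨n, rfl⟩ := Nat.exists_eq_add_of_le h1
  obtain ⟨w, hw⟩ := h (t₀ + 1 + n)
  have := An.U_guard _ (forbid_adm hM _) _ hw
  rw [ht1] at this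
  simp [forbid, key n] at this

/-- A satisfiable automaton accepts a state of some Kripke model. -/
theorem exists_model (hM : MF M) (hρ : ∀ n, ρ n ∈ M.Adm) {q₀ : D.Q}
    (h : (D.val M (litVal M ρ) q₀).Nonempty) :
    ∃ (S : Type) (V : Atom → Set S) (R : Act → S → Set S) (ρ' : Env S) (s : S),
      s ∈ D.val (fullFrame V R) (litVal (fullFrame V R) ρ') q₀ := by
  have hL := litVal_adm hM hρ
  let An := D.ann hM hL
  let Ω := {x : D.Q × Set D.Q // (An.U (forbid x.2) x.1).Nonempty}
  have hstep : ∀ ω : Ω, ∃ (w : M.W) (t : D.T), D.src t = ω.1.1 ∧ w ∈ D.lits M (litVal M ρ) t ∧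
      w ∈ nab M (D.suc t) (An.U (forbid (nextForbid An ω.1.1 ω.1.2))) :=
    fun ω => nonempty_next hM An ω.2
  choose w t ht hl hn using hstep
  let R : Act → Ω → Set Ω := fun a ω =>
    {ω' | ∃ ha : a ∈ A, ω'.1.1 ∈ D.suc (t ω) ⟨a, ha⟩ ∧ ω'.1.2 = nextForbid An ω.1.1 ω.1.2}
  let N := fullFrame (fun p => {ω : Ω | w ω ∈ M.V p}) R
  have hN : MF N := fullFrame_mf _ _
  let ρ' : Env N.W := fun n => {ω : Ω | w ω ∈ ρ n}
  have hL' : ∀ l, litVal N ρ' l ∈ N.Adm := fun l => trivial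
  have hlit : ∀ l (ω : Ω), w ω ∈ litVal M ρ l → ω ∈ litVal N ρ' l := by
    rintro ⟨p | n, _ | _⟩ ω h <;> exact h
  have h0 : (An.U (forbid (∅ : Set D.Q)) q₀).Nonempty := by
    have : (forbid ∅ : D.Q → Set M.W) = fun _ => univ := funext fun p => by simp [forbid]
    rw [this]
    change (An.y q₀).Nonempty
    rwa [show An.y = _ from D.ann_y hM hL]
  refine ⟨Ω, fun p => {ω : Ω | w ω ∈ M.V p}, R, ρ', ⟨(q₀, ∅), h0⟩, ?_⟩
  by_contra hw
  let ω₀ : Ω := ⟨(q₀, ∅), h0⟩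
  obtain ⟨c, hc0, hcs, -, hod⟩ := exists_path_two (C := Ω) hN
    (D.coann hN hL') (D.coann hN hL') (fun ω => {ω}) (fun _ => trivial)
    (fun _ => none) (fun ω => some ω.1.1) (fun _ _ => univ) (fun ω v => v ω.1.1)
    (fun c _ => PF.const trivial) (fun c => PFQ.var hN _)
    (fun ω ω' => ω'.1.2 = nextForbid An ω.1.1 ω.1.2) (by
      rintro ω v₁ v - - - - w' hw' - hu
      obtain rfl : ω = w' := hw'.symm
      have : ω ∉ nab N (D.suc (t ω)) fun p => (v p)ᶜ :=
        fun h => hu ⟨t ω, ht ω, fun l hl' => hlit l ω (hl ω l hl'), h⟩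
      obtain ⟨a, ⟨s, hs, h⟩ | ⟨ω', hω', h⟩⟩ := not_nab this
      · obtain ⟨w', -, hw'⟩ := (hn ω a).1 s hs
        exact ⟨⟨(s, _), ⟨w', hw'⟩⟩, rfl, ⟨(s, _), ⟨w', hw'⟩⟩, rfl, trivial,
          h ⟨(s, _), ⟨w', hw'⟩⟩ ⟨a.2, hs, rfl⟩⟩
      · obtain ⟨ha, h1, h2⟩ := hω'
        exact ⟨ω', h2, ω', rfl, trivial, h _ h1⟩)
    (c₀ := ω₀) (w₀ := ω₀) rfl trivial (by
      change ω₀ ∈ (D.coann hN hL').y q₀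
      rw [D.coann_y hN hL']
      exact hw)
  refine hod ((oddDom_succ_iff (c := fun t => D.pri (c t).1.1) ?_).2 ?_)
  · obtain ⟨B, hB⟩ := (finite_range D.pri).bddAbove
    exact ⟨B, fun t => hB (mem_range_self _)⟩
  · exact not_oddDom_forbid hM An (fun t => (c t).1.1) (fun t => (c t).1.2)
      (fun t => (c t).2) hcs

end Model

section Soundness
variable {S : Type} (V : Atom → Set S) (R : Act → S → Set S)

theorem sem_shiftFm (φ : Fm Act Atom) (c : ℕ) (ρ : Env S) :
    sem V R (shiftFm c φ) ρ = sem V R φ (fun n => if n < c then ρ n else ρ (n + 1)) := by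
  induction φ generalizing c ρ with
  | atom | ff => rfl
  | neg φ ih => simp only [shiftFm, sem, ih]
  | imp φ ψ ih₁ ih₂ => simp only [shiftFm, sem, ih₁, ih₂]
  | box a φ ih => simp only [shiftFm, sem, ih]
  | var n =>
    simp only [shiftFm, sem]
    split_ifs <;> rfl
  | mu φ ih =>
    simp only [shiftFm, sem, ih]
    have : ∀ T : Set S, (fun n => if n < c + 1 then Env.cons T ρ n else Env.cons T ρ (n + 1)) =
        Env.cons T (fun n => if n < c then ρ n else ρ (n + 1)) := by
      intro T
      funext n
      cases n with
      | zero => rfl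
      | succ n => simp [Env.cons]
    simp only [this]

theorem sem_instVar (φ ψ : Fm Act Atom) (k : ℕ) (ρ : Env S) :
    sem V R (instVar φ k ψ) ρ = sem V R φ
      (fun n => if n = k then sem V R ψ ρ else if k < n then ρ (n - 1) else ρ n) := by
  induction φ generalizing k ψ ρ with
  | atom | ff => rfl
  | neg φ ih => simp only [instVar, sem, ih]
  | imp φ ψ ih₁ ih₂ => simp only [instVar, sem, ih₁, ih₂]
  | box a φ ih => simp only [instVar, sem, ih]
  | var n =>
    simp only [instVar, sem]
    split_ifs <;> rfl
  | mu φ ih =>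
    simp only [instVar, sem, ih, sem_shiftFm]
    have : ∀ T : Set S, (fun n => if n = k + 1 then
          sem V R ψ (fun n => if n < 0 then Env.cons T ρ n else Env.cons T ρ (n + 1))
        else if k + 1 < n then Env.cons T ρ (n - 1) else Env.cons T ρ n) =
        Env.cons T (fun n => if n = k then sem V R ψ ρ else if k < n then ρ (n - 1) else ρ n) := by
      intro T
      funext n
      rcases n with _ | _ | n <;> simp [Env.cons, @eq_comm ℕ 0]
    simp only [this]

theorem sem_instVar_zero (φ ψ : Fm Act Atom) (ρ : Env S) :
    sem V R (instVar φ 0 ψ) ρ = sem V R φ (Env.cons (sem V R ψ ρ) ρ) := by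
  rw [sem_instVar]
  congr 1
  funext n
  cases n <;> simp [Env.cons]

theorem Polin.sem_mono {b : Bool} {x : ℕ} {φ : Fm Act Atom} (h : Polin b x φ) (ρ ρ' : Env S)
    (hne : ∀ n, n ≠ x → ρ n = ρ' n) (hx : ρ x ⊆ ρ' x) :
    bif b then sem V R φ ρ ⊆ sem V R φ ρ' else sem V R φ ρ' ⊆ sem V R φ ρ := by
  induction h generalizing ρ ρ' with
  | atom b | ff b => cases b <;> exact subset_rfl
  | varPos x y =>
    by_cases h : y = x
    · subst h; exact hx
    · exact (hne y h).subset
  | varNeg h => exact (hne _ h).symm.subset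
  | @neg b _ _ _ ih =>
    have := ih ρ ρ' hne hx
    cases b <;> exact compl_subset_compl.2 this
  | @imp b _ _ _ _ _ ih₁ ih₂ =>
    have h₁ := ih₁ ρ ρ' hne hx
    have h₂ := ih₂ ρ ρ' hne hx
    cases b <;> exact union_subset_union (compl_subset_compl.2 h₁) h₂
  | @box b _ _ _ _ ih =>
    have := ih ρ ρ' hne hx
    cases b <;> exact fun s hs r hr => this (hs r hr)
  | @mu b x _ _ ih =>
    have := fun T : Set S => ih (Env.cons T ρ) (Env.cons T ρ')
      (by rintro (_ | n) h; exacts [rfl, hne n (by simpa using h)]) hx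
    cases b <;> exact sInter_subset_sInter fun T hT => (this T).trans hT

theorem sem_mu_eq {A : Fm Act Atom} (hA : Posin 0 A) (ρ : Env S) :
    sem V R A (Env.cons (sem V R (.mu A) ρ) ρ) ⊆ sem V R (.mu A) ρ := by
  refine subset_sInter fun T hT => Subset.trans ?_ hT
  refine Polin.sem_mono V R hA _ _ ?_ (sInter_subset_of_mem hT)
  rintro (_ | n) h
  exacts [absurd rfl h, rfl]

theorem Deriv.sound [DecidableEq Act] [DecidableEq Atom] {Γ : Finset (Fm Act Atom)}
    {φ : Fm Act Atom} (h : Deriv Γ φ) (ρ : Env S) {s : S} (hs : ∀ γ ∈ Γ, s ∈ sem V R γ ρ) :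
    s ∈ sem V R φ ρ := by
  induction h generalizing s with
  | hyp Γ φ => exact hs _ (Finset.mem_insert_self _ _)
  | weak _ hsub ih => exact ih fun γ hγ => hs γ (hsub hγ)
  | raa _ ih => exact by_contra fun h => ih (Finset.forall_mem_insert _ _ _ |>.2 ⟨h, hs⟩)
  | impI _ ih =>
    exact or_iff_not_imp_left.2 fun h =>
      ih (Finset.forall_mem_insert _ _ _ |>.2 ⟨not_not.1 h, hs⟩)
  | impE _ _ ih₁ ih₂ => exact (ih₁ hs).resolve_left (not_not.2 (ih₂ hs))
  | negI _ ih => exact fun h => ih (Finset.forall_mem_insert _ _ _ |>.2 ⟨h, hs⟩)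
  | ffI _ _ ih₁ ih₂ => exact ih₂ hs (ih₁ hs)
  | boxI a _ ih => exact fun r _ => ih (by simp)
  | boxK _ _ ih₁ ih₂ => exact fun r hr => (ih₁ hs r hr).resolve_left (not_not.2 (ih₂ hs r hr))
  | muI hA _ ih =>
    have := ih hs
    rw [sem_instVar_zero] at this
    exact sem_mu_eq V R hA ρ this
  | @muE Γ A ψ hA _ _ ih₁ ih₂ =>
    refine ih₁ hs _ fun t ht => ih₂ ?_
    rw [← sem_instVar_zero] at ht
    simpa using ht

end Soundness

section Substitution

theorem shiftFm_shiftFm (φ : Fm Act Atom) {c d : ℕ} (h : d ≤ c) :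
    shiftFm (c + 1) (shiftFm d φ) = shiftFm d (shiftFm c φ) := by
  induction φ generalizing c d with
  | atom | ff => rfl
  | neg φ ih => simp only [shiftFm, ih h]
  | imp φ ψ ih₁ ih₂ => simp only [shiftFm, ih₁ h, ih₂ h]
  | box a φ ih => simp only [shiftFm, ih h]
  | var n => simp only [shiftFm]; split_ifs <;> simp only [shiftFm] <;> split_ifs <;> first | rfl | omega
  | mu φ ih => simp only [shiftFm, ih (Nat.succ_le_succ h)]

theorem instVar_shiftFm (φ ψ : Fm Act Atom) {c k : ℕ} (h : c ≤ k) :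
    instVar (shiftFm c φ) (k + 1) (shiftFm c ψ) = shiftFm c (instVar φ k ψ) := by
  induction φ generalizing c k ψ with
  | atom | ff => rfl
  | neg φ ih => simp only [shiftFm, instVar, ih _ h]
  | imp φ ψ ih₁ ih₂ => simp only [shiftFm, instVar, ih₁ _ h, ih₂ _ h]
  | box a φ ih => simp only [shiftFm, instVar, ih _ h]
  | var n =>
    simp only [shiftFm, instVar]
    split_ifs <;> simp only [instVar, shiftFm] <;> split_ifs <;>
      first | rfl | omega | (congr 1; omega)
  | mu φ ih =>
    simp only [shiftFm, instVar, ← ih _ (Nat.succ_le_succ h), shiftFm_shiftFm ψ (Nat.zero_le c)]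

theorem instVar_shiftFm_self (φ ψ : Fm Act Atom) (c : ℕ) : instVar (shiftFm c φ) c ψ = φ := by
  induction φ generalizing c ψ with
  | atom | ff => rfl
  | neg φ ih => simp only [shiftFm, instVar, ih]
  | imp φ ψ ih₁ ih₂ => simp only [shiftFm, instVar, ih₁, ih₂]
  | box a φ ih => simp only [shiftFm, instVar, ih]
  | var n =>
    simp only [shiftFm]
    split_ifs <;> simp only [instVar] <;> split_ifs <;> first | rfl | omega
  | mu φ ih => simp only [shiftFm, instVar, ih]

/-- Prepend a formula to a substitution. -/
def consSub (ψ : Fm Act Atom) (σ : ℕ → Fm Act Atom) : ℕ → Fm Act Atom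
  | 0 => ψ
  | n + 1 => σ n

/-- Lift a substitution under a binder. -/
def upSub (σ : ℕ → Fm Act Atom) : ℕ → Fm Act Atom := consSub (.var 0) fun n => shiftFm 0 (σ n)

/-- Parallel substitution. -/
def psub : (ℕ → Fm Act Atom) → Fm Act Atom → Fm Act Atom
  | _, .atom p => .atom p
  | _, .ff => .ff
  | σ, .neg A => .neg (psub σ A)
  | σ, .imp A B => .imp (psub σ A) (psub σ B)
  | σ, .box a A => .box a (psub σ A)
  | σ, .var n => σ n
  | σ, .mu A => .mu (psub (upSub σ) A)

theorem psub_var (φ : Fm Act Atom) : psub .var φ = φ := by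
  induction φ with
  | atom | ff | var => rfl
  | neg φ ih => simp only [psub, ih]
  | imp φ ψ ih₁ ih₂ => simp only [psub, ih₁, ih₂]
  | box a φ ih => simp only [psub, ih]
  | mu φ ih =>
    have : upSub (.var : ℕ → Fm Act Atom) = .var := by funext n; cases n <;> rfl
    simp only [psub, this, ih]

theorem instVar_psub (φ ψ : Fm Act Atom) (τ : ℕ → Fm Act Atom) (k : ℕ) :
    instVar (psub τ φ) k ψ = psub (fun n => instVar (τ n) k ψ) φ := by
  induction φ generalizing τ k ψ with
  | atom | ff | var => rfl
  | neg φ ih => simp only [psub, instVar, ih]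
  | imp φ ψ ih₁ ih₂ => simp only [psub, instVar, ih₁, ih₂]
  | box a φ ih => simp only [psub, instVar, ih]
  | mu φ ih =>
    have : (fun n => instVar (upSub τ n) (k + 1) (shiftFm 0 ψ)) =
        upSub fun n => instVar (τ n) k ψ := by
      funext n
      cases n with
      | zero => simp [upSub, consSub, instVar]
      | succ n => exact instVar_shiftFm _ _ (Nat.zero_le k)
    simp only [psub, instVar, ih, this]

theorem instVar_psub_upSub (φ ψ : Fm Act Atom) (σ : ℕ → Fm Act Atom) :
    instVar (psub (upSub σ) φ) 0 ψ = psub (consSub ψ σ) φ := by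
  rw [instVar_psub]
  congr 1
  funext n
  cases n with
  | zero => simp [upSub, consSub, instVar]
  | succ n => exact instVar_shiftFm_self _ _ _

theorem Polin.shiftFm {b : Bool} {y : ℕ} {φ : Fm Act Atom} (h : Polin b y φ) {c : ℕ} (hc : c ≤ y) :
    Polin b (y + 1) (shiftFm c φ) := by
  induction h generalizing c with
  | atom | ff => constructor
  | varPos => unfold MuCalc.shiftFm; split_ifs <;> constructor
  | varNeg h => unfold MuCalc.shiftFm; split_ifs <;> constructor <;> omega
  | neg _ ih => exact .neg (ih hc)
  | imp _ _ ih₁ ih₂ => exact .imp (ih₁ hc) (ih₂ hc)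
  | box a _ ih => exact .box a (ih hc)
  | mu _ ih => exact .mu (ih (Nat.succ_le_succ hc))

theorem polin_shiftFm_self (b : Bool) (c : ℕ) (φ : Fm Act Atom) : Polin b c (shiftFm c φ) := by
  induction φ generalizing b c with
  | atom | ff => constructor
  | neg φ ih => exact .neg (ih _ _)
  | imp φ ψ ih₁ ih₂ => exact .imp (ih₁ _ _) (ih₂ _ _)
  | box a φ ih => exact .box a (ih _ _)
  | var n => unfold shiftFm; cases b <;> split_ifs <;> constructor <;> omega
  | mu φ ih => exact .mu (ih _ _)

theorem Polin.psub {b : Bool} {x y : ℕ} {φ : Fm Act Atom} (h : Polin b x φ) {σ : ℕ → Fm Act Atom}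
    (hx : Polin true y (σ x)) (hne : ∀ n, n ≠ x → ∀ c, Polin c y (σ n)) :
    Polin b y (psub σ φ) := by
  induction h generalizing y σ with
  | atom | ff => constructor
  | varPos x n =>
    by_cases h : n = x
    · subst h; exact hx
    · exact hne n h _
  | varNeg h => exact hne _ h _
  | neg _ ih => exact .neg (ih hx hne)
  | imp _ _ ih₁ ih₂ => exact .imp (ih₁ hx hne) (ih₂ hx hne)
  | box a _ ih => exact .box a (ih hx hne)
  | mu _ ih =>
    refine .mu (ih (hx.shiftFm (Nat.zero_le _)) ?_)
    rintro (_ | n) hn c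
    · cases c
      · exact .varNeg (by omega)
      · exact .varPos _ _
    · exact (hne n (by omega) c).shiftFm (Nat.zero_le _)

theorem Posin.psub_upSub {φ : Fm Act Atom} (h : Posin 0 φ) (σ : ℕ → Fm Act Atom) :
    Posin 0 (psub (upSub σ) φ) := by
  refine Polin.psub h (.varPos _ _) ?_
  rintro (_ | n) hn c
  · exact absurd rfl hn
  · exact polin_shiftFm_self _ _ _

end Substitution

section Canonical
variable [DecidableEq Act] [DecidableEq Atom]

/-- No finite subset derives `ff`. -/
def Consistent (X : Set (Fm Act Atom)) : Prop :=
  ∀ Γ : Finset (Fm Act Atom), ↑Γ ⊆ X → ¬ Deriv Γ .ff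

/-- Maximal consistent sets. -/
def MCS (X : Set (Fm Act Atom)) : Prop := Maximal Consistent X

theorem Consistent.exists_mcs {X : Set (Fm Act Atom)} (hX : Consistent X) :
    ∃ Y, X ⊆ Y ∧ MCS Y := by
  refine zorn_subset_nonempty {Y | Consistent Y} (fun C hC hchain hne => ⟨⋃₀ C, ?_, ?_⟩) X hX
  · intro Γ hΓ
    obtain ⟨Y, hY, hΓY⟩ :=
      DirectedOn.exists_mem_subset_of_finset_subset_biUnion (f := id) hne
        (show DirectedOn (fun i j => i ⊆ j) C from hchain.directedOn)
        (by simpa [sUnion_eq_biUnion] using hΓ)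
    exact hC hY Γ hΓY
  · exact fun Y hY => subset_sUnion_of_mem hY

section MCS
variable {X : Set (Fm Act Atom)} {φ ψ : Fm Act Atom}

theorem MCS.mem_of_insert (hX : MCS X) (h : Consistent (insert φ X)) : φ ∈ X :=
  hX.2 h (subset_insert _ _) (mem_insert _ _)

theorem MCS.mem_of_deriv (hX : MCS X) {Γ : Finset (Fm Act Atom)} (hΓ : ↑Γ ⊆ X) (h : Deriv Γ φ) : φ ∈ X := by
  refine hX.mem_of_insert fun Δ hΔ hd => hX.1 (Γ ∪ Δ.erase φ) ?_ ?_
  · intro γ hγ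
    rcases Finset.mem_union.1 hγ with hγ | hγ
    · exact hΓ hγ
    · rw [Finset.mem_erase] at hγ
      exact (hΔ hγ.2).resolve_left hγ.1
  · have hd' : Deriv (insert φ (Γ ∪ Δ.erase φ)) .ff := hd.weak fun γ hγ => by
      by_cases h : γ = φ <;> simp [h, hγ]
    exact .impE (.impI hd') (h.weak Finset.subset_union_left)

theorem MCS.mem_of_deriv_singleton (hX : MCS X) (h : Deriv {φ} ψ) (hφ : φ ∈ X) : ψ ∈ X :=
  hX.mem_of_deriv (by simpa using hφ) h

theorem MCS.ff_notMem (hX : MCS X) : Fm.ff ∉ X := fun h =>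
  hX.1 {.ff} (by simpa using h) (Deriv.hyp ∅ _)

theorem MCS.neg_mem (hX : MCS X) : .neg φ ∈ X ↔ φ ∉ X := by
  constructor
  · intro h1 h2
    refine hX.1 {φ, .neg φ} (by simp [insert_subset_iff, h1, h2]) (.ffI (φ := φ) (.hyp _ _) ?_)
    exact (Deriv.hyp ∅ _).weak (by simp)
  · intro h
    refine hX.mem_of_insert fun Δ hΔ hd => h (hX.mem_of_deriv (Γ := Δ.erase (.neg φ)) ?_ (.raa ?_))
    · intro γ hγ
      have := Finset.mem_erase.1 hγ
      exact (hΔ this.2).resolve_left this.1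
    · exact hd.weak fun γ hγ => by by_cases h : γ = .neg φ <;> simp [h, hγ]

theorem MCS.imp_mem (hX : MCS X) : .imp φ ψ ∈ X ↔ φ ∉ X ∨ ψ ∈ X := by
  constructor
  · intro h
    refine or_iff_not_imp_left.2 fun h' => hX.mem_of_deriv (Γ := {φ, .imp φ ψ})
      (by simp [insert_subset_iff, h, not_not.1 h']) (.impE (φ := φ) ?_ (.hyp _ _))
    exact (Deriv.hyp ∅ _).weak (by simp)
  · rintro (h | h)
    · refine hX.mem_of_deriv_singleton (φ := .neg φ) (.impI (.raa (.ffI (φ := φ) ?_ ?_)))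
        (hX.neg_mem.2 h)
      · exact (Deriv.hyp ∅ _).weak (by simp)
      · exact (Deriv.hyp ∅ _).weak (by simp)
    · refine hX.mem_of_deriv_singleton (φ := ψ) (.impI ?_) h
      exact (Deriv.hyp ∅ _).weak (by simp)

theorem MCS.box_mem_of_deriv (hX : MCS X) {a : Act} {Γ : Finset (Fm Act Atom)} (h : Deriv Γ φ)
    (hΓ : ∀ γ ∈ Γ, .box a γ ∈ X) : .box a φ ∈ X := by
  induction Γ using Finset.induction_on generalizing φ with
  | empty => exact hX.mem_of_deriv (Γ := ∅) (by simp) (.boxI a h)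
  | insert γ Γ _ ih =>
    have h1 := ih (.impI h) fun δ hδ => hΓ δ (Finset.mem_insert_of_mem hδ)
    have h2 := hΓ γ (Finset.mem_insert_self _ _)
    refine hX.mem_of_deriv (Γ := {.box a γ, .box a (.imp γ φ)})
      (by simp [insert_subset_iff, h1, h2]) (.boxK (φ := γ) ?_ (.hyp _ _))
    exact (Deriv.hyp ∅ _).weak (by simp)

theorem MCS.exists_of_box_notMem (hX : MCS X) {a : Act} (h : .box a φ ∉ X) :
    ∃ Y, MCS Y ∧ (∀ ψ, .box a ψ ∈ X → ψ ∈ Y) ∧ φ ∉ Y := by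
  have hc : Consistent (insert (.neg φ) {ψ | .box a ψ ∈ X}) := by
    intro Δ hΔ hd
    refine h (hX.box_mem_of_deriv (Γ := Δ.erase (.neg φ)) (.raa ?_) ?_)
    · exact hd.weak fun γ hγ => by by_cases h : γ = .neg φ <;> simp [h, hγ]
    · intro γ hγ
      have := Finset.mem_erase.1 hγ
      exact (hΔ this.2).resolve_left this.1
  obtain ⟨Y, hY, hm⟩ := hc.exists_mcs
  exact ⟨Y, hm, fun ψ hψ => hY (Or.inr hψ), hm.neg_mem.1 (hY (Or.inl rfl))⟩

end MCS

variable (Act Atom) in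
/-- The states of the canonical frame. -/
abbrev CState := {X : Set (Fm Act Atom) // MCS X}

/-- The maximal consistent sets containing `φ`. -/
def truthSet (φ : Fm Act Atom) : Set (CState Act Atom) := {X | φ ∈ X.1}

theorem deriv_of_truthSet_subset {φ ψ : Fm Act Atom} (h : truthSet φ ⊆ truthSet ψ) :
    Deriv {φ} ψ := by
  by_contra hd
  have hc : Consistent {.neg ψ, φ} := by
    intro Δ hΔ hff
    refine hd (.raa (hff.weak fun γ hγ => ?_))
    simpa using hΔ hγ
  obtain ⟨Y, hY, hm⟩ := hc.exists_mcs
  exact hm.neg_mem.1 (hY (Or.inl rfl)) (h (a := ⟨Y, hm⟩) (hY (Or.inr rfl)))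

theorem truthSet_subset {φ ψ : Fm Act Atom} (h : Deriv {φ} ψ) : truthSet φ ⊆ truthSet ψ :=
  fun X hX => X.2.mem_of_deriv_singleton h hX

theorem truthSet_neg (φ : Fm Act Atom) : truthSet (.neg φ) = (truthSet φ)ᶜ :=
  Set.ext fun X => X.2.neg_mem

variable (Act Atom) in
/-- The canonical frame. -/
def canon : Frame Act Atom where
  W := CState Act Atom
  V p := truthSet (.atom p)
  R a X := {Y | ∀ ψ, .box a ψ ∈ X.1 → ψ ∈ Y.1}
  Adm := range truthSet

theorem semA_canon (φ : Fm Act Atom) (hφ : Wf φ) (σ : ℕ → Fm Act Atom) :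
    semA (canon Act Atom) φ (fun n => truthSet (σ n)) = truthSet (psub σ φ) := by
  induction φ generalizing σ with
  | atom | var => rfl
  | ff => exact (eq_empty_of_forall_notMem fun X => X.2.ff_notMem).symm
  | neg φ ih => exact (congrArg compl (ih hφ σ)).trans (truthSet_neg _).symm
  | imp φ ψ ih₁ ih₂ =>
    refine (congrArg₂ (fun s t => sᶜ ∪ t) (ih₁ hφ.1 σ) (ih₂ hφ.2 σ)).trans ?_
    exact Set.ext fun X => X.2.imp_mem.symm
  | box a φ ih =>
    refine (congrArg ((canon Act Atom).bx a) (ih hφ σ)).trans (Set.ext fun X => ⟨fun h => ?_, ?_⟩)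
    · by_contra hn
      obtain ⟨Y, hm, hY, hn'⟩ := X.2.exists_of_box_notMem hn
      exact hn' (h ⟨Y, hm⟩ hY)
    · exact fun h Y hY => hY _ h
  | mu φ ih =>
    have hpos := hφ.1.psub_upSub σ
    have key : ∀ ψ, semA (canon Act Atom) φ (Env.cons (truthSet ψ) fun n => truthSet (σ n)) =
        truthSet (instVar (psub (upSub σ) φ) 0 ψ) := by
      intro ψ
      rw [instVar_psub_upSub, ← ih hφ.2]
      congr 1
      funext n
      cases n <;> rfl
    refine Subset.antisymm ?_ ?_
    · refine lfpA_subset ⟨_, rfl⟩ ((key _).subset.trans ?_)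
      exact truthSet_subset (.muI hpos (Deriv.hyp ∅ _))
    · rintro X hX _ ⟨⟨ψ, rfl⟩, hψ⟩
      have hd := deriv_of_truthSet_subset ((key ψ).symm.subset.trans hψ)
      exact truthSet_subset (.muE hpos (Deriv.hyp ∅ _) hd) hX

end Canonical

/-- Translation of positive terms, with the variables in `s` replaced by their negations. -/
def PT.toFm : (ℕ → Bool) → PT Act → Fm Act Atom
  | s, .var n => bif s n then .neg (.var n) else .var n
  | s, .and t u => andFm (t.toFm s) (u.toFm s)
  | s, .or t u => .imp (.neg (t.toFm s)) (u.toFm s)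
  | s, .box a t => .box a (t.toFm s)
  | s, .dia a t => .neg (.box a (.neg (t.toFm s)))
  | s, .fix true t => .mu (t.toFm fun n => n.casesOn false s)
  | s, .fix false t => .neg (.mu (.neg (t.toFm fun n => n.casesOn true s)))

theorem PT.polin_toFm (t : PT Act) (s : ℕ → Bool) (x : ℕ) (b : Bool) (hb : b = !s x) :
    Polin b x (t.toFm s : Fm Act Atom) := by
  induction t generalizing s x b with
  | var n =>
    unfold PT.toFm
    by_cases h : n = x
    · subst h hb
      cases s n
      · exact .varPos _ _
      · exact .neg (.varPos _ _)
    · cases s n <;> cases b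
      exacts [.varNeg h, .varPos _ _, .neg (.varPos _ _), .neg (.varNeg h)]
  | and t u iht ihu =>
    exact .neg (.imp (by simpa using iht s x b hb) (.neg (by simpa using ihu s x b hb)))
  | or t u iht ihu => exact .imp (.neg (by simpa using iht s x b hb)) (ihu s x b hb)
  | box a t ih => exact .box a (ih s x b hb)
  | dia a t ih => exact .neg (.box a (.neg (by simpa using ih s x b hb)))
  | fix c t ih =>
    cases c
    · exact .neg (.mu (.neg (by simpa using ih _ (x + 1) b hb)))
    · exact .mu (ih _ (x + 1) b hb)

theorem PT.wf_toFm (t : PT Act) (s : ℕ → Bool) : Wf (t.toFm s : Fm Act Atom) := by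
  induction t generalizing s with
  | var n => unfold PT.toFm; cases s n <;> trivial
  | and t u iht ihu => exact ⟨iht s, ihu s⟩
  | or t u iht ihu => exact ⟨iht s, ihu s⟩
  | box a t ih => exact ih s
  | dia a t ih => exact ih s
  | fix c t ih =>
    cases c
    · exact ⟨.neg (PT.polin_toFm _ _ _ _ rfl), ih _⟩
    · exact ⟨PT.polin_toFm _ _ _ _ rfl, ih _⟩

theorem PT.semA_toFm (M : Frame Act Atom) (t : PT Act) (s : ℕ → Bool) (ρ : Env M.W) :
    semA M (t.toFm s) ρ = semPT M t fun n => bif s n then (ρ n)ᶜ else ρ n := by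
  induction t generalizing s ρ with
  | var n => unfold PT.toFm; simp only [semPT]; cases s n <;> rfl
  | and t u iht ihu => simp only [PT.toFm, andFm, semA, semPT, iht, ihu]; simp [compl_union]
  | or t u iht ihu => simp only [PT.toFm, semA, semPT, iht, ihu]; simp
  | box a t ih => simp only [PT.toFm, semA, semPT, ih]
  | dia a t ih =>
    simp only [PT.toFm, semA, semPT, ih]
    ext w
    simp [Frame.bx, Frame.dm]
  | fix c t ih =>
    cases c
    · refine congrArg compl (congrArg (lfpA M.Adm) (funext fun T => congrArg compl ?_))
      refine (ih _ _).trans (congrArg (semPT M t) (funext fun n => ?_))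
      cases n <;> rfl
    · refine congrArg (lfpA M.Adm) (funext fun T => ?_)
      refine (ih _ _).trans (congrArg (semPT M t) (funext fun n => ?_))
      cases n <;> rfl

theorem mem_semA_andFm {M : Frame Act Atom} {ρ : Env M.W} {φ ψ : Fm Act Atom} {w : M.W} :
    w ∈ semA M (andFm φ ψ) ρ ↔ w ∈ semA M φ ρ ∧ w ∈ semA M ψ ρ := by
  simp [andFm, semA]

theorem mem_semA_conjList {M : Frame Act Atom} {ρ : Env M.W} {l : List (Fm Act Atom)} {w : M.W} :
    w ∈ semA M (conjList l) ρ ↔ ∀ φ ∈ l, w ∈ semA M φ ρ := by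
  induction l with
  | nil => simp [conjList, semA]
  | cons φ l ih => rw [conjList, mem_semA_andFm, ih, List.forall_mem_cons]

theorem wf_conjList {l : List (Fm Act Atom)} (h : ∀ φ ∈ l, Wf φ) : Wf (conjList l) := by
  induction l with
  | nil => trivial
  | cons φ l ih =>
    rw [List.forall_mem_cons] at h
    exact ⟨h.1, ih h.2⟩

section Completeness
variable [DecidableEq Act] [DecidableEq Atom]

theorem semA_canon_mem {φ : Fm Act Atom} (hφ : Wf φ) {ρ : Env (canon Act Atom).W}
    (hρ : ∀ n, ρ n ∈ (canon Act Atom).Adm) : semA (canon Act Atom) φ ρ ∈ (canon Act Atom).Adm := by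
  choose σ hσ using hρ
  obtain rfl : (fun n => truthSet (σ n)) = ρ := funext hσ
  exact ⟨_, (semA_canon φ hφ σ).symm⟩

theorem canon_mf : MF (canon Act Atom) where
  univ_mem := ⟨.neg .ff, eq_univ_of_forall fun X => X.2.neg_mem.2 X.2.ff_notMem⟩
  compl_mem := by
    rintro _ ⟨φ, rfl⟩
    exact ⟨.neg φ, truthSet_neg φ⟩
  atom_mem p := ⟨_, rfl⟩
  pt_mem t ρ hρ := by
    have := semA_canon_mem (t.wf_toFm fun _ => false) hρ
    rwa [PT.semA_toFm] at this

/-- A finite consistent set of well-formed formulae has a Kripke model. -/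
theorem Consistent.exists_model {l : List (Fm Act Atom)} (hl : ∀ φ ∈ l, Wf φ)
    (hc : Consistent {φ | φ ∈ l}) :
    ∃ (S : Type) (V : Atom → Set S) (R : Act → S → Set S) (ρ : Env S) (s : S),
      ∀ φ ∈ l, s ∈ sem V R φ ρ := by
  obtain ⟨X, hX, hm⟩ := hc.exists_mcs
  have hwf := wf_conjList hl
  obtain ⟨A, hA⟩ := exists_actsIn (conjList l)
  obtain ⟨f, ⟨D, q, -, hD⟩, hf⟩ := exists_rep (conjList l) hwf hA true
  have hρ : ∀ n, truthSet (.var n) ∈ (canon Act Atom).Adm := fun n => ⟨_, rfl⟩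
  have hne : (D.val (canon Act Atom) (litVal (canon Act Atom) fun n => truthSet (.var n))
      q).Nonempty := by
    refine ⟨⟨X, hm⟩, ?_⟩
    rw [hD _ _ canon_mf (litVal_adm canon_mf hρ)]
    refine (hf _ _ canon_mf hρ).symm.subset (mem_semA_conjList.2 fun φ hφ => ?_)
    have := semA_canon φ (hl φ hφ) .var
    rw [psub_var] at this
    exact this.symm.subset (hX hφ : φ ∈ X)
  obtain ⟨S, V, R, ρ, s, hs⟩ := MuCalc.exists_model D canon_mf hρ hne
  refine ⟨S, V, R, ρ, s, ?_⟩
  have hF := fullFrame_mf V R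
  rw [hD _ _ hF fun _ => trivial] at hs
  have hs' := (hf _ _ hF fun _ => trivial).subset hs
  exact fun φ hφ => (semA_fullFrame V R φ ρ).subset (mem_semA_conjList.1 hs' φ hφ)

end Completeness

/-- soundness and completeness of N(μK): for finite `Γ` and `φ`
formulae, `Γ ⊢ φ` iff `Γ ⊨ φ`. -/
theorem soundness_and_completeness {Act Atom : Type} [DecidableEq Act] [DecidableEq Atom]
    (Γ : Finset (Fm Act Atom)) (φ : Fm Act Atom)
    (hΓ : ∀ γ ∈ Γ, Wf γ) (hφ : Wf φ) :
    Deriv Γ φ ↔ SemCons (↑Γ) φ := by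
  constructor
  · intro h S _ V R ρ s hs
    exact h.sound V R ρ fun γ hγ => mem_iInter₂.1 hs γ hγ
  · intro h
    by_contra hd
    obtain ⟨S, V, R, ρ, s, hs⟩ := Consistent.exists_model (l := .neg φ :: Γ.toList)
      (by simpa [Wf, hφ] using hΓ) fun Δ hΔ hff =>
        hd (.raa (hff.weak fun γ hγ => by simpa using hΔ hγ))
    rw [List.forall_mem_cons] at hs
    have : Nonempty S := ⟨s⟩
    exact hs.1 (h S V R ρ (mem_iInter₂.2 fun γ hγ => hs.2 γ (Finset.mem_toList.2 hγ)))

end MuCalc
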